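/- For every ε > 0 and integer d ≥ 1 there exists k = k(ε,d) ≥ 1 such that for all sufficiently large even n there is a coupling of G ~ μ_{d,n} and G_⊕ ~ ν_{kd,n} under which P(every edge of G is an edge of G_⊕) ≥ 1 − ε. -/

import Mathlib

open Filter Topology

/-- Degree of a vertex in a graph on `Fin n`. -/
noncomputable def gDeg {n : ℕ} (G : SimpleGraph (Fin n)) (v : Fin n) : ℕ :=
  Nat.card {w : Fin n // G.Adj v w}

/-- `G` is a `d`-regular graph. -/
def IsRegularGraph {n : ℕ} (G : SimpleGraph (Fin n)) (d : ℕ) : Prop :=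
  ∀ v, gDeg G v = d

open scoped Classical in
/-- The uniform probability distribution `μ_{d,n}` on the `d`-regular graphs on `{1,…,n}`. -/
noncomputable def mu (n d : ℕ) : SimpleGraph (Fin n) → ℝ := fun G =>
  if IsRegularGraph G d then
    (Nat.card {H : SimpleGraph (Fin n) // IsRegularGraph H d} : ℝ)⁻¹
  else 0

/-- `p` is a probability distribution on a finite or countable space. -/
def IsProbC {α : Type*} (p : α → ℝ) : Prop :=
  (∀ x, 0 ≤ p x) ∧ ∑' x, p x = 1

/-- Probability of an event `A` under the distribution `p`. -/
noncomputable def probOf {α : Type*} (p : α → ℝ) (A : Set α) : ℝ := ∑' x : A, p x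

/-- Total variation distance. -/
noncomputable def tvDist {α : Type*} (p q : α → ℝ) : ℝ := (1/2) * ∑' x, |p x - q x|

/-- `π` is a coupling of `p` and `q`. -/
def IsCoupling {α β : Type*} (π : α × β → ℝ) (p : α → ℝ) (q : β → ℝ) : Prop :=
  IsProbC π ∧ (∀ a, ∑' b, π (a, b) = p a) ∧ (∀ b, ∑' a, π (a, b) = q b)

/-- Expectation of `f` under the distribution `p`. -/
noncomputable def expec {α : Type*} (p f : α → ℝ) : ℝ := ∑' x, p x * f x

/-- Number of (ordered) 1-factorisations of `G` into `d` perfect matchings. -/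
noncomputable def nFact {n : ℕ} (d : ℕ) (G : SimpleGraph (Fin n)) : ℕ :=
  Nat.card {f : Fin d → SimpleGraph (Fin n) //
    (∀ i, IsRegularGraph (f i) 1) ∧ (∀ i j, i ≠ j → Disjoint (f i) (f j)) ∧ (⨆ i, f i) = G}

/-- The distribution `ν_{d,n}`, proportional to the number of 1-factorisations. -/
noncomputable def nu (n d : ℕ) : SimpleGraph (Fin n) → ℝ :=
  fun G => (nFact d G : ℝ) / ∑' H : SimpleGraph (Fin n), (nFact d H : ℝ)

namespace RegularCoupling

open scoped Classical
open Finset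

set_option linter.unusedSectionVars false

/-- Perfect matchings of a set of points, as involutions without fixed points. -/
structure PM (α : Type*) where
  /-- The partner of a point. -/
  toFun : α → α
  invol : ∀ x, toFun (toFun x) = x
  ne : ∀ x, toFun x ≠ x

instance {α : Type*} : CoeFun (PM α) (fun _ => α → α) := ⟨PM.toFun⟩

noncomputable instance {α : Type*} [Fintype α] : Fintype (PM α) :=
  Fintype.ofInjective PM.toFun (by rintro ⟨f, _, _⟩ ⟨g, _, _⟩ h; cases h; rfl)

namespace PM
variable {α β T : Type*}

@[ext] lemma ext {M N : PM α} (h : ∀ x, M x = N x) : M = N := by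
  obtain ⟨f, _, _⟩ := M; obtain ⟨g, _, _⟩ := N
  have : f = g := funext h
  subst this; rfl

@[simp] lemma apply_apply (M : PM α) (x : α) : M (M x) = x := M.invol x

lemma apply_ne (M : PM α) (x : α) : M x ≠ x := M.ne x

lemma injective (M : PM α) : Function.Injective M :=
  Function.LeftInverse.injective (g := M) M.invol

lemma apply_eq_iff (M : PM α) {x y : α} : M x = y ↔ x = M y := by
  constructor
  · rintro rfl; simp
  · rintro rfl; simp

/-- Relabelling the points of a perfect matching. -/
def conj (σ : Equiv.Perm α) (M : PM α) : PM α :=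
  mk (fun x => σ (M (σ.symm x))) (by simp) (fun x h => M.apply_ne (σ.symm x) (by
    apply σ.injective; simpa using h))

@[simp] lemma conj_apply (σ : Equiv.Perm α) (M : PM α) (x : α) :
    conj σ M x = σ (M (σ.symm x)) := rfl

/-- Transport of perfect matchings along a bijection. -/
def congr (e : α ≃ β) : PM α ≃ PM β where
  toFun M := mk (fun x => e (M (e.symm x))) (by simp) (fun x h => M.apply_ne (e.symm x) (by
    apply e.injective; simpa using h))
  invFun M := mk (fun x => e.symm (M (e x))) (by simp) (fun x h => M.apply_ne (e x) (by
    apply e.symm.injective; simpa using h))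
  left_inv M := by ext; simp
  right_inv M := by ext; simp

/-- A perfect matching preserving a colouring is a family of perfect matchings of the classes. -/
def piEquiv (κ : α → T) :
    {M : PM α // ∀ x, κ (M x) = κ x} ≃ ((t : T) → PM {x // κ x = t}) where
  toFun M t := mk (fun x => ⟨M.1 x.1, by rw [M.2, x.2]⟩) (fun x => by simp)
    (fun x h => M.1.apply_ne x.1 (congrArg Subtype.val h))
  invFun N := ⟨mk (fun x => (N (κ x) ⟨x, rfl⟩).1) (fun x => by
      have key : ∀ (t : T) (y : {x // κ x = t}) , ((N (κ y.1) ⟨y.1, rfl⟩).1) = (N t y).1 := by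
        rintro t ⟨y, rfl⟩; rfl
      rw [key (κ x) (N (κ x) ⟨x, rfl⟩)]; simp)
    (fun x h => (N (κ x)).apply_ne ⟨x, rfl⟩ (Subtype.ext h)),
    fun x => (N (κ x) ⟨x, rfl⟩).2⟩
  left_inv M := by ext; rfl
  right_inv N := by
    funext t; ext ⟨x, rfl⟩; rfl

end PM

/-- The number of perfect matchings of a set of `n` points. -/
def pm : ℕ → ℕ
  | 0 => 1
  | 1 => 0
  | n + 2 => (n + 1) * pm n

lemma card_PM_two {α : Type*} [Fintype α] (h : Fintype.card α = 2) : Fintype.card (PM α) = 1 := by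
  obtain ⟨x, y, hxy, hu⟩ := Finset.card_eq_two.1 (by simpa using h : (univ : Finset α).card = 2)
  have hu' : ∀ z, z = x ∨ z = y := fun z => by simpa [hu] using Finset.mem_univ z
  rw [Fintype.card_eq_one_iff]
  have hM : ∀ (M : PM α) z, M z = if z = x then y else x := by
    intro M z
    rcases hu' z with rfl | rfl
    · simpa [M.apply_ne] using hu' (M z)
    · rw [if_neg hxy.symm]
      simpa [M.apply_ne] using hu' (M z)
  refine ⟨PM.mk (fun z => if z = x then y else x) (fun z => ?_) (fun z => ?_), fun M => ?_⟩
  · rcases hu' z with rfl | rfl <;> simp [hxy.symm]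
  · rcases hu' z with rfl | rfl <;> simp [hxy, hxy.symm]
  · ext z; rw [hM]

theorem card_PM_preserving {α T : Type*} [Fintype α] [Fintype T] (κ : α → T)
    [Fintype {M : PM α // ∀ x, κ (M x) = κ x}] [∀ t, Fintype {x // κ x = t}] :
    Fintype.card {M : PM α // ∀ x, κ (M x) = κ x} =
      ∏ t, Fintype.card (PM {x // κ x = t}) := by
  rw [Fintype.card_congr (PM.piEquiv κ), Fintype.card_pi]

theorem card_PM {α : Type*} [Fintype α] : Fintype.card (PM α) = pm (Fintype.card α) := by
  generalize hn : Fintype.card α = n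
  induction n using Nat.strong_induction_on generalizing α with
  | _ n ih =>
  match n, hn with
  | 0, hn =>
    have := Fintype.card_eq_zero_iff.1 hn
    rw [pm, Fintype.card_eq_one_iff]
    exact ⟨PM.mk id (fun x => rfl) (fun x => isEmptyElim x), fun M => PM.ext fun x => isEmptyElim x⟩
  | 1, hn =>
    obtain ⟨x, hx⟩ := Fintype.card_eq_one_iff.1 hn
    rw [pm, Fintype.card_eq_zero_iff]
    exact ⟨fun M => M.apply_ne x (hx _)⟩
  | n + 2, hn =>
    have : Nonempty α := Fintype.card_pos_iff.1 (by omega)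
    obtain ⟨x⟩ := this
    have h1 : Fintype.card (PM α) = ∑ y ∈ univ.erase x, (univ.filter fun M : PM α => M x = y).card := by
      rw [← Finset.card_univ]
      apply Finset.card_eq_sum_card_fiberwise
      intro M _
      simp [M.apply_ne]
    have h2 : ∀ y ∈ univ.erase x, (univ.filter fun M : PM α => M x = y).card = pm n := by
      intro y hy
      have hyx : y ≠ x := by simpa using hy
      obtain ⟨κ, hκ⟩ : ∃ κ : α → Bool, ∀ z, κ z = true ↔ z = x ∨ z = y :=
        ⟨fun z => decide (z = x ∨ z = y), fun z => by simp⟩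
      have h4 : (univ.filter fun M : PM α => M x = y).card =
          Fintype.card {M : PM α // ∀ z, κ (M z) = κ z} := by
        rw [Fintype.card_subtype]
        congr 1
        ext M
        simp only [Finset.mem_filter, Finset.mem_univ, true_and, Bool.eq_iff_iff, hκ]
        constructor
        · intro h z
          have h' : M y = x := by rw [← h]; simp
          rw [M.apply_eq_iff, M.apply_eq_iff, h, h', or_comm]
        · intro h
          have := (h x).2 (Or.inl rfl)
          simpa [M.apply_ne] using this
      rw [h4, card_PM_preserving, Fintype.prod_bool]
      have hc : Fintype.card {z // κ z = true} = 2 := by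
        rw [Fintype.card_subtype]
        have : (univ.filter fun z => κ z = true) = {x, y} := by
          ext z; simp [hκ]
        rw [this, Finset.card_pair hyx.symm]
      have hc' : Fintype.card {z // κ z = false} = n := by
        have h5 := Fintype.card_subtype_compl (fun z => κ z = true)
        rw [hc, hn] at h5
        simp only [Bool.not_eq_true] at h5
        simpa using h5
      rw [card_PM_two hc, ih n (by omega) hc', one_mul]
    rw [h1, Finset.sum_congr rfl h2]
    simp [Finset.card_erase_of_mem, hn, pm]

lemma pm_eq_zero {n : ℕ} (h : ¬ Even n) : pm n = 0 := by
  induction n using Nat.strong_induction_on with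
  | _ n ih =>
    match n with
    | 0 => simp at h
    | 1 => rfl
    | n + 2 =>
      rw [pm, ih n (by omega) (by simpa [Nat.even_add] using h), mul_zero]

lemma pm_pos (m : ℕ) : 0 < pm (2 * m) := by
  induction m with
  | zero => simp [pm]
  | succ m ih => rw [mul_add, mul_one, pm]; positivity

lemma pm_mul (m : ℕ) : pm (2 * m) * (2 ^ m * m.factorial) = (2 * m).factorial := by
  induction m with
  | zero => simp [pm]
  | succ m ih =>
    rw [mul_add, mul_one, pm, Nat.factorial_succ (2 * m + 1), Nat.factorial_succ (2 * m), ← ih,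
      Nat.factorial_succ, pow_succ]
    ring

lemma PM.even_card {α : Type*} [Fintype α] (M : PM α) : Even (Fintype.card α) := by
  by_contra h
  have := card_PM (α := α)
  rw [pm_eq_zero h, Fintype.card_eq_zero_iff] at this
  exact this.false M

/-- The points of a perfect matching, listed pair by pair. -/
lemma PM.exists_enum {α : Type*} [Fintype α] (M : PM α) :
    ∃ (m : ℕ) (φ : Fin m × Bool ≃ α), Fintype.card α = 2 * m ∧ ∀ k b, M (φ (k, b)) = φ (k, !b) := by
  let e := Fintype.equivFin α
  let R := {x : α // e x < e (M x)}
  let ψ : R × Bool ≃ α :=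
    { toFun := fun p => if p.2 then p.1.1 else M p.1.1
      invFun := fun x => if h : e x < e (M x) then (⟨x, h⟩, true) else
        (⟨M x, by
          rw [M.apply_apply]
          exact lt_of_le_of_ne (not_lt.1 h) (fun h' => M.apply_ne x (e.injective h'))⟩, false)
      left_inv := by
        rintro ⟨⟨x, hx⟩, b⟩
        cases b
        · simp [not_lt.2 hx.le]
        · simp [hx]
      right_inv := by
        intro x
        by_cases h : e x < e (M x) <;> simp [h] }
  let f := Fintype.equivFin R
  refine ⟨Fintype.card R, (Equiv.prodCongr f.symm (Equiv.refl _)).trans ψ, ?_, ?_⟩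
  · exact (Fintype.card_congr ψ).symm.trans (by rw [Fintype.card_prod, Fintype.card_bool, mul_comm])
  · intro k b
    cases b <;> simp [ψ]

/-- The Stirling approximation `(n / e) ^ (n / 2)` to the number of perfect matchings. -/
noncomputable def phi (n : ℕ) : ℝ := Real.exp ((n : ℝ) / 2 * (Real.log n - 1))

lemma phi_pos (n : ℕ) : 0 < phi n := Real.exp_pos _

lemma pm_eq_phi_mul (m : ℕ) (hm : m ≠ 0) : (pm (2 * m) : ℝ) =
    √2 * (Stirling.stirlingSeq (2 * m) / Stirling.stirlingSeq m) * phi (2 * m) := by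
  have h := congrArg (Nat.cast : ℕ → ℝ) (pm_mul m)
  push_cast at h
  have hm0 : (0 : ℝ) < m := by positivity
  have hphi : phi (2 * m) = (2 * m / Real.exp 1) ^ m := by
    have h2 : (0 : ℝ) < 2 * m / Real.exp 1 := by positivity
    rw [phi, ← Real.exp_log h2, ← Real.exp_nat_mul, Real.log_div (by positivity) (by positivity),
      Real.log_exp]
    push_cast
    ring_nf
  have h3 : (pm (2 * m) : ℝ) = (2 * m).factorial / (2 ^ m * m.factorial) := by
    rw [eq_div_iff (by positivity), h]
  rw [h3, hphi, Stirling.stirlingSeq, Stirling.stirlingSeq]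
  push_cast
  have h4 : √(2 * (2 * (m : ℝ))) = √2 * √(2 * m) := by rw [Real.sqrt_mul (by norm_num)]
  rw [h4]
  have : √(2 * (m : ℝ)) ≠ 0 := by positivity
  have : √(2 : ℝ) ≠ 0 := by positivity
  field_simp
  rw [← mul_pow, ← mul_pow, two_mul m, pow_add, ← mul_pow]
  ring_nf

lemma pm_le_two_mul_phi (m : ℕ) : (pm (2 * m) : ℝ) ≤ 2 * phi (2 * m) := by
  rcases eq_or_ne m 0 with rfl | hm
  · simp [pm, phi]
  obtain ⟨k, rfl⟩ := Nat.exists_eq_succ_of_ne_zero hm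
  rw [pm_eq_phi_mul _ hm]
  gcongr
  · exact (phi_pos _).le
  have h1 : Stirling.stirlingSeq (2 * (k + 1)) ≤ Stirling.stirlingSeq (k + 1) := by
    have := Stirling.stirlingSeq'_antitone (show k ≤ 2 * k + 1 by omega)
    simpa [mul_add] using this
  have h2 : 0 < Stirling.stirlingSeq (k + 1) := Stirling.stirlingSeq'_pos k
  have h3 : Stirling.stirlingSeq (2 * (k + 1)) / Stirling.stirlingSeq (k + 1) ≤ 1 :=
    (div_le_one h2).2 h1
  have h4 : √2 ≤ 2 := by rw [Real.sqrt_le_left] <;> norm_num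
  have h5 : 0 ≤ √2 := by positivity
  simp only [Nat.succ_eq_add_one]
  nlinarith

lemma phi_le_pm (m : ℕ) : phi (2 * m) ≤ pm (2 * m) := by
  rcases eq_or_ne m 0 with rfl | hm
  · simp [pm, phi]
  obtain ⟨k, rfl⟩ := Nat.exists_eq_succ_of_ne_zero hm
  rw [pm_eq_phi_mul _ hm]
  refine le_mul_of_one_le_left (phi_pos _).le ?_
  simp only [Nat.succ_eq_add_one]
  have h1 : √Real.pi ≤ Stirling.stirlingSeq (2 * (k + 1)) := Stirling.sqrt_pi_le_stirlingSeq (by omega)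
  have h2 : 0 < Stirling.stirlingSeq (k + 1) := Stirling.stirlingSeq'_pos k
  have h3 : Stirling.stirlingSeq (k + 1) ≤ Real.exp 1 / √2 := by
    have := Stirling.stirlingSeq'_antitone (show 0 ≤ k by omega)
    simpa [Stirling.stirlingSeq_one] using this
  rw [mul_div_assoc', one_le_div h2]
  refine h3.trans ?_
  rw [div_le_iff₀ (by positivity)]
  have h4 : √2 * √2 = 2 := Real.mul_self_sqrt (by norm_num)
  have h5 : (1.7 : ℝ) ≤ √Real.pi := by
    apply Real.le_sqrt_of_sq_le
    have := Real.pi_gt_three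
    norm_num; linarith
  have := Real.exp_one_lt_d9
  nlinarith

lemma pm_mul_pm (k l : ℕ) : pm (2 * k) * pm (2 * l) * (2 * (k + l)).choose (2 * k) =
    (k + l).choose k * pm (2 * (k + l)) := by
  have h1 := pm_mul k
  have h2 := pm_mul l
  have h3 := pm_mul (k + l)
  have h4 := Nat.add_choose_mul_factorial_mul_factorial l k
  have h5 := Nat.add_choose_mul_factorial_mul_factorial (2 * l) (2 * k)
  rw [← mul_add, add_comm l k] at h5
  rw [add_comm l k] at h4
  have hk := k.factorial_pos
  have hl := l.factorial_pos
  have hp : 0 < 2 ^ k * k.factorial * (2 ^ l * l.factorial) := by positivity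
  apply Nat.eq_of_mul_eq_mul_right hp
  calc _ = (2 * (k + l)).choose (2 * k) * (pm (2 * l) * (2 ^ l * l.factorial)) *
        (pm (2 * k) * (2 ^ k * k.factorial)) := by ring
    _ = pm (2 * (k + l)) * (2 ^ (k + l) * (k + l).factorial) := by rw [h1, h2, h5, h3]
    _ = _ := by rw [← h4, pow_add]; ring

/-- A special case of Vandermonde's identity. -/
lemma choose_sq_le (m k : ℕ) : m.choose k ^ 2 ≤ (2 * m).choose (2 * k) := by
  rw [two_mul m, two_mul k, Nat.add_choose_eq, sq]
  exact Finset.single_le_sum (f := fun ij : ℕ × ℕ => m.choose ij.1 * m.choose ij.2)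
    (fun _ _ => Nat.zero_le _) (show (k, k) ∈ antidiagonal (k + k) by simp)

section Switching
variable {𝓜 X : Type*} [Fintype X] {S : Finset 𝓜} {sw : X → 𝓜 → 𝓜} {Y : 𝓜 → ℕ}
  {Fwd : 𝓜 → Finset X} {a C : ℕ}

lemma switching_double_count (hinv : ∀ x M, sw x (sw x M) = M)
    (h3 : ∀ M ∈ S, (univ.filter fun x => sw x M ∈ S ∧ x ∈ Fwd (sw x M)).card ≤ C * a)
    (T T' : Finset 𝓜) (hT : T ⊆ S) (hT' : T' ⊆ S)
    (h : ∀ M ∈ T, ∀ x ∈ Fwd M, sw x M ∈ T') :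
    ∑ M ∈ T, (Fwd M).card ≤ C * a * T'.card := by
  calc ∑ M ∈ T, (Fwd M).card = (T.sigma Fwd).card := (card_sigma _ _).symm
    _ ≤ (T'.sigma fun M => univ.filter fun x => sw x M ∈ S ∧ x ∈ Fwd (sw x M)).card := by
        refine card_le_card_of_injOn (fun p => ⟨sw p.2 p.1, p.2⟩) ?_ ?_
        · rintro ⟨M, x⟩ hp
          simp only [coe_sigma, Set.mem_sigma_iff, mem_coe] at hp
          simp only [coe_sigma, Set.mem_sigma_iff, mem_coe, mem_filter, mem_univ, true_and, hinv]
          exact ⟨h M hp.1 x hp.2, hT hp.1, hp.2⟩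
        · rintro ⟨M, x⟩ _ ⟨M', x'⟩ _ hxx
          simp only [Sigma.mk.injEq, heq_eq_eq] at hxx
          obtain ⟨h1, rfl⟩ := hxx
          have := congrArg (sw x) h1
          simp only [hinv] at this
          simp [this]
    _ = ∑ M ∈ T', _ := card_sigma _ _
    _ ≤ ∑ M ∈ T', C * a := sum_le_sum fun M hM => h3 M (hT' hM)
    _ = C * a * T'.card := by rw [sum_const, smul_eq_mul, mul_comm]

/-- If the obstructions counted by `Y` can be removed by many switchings and created by few, then
a positive proportion of the objects has no obstruction. -/
theorem switching_positive (hinv : ∀ x M, sw x (sw x M) = M) (ha : 0 < a)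
    (h1 : ∀ M ∈ S, Y M * a ≤ (Fwd M).card)
    (h2 : ∀ M ∈ S, ∀ x ∈ Fwd M, sw x M ∈ S ∧ Y (sw x M) < Y M)
    (h3 : ∀ M ∈ S, (univ.filter fun x => sw x M ∈ S ∧ x ∈ Fwd (sw x M)).card ≤ C * a) :
    S.card ≤ 2 * (1 + C) ^ (2 * C) * (S.filter fun M => Y M = 0).card := by
  have step : ∀ k, (S.filter fun M => Y M < k + 1).card ≤
      (1 + C) ^ k * (S.filter fun M => Y M = 0).card := by
    intro k
    induction k with
    | zero => simp
    | succ k ih =>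
      have hd := switching_double_count hinv h3 (S.filter fun M => Y M = k + 1)
        (S.filter fun M => Y M < k + 1) (filter_subset _ _) (filter_subset _ _) (by
          intro M hM x hx
          rw [mem_filter] at hM ⊢
          obtain ⟨q1, q2⟩ := h2 M hM.1 x hx
          exact ⟨q1, by omega⟩)
      have hl : (S.filter fun M => Y M = k + 1).card * a ≤
          ∑ M ∈ S.filter fun M => Y M = k + 1, (Fwd M).card := by
        rw [← smul_eq_mul, ← sum_const]
        refine sum_le_sum fun M hM => ?_
        rw [mem_filter] at hM
        have := h1 M hM.1
        rw [hM.2] at this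
        nlinarith
      have hk : (S.filter fun M => Y M = k + 1).card ≤ C * (S.filter fun M => Y M < k + 1).card := by
        have := hl.trans hd
        refine le_of_mul_le_mul_right ?_ ha
        linarith
      have hs : (S.filter fun M => Y M < k + 1 + 1).card ≤
          (S.filter fun M => Y M < k + 1).card + (S.filter fun M => Y M = k + 1).card := by
        refine (card_le_card ?_).trans (card_union_le _ _)
        intro M hM
        simp only [mem_filter, mem_union] at hM ⊢
        rcases Nat.lt_succ_iff_lt_or_eq.1 hM.2 with h | h
        · exact Or.inl ⟨hM.1, h⟩
        · exact Or.inr ⟨hM.1, h⟩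
      calc _ ≤ _ := hs
        _ ≤ (1 + C) * (S.filter fun M => Y M < k + 1).card := by linarith
        _ ≤ (1 + C) * ((1 + C) ^ k * (S.filter fun M => Y M = 0).card) := by gcongr
        _ = _ := by ring
  have hsum : ∑ M ∈ S, Y M ≤ C * S.card := by
    have hd := switching_double_count hinv h3 S S subset_rfl subset_rfl (fun M hM x hx => (h2 M hM x hx).1)
    have := (sum_le_sum h1).trans hd
    rw [← sum_mul] at this
    refine le_of_mul_le_mul_right ?_ ha
    linarith
  have hbig : (2 * C + 1) * (S.filter fun M => ¬ Y M < 2 * C + 1).card ≤ C * S.card := by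
    refine le_trans ?_ hsum
    refine le_trans ?_ (sum_le_sum_of_subset (filter_subset (fun M => ¬ Y M < 2 * C + 1) S))
    rw [mul_comm, ← smul_eq_mul, ← sum_const]
    refine sum_le_sum fun M hM => ?_
    rw [mem_filter] at hM
    omega
  have htot := card_filter_add_card_filter_not (s := S) (fun M => Y M < 2 * C + 1)
  have := step (2 * C)
  rw [mul_assoc]
  nlinarith

end Switching

section SimplePairings
variable {Q V J : Type*} [Fintype Q] [Fintype V] [Fintype J] (vert : Q → V) (col : Q → J)
  (U : V → V → Prop)

/-- Two points that must not be matched. -/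
def Forbidden (p q : Q) : Prop := vert p = vert q ∨ U (vert p) (vert q)

/-- The pairing produces an edge parallel to that of `p`. -/
def IsMultiple (M : PM Q) (p : Q) : Prop :=
  ∃ p', p' ≠ p ∧ vert p' = vert p ∧ vert (M p') = vert (M p)

variable {vert col U}

lemma Forbidden.symm (hU : ∀ u v, U u v → U v u) {p q : Q} (h : Forbidden vert U p q) :
    Forbidden vert U q p := h.imp Eq.symm (hU _ _)

lemma isMultiple_apply {M : PM Q} {p : Q} (h : IsMultiple vert M (M p)) : IsMultiple vert M p := by
  obtain ⟨p', h1, h2, h3⟩ := h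
  refine ⟨M p', fun h => h1 ?_, by simpa using h3, by simpa using h2⟩
  rw [← h]; simp

lemma card_forbidden_le {D : ℕ} (hv : ∀ v, (univ.filter fun q => vert q = v).card ≤ D)
    (hD : ∀ u, (univ.filter fun v => U u v).card ≤ D) (p : Q) :
    (univ.filter fun q => Forbidden vert U p q).card ≤ D + D * D := by
  have : (univ.filter fun q => Forbidden vert U p q) ⊆ (univ.filter fun q => vert q = vert p) ∪
      (univ.filter fun v => U (vert p) v).biUnion fun v => univ.filter fun q => vert q = v := by
    intro q hq
    simp only [mem_filter, mem_univ, true_and, mem_union, mem_biUnion] at hq ⊢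
    rcases hq with h | h
    · exact Or.inl h.symm
    · exact Or.inr ⟨_, h, rfl⟩
  refine (card_le_card this).trans ((card_union_le _ _).trans (add_le_add (hv _) ?_))
  refine (card_biUnion_le_card_mul _ _ D fun v _ => hv v).trans ?_
  exact Nat.mul_le_mul_right _ (hD _)

lemma card_filter_apply (M : PM Q) (P : Q → Prop) [DecidablePred P]
    [DecidablePred fun q => P (M q)] :
    (univ.filter fun q => P (M q)).card = (univ.filter P).card := by
  refine card_bij (fun q _ => M q) ?_ (fun a _ b _ h => M.injective h) ?_
  · intro q; simp
  · intro q hq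
    exact ⟨M q, by simpa using hq, by simp⟩

/-- The points that can be switched with `p`. -/
noncomputable def partners (vert : Q → V) (col : Q → J) (U : V → V → Prop) (M : PM Q) (p : Q) :
    Finset Q :=
  univ.filter fun q => col q = col p ∧ q ≠ p ∧ q ≠ M p ∧ ¬ Forbidden vert U p (M q) ∧
    ¬ Forbidden vert U q (M p) ∧ vert q ≠ vert p ∧
    (∀ x, vert x = vert p → vert (M x) ≠ vert (M q)) ∧
    (∀ x, vert x = vert q → vert (M x) ≠ vert (M p))

lemma le_card_partners {D a : ℕ} (hU : ∀ u v, U u v → U v u)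
    (hv : ∀ v, (univ.filter fun q => vert q = v).card ≤ D)
    (hD : ∀ u, (univ.filter fun v => U u v).card ≤ D)
    (hc : ∀ p, a + (2 + 3 * D + 4 * (D * D)) ≤ (univ.filter fun q => col q = col p).card)
    (M : PM Q) (p : Q) : a ≤ (partners vert col U M p).card := by
  have hsub : (univ.filter fun q => col q = col p) ⊆ partners vert col U M p ∪
      (({p, M p} : Finset Q) ∪ ((univ.filter fun q => Forbidden vert U p (M q)) ∪
      ((univ.filter fun q => Forbidden vert U (M p) q) ∪ ((univ.filter fun q => vert q = vert p) ∪
      ((univ.filter fun q => ∃ x, vert x = vert p ∧ vert (M x) = vert (M q)) ∪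
      (univ.filter fun q => ∃ x, vert x = vert q ∧ vert (M x) = vert (M p))))))) := by
    intro q hq
    simp only [mem_filter, mem_univ, true_and] at hq
    simp only [partners, mem_union, mem_filter, mem_univ, true_and, mem_insert, mem_singleton]
    by_contra hcon
    simp only [not_or] at hcon
    obtain ⟨h1, ⟨h2, h3⟩, h4, h5, h6, h7, h8⟩ := hcon
    exact h1 ⟨hq, h2, h3, h4, fun h => h5 (h.symm hU), h6, fun x hx hx' => h7 ⟨x, hx, hx'⟩,
      fun x hx hx' => h8 ⟨x, hx, hx'⟩⟩
  have c1 := card_forbidden_le hv hD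
  have c2 : (univ.filter fun q => ∃ x, vert x = vert p ∧ vert (M x) = vert (M q)).card ≤ D * D := by
    rw [card_filter_apply M fun q => ∃ x, vert x = vert p ∧ vert (M x) = vert q]
    have : (univ.filter fun q => ∃ x, vert x = vert p ∧ vert (M x) = vert q) ⊆
        (univ.filter fun x => vert x = vert p).biUnion
          fun x => univ.filter fun q => vert q = vert (M x) := by
      intro q
      simp only [mem_filter, mem_univ, true_and, mem_biUnion]
      rintro ⟨x, h, h'⟩
      exact ⟨x, h, h'.symm⟩
    exact (card_le_card this).trans ((card_biUnion_le_card_mul _ _ D fun v _ => hv _).trans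
      (Nat.mul_le_mul_right _ (hv _)))
  have c3 : (univ.filter fun q => ∃ x, vert x = vert q ∧ vert (M x) = vert (M p)).card ≤ D * D := by
    have : (univ.filter fun q => ∃ x, vert x = vert q ∧ vert (M x) = vert (M p)) ⊆
        (univ.filter fun x => vert (M x) = vert (M p)).biUnion
          fun x => univ.filter fun q => vert q = vert x := by
      intro q
      simp only [mem_filter, mem_univ, true_and, mem_biUnion]
      rintro ⟨x, h, h'⟩
      exact ⟨x, h', h.symm⟩
    refine (card_le_card this).trans ((card_biUnion_le_card_mul _ _ D fun v _ => hv _).trans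
      (Nat.mul_le_mul_right _ ?_))
    rw [card_filter_apply M fun q => vert q = vert (M p)]
    exact hv _
  have c4 := card_filter_apply M (Forbidden vert U p)
  have c5 : ({p, M p} : Finset Q).card ≤ 2 := card_le_two
  have := (hc p).trans ((card_le_card hsub).trans <| (card_union_le _ _).trans <|
    Nat.add_le_add_left ((card_union_le _ _).trans <| Nat.add_le_add_left ((card_union_le _ _).trans
    <| Nat.add_le_add_left ((card_union_le _ _).trans <| Nat.add_le_add_left
    ((card_union_le _ _).trans <| Nat.add_le_add_left (card_union_le _ _) _) _) _) _) _)
  have := c1 p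
  have := c1 (M p)
  have := hv (vert p)
  linarith

section swap
variable {M : PM Q} {p q : Q}

lemma conj_swap_conj_swap (x : Q × Q) (M : PM Q) :
    PM.conj (Equiv.swap x.1 x.2) (PM.conj (Equiv.swap x.1 x.2) M) = M := by
  ext y; simp

lemma conj_swap_left (h' : q ≠ M p) : PM.conj (Equiv.swap p q) M p = M q := by
  rw [PM.conj_apply, Equiv.symm_swap, Equiv.swap_apply_left]
  exact Equiv.swap_apply_of_ne_of_ne (fun h => h' (M.apply_eq_iff.1 h)) (M.apply_ne q)

lemma conj_swap_right (h' : q ≠ M p) : PM.conj (Equiv.swap p q) M q = M p := by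
  rw [PM.conj_apply, Equiv.symm_swap, Equiv.swap_apply_right]
  exact Equiv.swap_apply_of_ne_of_ne (M.apply_ne p) h'.symm

lemma conj_swap_of_ne {x : Q} (h1 : x ≠ p) (h2 : x ≠ q) (h3 : x ≠ M p) (h4 : x ≠ M q) :
    PM.conj (Equiv.swap p q) M x = M x := by
  rw [PM.conj_apply, Equiv.symm_swap, Equiv.swap_apply_of_ne_of_ne h1 h2]
  exact Equiv.swap_apply_of_ne_of_ne (fun h => h3 (M.apply_eq_iff.1 h))
    (fun h => h4 (M.apply_eq_iff.1 h))

lemma conj_swap_col (hM : ∀ x, col (M x) = col x) (h : col q = col p) (x : Q) :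
    col (PM.conj (Equiv.swap p q) M x) = col x := by
  have hs : ∀ y, col (Equiv.swap p q y) = col y := by
    intro y
    rcases eq_or_ne y p with rfl | h1
    · simpa
    rcases eq_or_ne y q with rfl | h2
    · simpa using h.symm
    rw [Equiv.swap_apply_of_ne_of_ne h1 h2]
  rw [PM.conj_apply, hs, hM, Equiv.symm_swap, hs]

lemma forbidden_of_forbidden_conj_swap (hU : ∀ u v, U u v → U v u)
    (hq : q ∈ partners vert col U M p) {x : Q}
    (hx : Forbidden vert U x (PM.conj (Equiv.swap p q) M x)) :
    Forbidden vert U x (M x) ∧ x ≠ p := by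
  simp only [partners, mem_filter, mem_univ, true_and] at hq
  obtain ⟨h0, h1, h2, h3, h4, -⟩ := hq
  have e1 := conj_swap_left h2
  have e2 := conj_swap_right h2
  have n1 : x ≠ p := by rintro rfl; rw [e1] at hx; exact h3 hx
  have n2 : x ≠ q := by rintro rfl; rw [e2] at hx; exact h4 hx
  have n3 : x ≠ M p := by
    rintro rfl
    rw [← e2, PM.apply_apply, e2] at hx
    exact h4 (hx.symm hU)
  have n4 : x ≠ M q := by
    rintro rfl
    rw [← e1, PM.apply_apply, e1] at hx
    exact h3 (hx.symm hU)
  rw [conj_swap_of_ne n1 n2 n3 n4] at hx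
  exact ⟨hx, n1⟩

lemma isMultiple_of_isMultiple_conj_swap (hM : ∀ x, ¬ Forbidden vert U x (M x))
    (hq : q ∈ partners vert col U M p) {x : Q}
    (hx : IsMultiple vert (PM.conj (Equiv.swap p q) M) x) :
    IsMultiple vert M x ∧ x ≠ p := by
  simp only [partners, mem_filter, mem_univ, true_and] at hq
  obtain ⟨h0, h1, h2, h3, h4, h5, h6, h7⟩ := hq
  have e1 := conj_swap_left h2
  have e2 := conj_swap_right h2
  have e3 : PM.conj (Equiv.swap p q) M (M p) = q := by rw [← e2, PM.apply_apply]
  have e4 : PM.conj (Equiv.swap p q) M (M q) = p := by rw [← e1, PM.apply_apply]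
  have vp : vert p ≠ vert (M p) := fun h => hM p (Or.inl h)
  have vq : vert q ≠ vert (M q) := fun h => hM q (Or.inl h)
  have vpq : vert p ≠ vert (M q) := fun h => h3 (Or.inl h)
  have vqp : vert q ≠ vert (M p) := fun h => h4 (Or.inl h)
  have b1 : ¬ IsMultiple vert (PM.conj (Equiv.swap p q) M) p := by
    rintro ⟨y, y1, y2, y3⟩
    rw [e1] at y3
    have n2 : y ≠ q := by rintro rfl; exact h5 y2
    have n3 : y ≠ M p := by rintro rfl; exact vp y2.symm
    have n4 : y ≠ M q := by rintro rfl; exact vpq y2.symm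
    rw [conj_swap_of_ne y1 n2 n3 n4] at y3
    exact h6 y y2 y3
  have b2 : ¬ IsMultiple vert (PM.conj (Equiv.swap p q) M) q := by
    rintro ⟨y, y1, y2, y3⟩
    rw [e2] at y3
    have n1 : y ≠ p := by rintro rfl; exact h5 y2.symm
    have n3 : y ≠ M p := by rintro rfl; exact vqp y2.symm
    have n4 : y ≠ M q := by rintro rfl; exact vq y2.symm
    rw [conj_swap_of_ne n1 y1 n3 n4] at y3
    exact h7 y y2 y3
  have b3 : ¬ IsMultiple vert (PM.conj (Equiv.swap p q) M) (M p) := by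
    intro h; rw [← e2] at h; exact b2 (isMultiple_apply h)
  have b4 : ¬ IsMultiple vert (PM.conj (Equiv.swap p q) M) (M q) := by
    intro h; rw [← e1] at h; exact b1 (isMultiple_apply h)
  have key : ∀ y, IsMultiple vert (PM.conj (Equiv.swap p q) M) y →
      PM.conj (Equiv.swap p q) M y = M y ∧ y ≠ p := by
    intro y hy
    have n1 : y ≠ p := by rintro rfl; exact b1 hy
    refine ⟨conj_swap_of_ne n1 ?_ ?_ ?_, n1⟩ <;> (rintro rfl; first | exact b2 hy | exact b3 hy | exact b4 hy)
  have hx' := hx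
  obtain ⟨y, y1, y2, y3⟩ := hx
  have hy := (key y ⟨x, y1.symm, y2.symm, y3.symm⟩).1
  rw [(key x hx').1, hy] at y3
  exact ⟨⟨y, y1, y2, y3⟩, (key x hx').2⟩

end swap

variable (vert col U)

/-- The colour-preserving pairings without forbidden pairs and without multiple edges. -/
def IsSimplePairing (M : PM Q) : Prop :=
  (∀ x, ¬ Forbidden vert U x (M x)) ∧ ∀ x, ¬ IsMultiple vert M x

variable {vert col U}

lemma card_filter_prod_le {X Y : Type*} [Fintype X] [Fintype Y] (P : X → Y → Prop)
    [∀ x, DecidablePred (P x)] [DecidablePred fun z : X × Y => P z.1 z.2] (b : ℕ)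
    (h : ∀ x, (univ.filter (P x)).card ≤ b) :
    (univ.filter fun z : X × Y => P z.1 z.2).card ≤ Fintype.card X * b := by
  have : (univ.filter fun z : X × Y => P z.1 z.2) ⊆
      (univ : Finset X).biUnion fun x => (univ.filter (P x)).image fun y => (x, y) := by
    rintro ⟨x, y⟩ hz
    simpa using hz
  exact (card_le_card this).trans (card_biUnion_le_card_mul _ _ b
    fun x _ => card_image_le.trans (h x))

lemma le_card_filter_prod {X Y : Type*} [Fintype X] [Fintype Y] (P : X → Prop) [DecidablePred P]
    (R : X → Finset Y) [DecidablePred fun z : X × Y => P z.1 ∧ z.2 ∈ R z.1] (b : ℕ) (h : ∀ x, b ≤ (R x).card) :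
    (univ.filter P).card * b ≤ (univ.filter fun z : X × Y => P z.1 ∧ z.2 ∈ R z.1).card := by
  calc (univ.filter P).card * b ≤ ∑ x ∈ univ.filter P, (R x).card := by
        rw [← smul_eq_mul, ← sum_const]; exact sum_le_sum fun x _ => h x
    _ = ((univ.filter P).sigma R).card := (card_sigma _ _).symm
    _ ≤ _ := card_le_card_of_injOn (fun z => (z.1, z.2)) (by rintro ⟨x, y⟩; simp)
        (by rintro ⟨x, y⟩ _ ⟨x', y'⟩ _ h; simpa using h)

/-- A positive proportion of the colour-preserving pairings is simple. -/
theorem card_le_card_isSimplePairing {D a C : ℕ} (hU : ∀ u v, U u v → U v u) (ha : 0 < a)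
    (hv : ∀ v, (univ.filter fun q => vert q = v).card ≤ D)
    (hD : ∀ u, (univ.filter fun v => U u v).card ≤ D)
    (hc : ∀ p, a + (2 + 3 * D + 4 * (D * D)) ≤ (univ.filter fun q => col q = col p).card)
    (hC : Fintype.card Q * (D + D * D) ≤ C * a) :
    (univ.filter fun M : PM Q => ∀ x, col (M x) = col x).card ≤ (2 * (1 + C) ^ (2 * C)) ^ 2 *
      (univ.filter fun M : PM Q => (∀ x, col (M x) = col x) ∧ IsSimplePairing vert U M).card := by
  have hpart := le_card_partners hU hv hD hc
  let sw : Q × Q → PM Q → PM Q := fun x M => PM.conj (Equiv.swap x.1 x.2) M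
  have stage1 := switching_positive (S := univ.filter fun M : PM Q => ∀ x, col (M x) = col x)
    (sw := sw) (Y := fun M => (univ.filter fun x => Forbidden vert U x (M x)).card)
    (Fwd := fun M => univ.filter fun z => Forbidden vert U z.1 (M z.1) ∧
      z.2 ∈ partners vert col U M z.1) (a := a) (C := C) conj_swap_conj_swap ha
    (fun M _ => le_card_filter_prod _ _ a fun p => hpart M p)
    (by
      intro M hM x hx
      simp only [mem_filter, mem_univ, true_and] at hM hx ⊢
      have hcol : col x.2 = col x.1 := (mem_filter.1 hx.2).2.1
      refine ⟨conj_swap_col hM hcol, card_lt_card ⟨?_, fun h => ?_⟩⟩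
      · intro y hy
        simp only [mem_filter, mem_univ, true_and] at hy ⊢
        exact (forbidden_of_forbidden_conj_swap hU hx.2 hy).1
      · have := h (show x.1 ∈ _ by simpa using hx.1)
        simp only [mem_filter, mem_univ, true_and] at this
        exact (forbidden_of_forbidden_conj_swap hU hx.2 this).2 rfl)
    (by
      intro M hM
      refine le_trans (card_le_card (t := univ.filter fun z : Q × Q =>
        Forbidden vert U z.1 (M z.2)) ?_) ((card_filter_prod_le (fun p q => Forbidden vert U p (M q))
          (D + D * D) ?_).trans hC)
      · rintro ⟨p, q⟩ hz
        simp only [mem_filter, mem_univ, true_and] at hz ⊢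
        obtain ⟨-, hz1, hz2⟩ := hz
        simp only [partners, mem_filter, mem_univ, true_and] at hz2
        have := conj_swap_right hz2.2.2.1
        rw [show PM.conj (Equiv.swap p q) (sw (p, q) M) = M from conj_swap_conj_swap (p, q) M]
          at this
        rwa [this]
      · intro p
        rw [card_filter_apply M fun q => Forbidden vert U p q]
        exact card_forbidden_le hv hD p)
  have stage2 := switching_positive (S := univ.filter fun M : PM Q => (∀ x, col (M x) = col x) ∧
      ∀ x, ¬ Forbidden vert U x (M x))
    (sw := sw) (Y := fun M => (univ.filter fun x => IsMultiple vert M x).card)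
    (Fwd := fun M => univ.filter fun z => IsMultiple vert M z.1 ∧
      z.2 ∈ partners vert col U M z.1) (a := a) (C := C) conj_swap_conj_swap ha
    (fun M _ => le_card_filter_prod _ _ a fun p => hpart M p)
    (by
      intro M hM x hx
      simp only [mem_filter, mem_univ, true_and] at hM hx ⊢
      have hcol : col x.2 = col x.1 := (mem_filter.1 hx.2).2.1
      refine ⟨⟨conj_swap_col hM.1 hcol, fun y hy => hM.2 y
        (forbidden_of_forbidden_conj_swap hU hx.2 hy).1⟩, card_lt_card ⟨?_, fun h => ?_⟩⟩
      · intro y hy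
        simp only [mem_filter, mem_univ, true_and] at hy ⊢
        exact (isMultiple_of_isMultiple_conj_swap hM.2 hx.2 hy).1
      · have := h (show x.1 ∈ _ by simpa using hx.1)
        simp only [mem_filter, mem_univ, true_and] at this
        exact (isMultiple_of_isMultiple_conj_swap hM.2 hx.2 this).2 rfl)
    (by
      intro M hM
      refine le_trans (card_le_card (t := univ.filter fun z : Q × Q =>
        ∃ x, vert x = vert z.1 ∧ vert (M z.2) = vert (M x)) ?_)
        ((card_filter_prod_le (fun p q => ∃ x, vert x = vert p ∧ vert (M q) = vert (M x))
          (D + D * D) ?_).trans hC)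
      · rintro ⟨p, q⟩ hz
        simp only [mem_filter, mem_univ, true_and] at hz ⊢
        obtain ⟨hz0, ⟨y, y1, y2, y3⟩, hz2⟩ := hz
        simp only [partners, mem_filter, mem_univ, true_and] at hz2
        have h2 := conj_swap_right hz2.2.2.1
        have h3 := conj_swap_of_ne (M := sw (p, q) M) (p := p) (q := q) (x := y) y1
          (fun h => hz2.2.2.2.2.2.1 (h ▸ y2)) (fun h => hz0.2 p (Or.inl (h ▸ y2.symm)))
          (fun h => hz2.2.2.2.1 (Or.inl (h ▸ y2.symm)))
        rw [show PM.conj (Equiv.swap p q) (sw (p, q) M) = M from conj_swap_conj_swap (p, q) M]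
          at h2 h3
        exact ⟨y, y2, by rw [h2, h3, y3]⟩
      · intro p
        rw [card_filter_apply M fun q => ∃ x, vert x = vert p ∧ vert q = vert (M x)]
        have : (univ.filter fun q => ∃ x, vert x = vert p ∧ vert q = vert (M x)) ⊆
            (univ.filter fun x => vert x = vert p).biUnion
              fun x => univ.filter fun q => vert q = vert (M x) := by
          intro q
          simp only [mem_filter, mem_univ, true_and, mem_biUnion]
          exact id
        exact (card_le_card this).trans (((card_biUnion_le_card_mul _ _ D fun v _ => hv _).trans
          (Nat.mul_le_mul_right _ (hv _))).trans (Nat.le_add_left _ _)))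
  rw [sq, mul_assoc]
  refine stage1.trans (Nat.mul_le_mul_left _ ?_)
  refine le_trans (le_of_eq (congrArg card ?_)) (stage2.trans
    (le_of_eq (congrArg (fun s : Finset (PM Q) => 2 * (1 + C) ^ (2 * C) * s.card) ?_)))
  · ext M
    simp only [mem_filter, mem_univ, true_and, card_eq_zero, filter_eq_empty_iff, forall_true_left]
  · ext M
    simp only [mem_filter, mem_univ, true_and, card_eq_zero, filter_eq_empty_iff, forall_true_left,
      and_assoc]
    exact Iff.rfl

end SimplePairings

/-- The real-valued indicator of a proposition. -/
noncomputable def ind (P : Prop) : ℝ := if P then 1 else 0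

lemma ind_nonneg (P : Prop) : 0 ≤ ind P := by unfold ind; split_ifs <;> norm_num

lemma ind_le_one (P : Prop) : ind P ≤ 1 := by unfold ind; split_ifs <;> norm_num

lemma ind_of {P : Prop} (h : P) : ind P = 1 := if_pos h

lemma ind_of_not {P : Prop} (h : ¬ P) : ind P = 0 := if_neg h

lemma ind_and (P Q : Prop) : ind (P ∧ Q) = ind P * ind Q := by
  unfold ind; split_ifs <;> simp_all

lemma ind_or_le (P Q : Prop) : ind (P ∨ Q) ≤ ind P + ind Q := by
  unfold ind; split_ifs <;> simp_all

lemma ind_mono {P Q : Prop} (h : P → Q) : ind P ≤ ind Q := by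
  unfold ind; split_ifs <;> simp_all

lemma ind_exists_le {X : Type*} [Fintype X] (P : X → Prop) : ind (∃ x, P x) ≤ ∑ x, ind (P x) := by
  by_cases h : ∃ x, P x
  · obtain ⟨x, hx⟩ := h
    rw [ind_of ⟨x, hx⟩, ← ind_of hx]
    exact single_le_sum (f := fun x => ind (P x)) (fun _ _ => ind_nonneg _) (mem_univ x)
  · rw [ind_of_not h]; exact sum_nonneg fun _ _ => ind_nonneg _

lemma sum_ind {X : Type*} [Fintype X] (P : X → Prop) [DecidablePred P] :
    ∑ x, ind (P x) = (univ.filter P).card := by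
  rw [card_filter, Nat.cast_sum]
  refine sum_congr rfl fun x _ => ?_
  by_cases h : P x <;> simp [h, ind]

section Poisson
variable {V : Type*} [Fintype V] {A B : V → V → Prop} {a b : ℕ}

/-- The number of ordered pairs that are adjacent in `A` and whose images are adjacent in `B`. -/
noncomputable def overlap (A B : V → V → Prop) (σ : Equiv.Perm V) : ℕ :=
  (univ.filter fun z : V × V => A z.1 z.2 ∧ B (σ z.1) (σ z.2)).card

/-- A relation is the adjacency relation of a regular graph. -/
structure IsRegRel (A : V → V → Prop) (a : ℕ) : Prop where
  symm : ∀ u v, A u v → A v u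
  irrefl : ∀ u, ¬ A u u
  deg : ∀ u, ∑ v, ind (A u v) = a

lemma IsRegRel.comm (hA : IsRegRel A a) (u v : V) : A u v ↔ A v u := ⟨hA.symm u v, hA.symm v u⟩

lemma IsRegRel.deg' (hA : IsRegRel A a) (v : V) : ∑ u, ind (A u v) = a := by
  simp_rw [fun u => hA.comm u v]; exact hA.deg v

lemma IsRegRel.sum_perm (hB : IsRegRel B b) (σ : Equiv.Perm V) (v : V) :
    ∑ w, ind (B (σ w) v) = b := by
  rw [Equiv.sum_comp σ fun w => ind (B w v)]; exact hB.deg' v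

lemma IsRegRel.sum_perm' (hB : IsRegRel B b) (σ : Equiv.Perm V) (v : V) :
    ∑ w, ind (B v (σ w)) = b := by
  rw [Equiv.sum_comp σ fun w => ind (B v w)]; exact hB.deg v

lemma overlap_eq (σ : Equiv.Perm V) :
    (overlap A B σ : ℝ) = ∑ u, ∑ v, ind (A u v) * ind (B (σ u) (σ v)) := by
  rw [overlap, ← sum_ind, Fintype.sum_prod_type]
  simp_rw [ind_and]

lemma sum_perm_mul_swap (u w : V) (f : Equiv.Perm V → ℝ) :
    ∑ σ : Equiv.Perm V, f (σ * Equiv.swap u w) = ∑ σ, f σ :=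
  Equiv.sum_comp (Equiv.mulRight (Equiv.swap u w)) f

lemma sum_const_filter_ne (v : V) (c : ℝ) :
    ∑ w, ind (w ≠ v) * c = (Fintype.card V - 1) * c := by
  rw [← sum_mul, sum_ind, filter_ne' univ v, card_erase_of_mem (mem_univ v), card_univ,
    Nat.cast_sub (Fintype.card_pos_iff.2 ⟨v⟩)]
  simp

lemma sum_overlap_mul (hA : IsRegRel A a) (hB : IsRegRel B b) (f : Equiv.Perm V → ℝ) :
    (Fintype.card V - 1) * ∑ σ, overlap A B σ * f σ =
      ∑ σ : Equiv.Perm V, ∑ u, ∑ v, ∑ w,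
        ind (A u v) * ind (B (σ w) (σ v)) * f (σ * Equiv.swap u w) := by
  have key : ∀ u v, A u v → (Fintype.card V - 1) * ∑ σ : Equiv.Perm V, ind (B (σ u) (σ v)) * f σ =
      ∑ w, ∑ σ : Equiv.Perm V, ind (B (σ w) (σ v)) * f (σ * Equiv.swap u w) := by
    intro u v huv
    rw [← sum_const_filter_ne v]
    refine sum_congr rfl fun w _ => ?_
    by_cases hw : w = v
    · subst hw
      rw [ind_of_not (by simp), zero_mul]
      refine (sum_eq_zero fun σ _ => ?_).symm
      rw [ind_of_not (hB.irrefl _), zero_mul]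
    · rw [ind_of hw, one_mul, ← sum_perm_mul_swap u w]
      refine sum_congr rfl fun σ _ => ?_
      have hvu : v ≠ u := by rintro rfl; exact hA.irrefl _ huv
      rw [Equiv.Perm.mul_apply, Equiv.Perm.mul_apply, Equiv.swap_apply_left,
        Equiv.swap_apply_of_ne_of_ne hvu (Ne.symm hw)]
  calc _ = ∑ u, ∑ v, ind (A u v) *
        ((Fintype.card V - 1) * ∑ σ : Equiv.Perm V, ind (B (σ u) (σ v)) * f σ) := by
        simp_rw [overlap_eq, sum_mul]
        rw [sum_comm, mul_sum]
        refine sum_congr rfl fun u _ => ?_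
        rw [sum_comm, mul_sum]
        refine sum_congr rfl fun v _ => ?_
        rw [mul_sum, mul_sum, mul_sum]
        exact sum_congr rfl fun σ _ => by ring
    _ = ∑ u, ∑ v, ind (A u v) *
        ∑ w, ∑ σ : Equiv.Perm V, ind (B (σ w) (σ v)) * f (σ * Equiv.swap u w) := by
        refine sum_congr rfl fun u _ => sum_congr rfl fun v _ => ?_
        by_cases h : A u v
        · rw [key u v h]
        · rw [ind_of_not h, zero_mul, zero_mul]
    _ = _ := by
        symm
        rw [sum_comm]
        refine sum_congr rfl fun u _ => ?_
        rw [sum_comm]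
        refine sum_congr rfl fun v _ => ?_
        rw [mul_sum, sum_comm]
        refine sum_congr rfl fun w _ => ?_
        rw [mul_sum]
        exact sum_congr rfl fun σ _ => by ring

/-- The switching of `u` and `w` does not simply create the overlapping edge `uv`. -/
def BadTriple (A B : V → V → Prop) (σ : Equiv.Perm V) (u v w : V) : Prop :=
  (∃ y, A u y ∧ B (σ u) (σ y)) ∨ (∃ y, A w y ∧ B (σ w) (σ y)) ∨
  (∃ y, y ≠ v ∧ A u y ∧ B (σ w) (σ y)) ∨ (u ≠ w ∧ ∃ y, y ≠ v ∧ A w y ∧ B (σ u) (σ y))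

lemma overlap_mul_swap (hA : IsRegRel A a) (hB : IsRegRel B b) {σ : Equiv.Perm V} {u v w : V}
    (huv : A u v) (hwv : B (σ w) (σ v)) (h : ¬ BadTriple A B σ u v w) :
    overlap A B (σ * Equiv.swap u w) = overlap A B σ + 2 := by
  simp only [BadTriple, not_or, not_exists, not_and] at h
  obtain ⟨h1, h2, h3, h4⟩ := h
  have huw : u ≠ w := by rintro rfl; exact h1 v huv hwv
  have hvu : v ≠ u := by rintro rfl; exact hA.irrefl _ huv
  have hvw : v ≠ w := by rintro rfl; exact hB.irrefl _ hwv
  have h4' : ∀ y, A w y → ¬ B (σ u) (σ y) := by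
    intro y hy
    by_cases hyv : y = v
    · subst hyv; exact absurd hwv (h2 y hy)
    · exact h4 huw y hyv hy
  have h3' : ∀ y, A u y → B (σ w) (σ y) → y = v := by
    intro y hy hyy
    by_contra hne
    exact h3 y hne hy hyy
  have hset : (univ.filter fun z : V × V => A z.1 z.2 ∧ B ((σ * Equiv.swap u w) z.1)
      ((σ * Equiv.swap u w) z.2)) = insert (u, v) (insert (v, u)
        (univ.filter fun z : V × V => A z.1 z.2 ∧ B (σ z.1) (σ z.2))) := by
    ext ⟨x, y⟩
    rw [mem_insert, mem_insert, mem_filter, mem_filter]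
    have hBs := hB.symm
    have hAs := hA.symm
    have hAi := hA.irrefl
    have hBi := hB.irrefl
    simp only [mem_univ, true_and, Prod.mk.injEq, Equiv.Perm.mul_apply, Equiv.swap_apply_def]
    by_cases hxu : x = u <;> by_cases hyu : y = u <;> by_cases hxw : x = w <;>
      by_cases hyw : y = w <;> simp only [hxu, hyu, hxw, hyw, if_true, if_false] <;> grind
  rw [overlap, overlap, hset, card_insert_of_notMem, card_insert_of_notMem]
  · simp only [mem_filter, mem_univ, true_and, not_and]
    intro hA' hB'
    exact h1 v huv (hB.symm _ _ hB')
  · simp only [mem_insert, Prod.mk.injEq, mem_filter, mem_univ, true_and, not_or, not_and]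
    exact ⟨fun h => absurd h.symm hvu, fun _ => h1 v huv⟩

end Poisson

section Poisson
variable {V : Type*} [Fintype V] {A B : V → V → Prop} {a b : ℕ}

lemma sum_ind_mul_ind_eq (hA : IsRegRel A a) (hB : IsRegRel B b) (σ : Equiv.Perm V) :
    ∑ u, ∑ v, ∑ w, ind (A u v) * ind (B (σ w) (σ v)) = Fintype.card V * (a * b : ℝ) := by
  simp_rw [← mul_sum, hB.sum_perm, ← sum_mul, hA.deg]
  simp [mul_assoc]

lemma sum_overlap (hA : IsRegRel A a) (hB : IsRegRel B b) :
    (Fintype.card V - 1) * ∑ σ, (overlap A B σ : ℝ) =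
      Fintype.card V * (a * b : ℝ) * Fintype.card (Equiv.Perm V) := by
  have := sum_overlap_mul hA hB (fun _ => 1)
  simp only [mul_one] at this
  rw [this]
  simp_rw [sum_ind_mul_ind_eq hA hB]
  simp [mul_comm]

lemma bad_first (hA : IsRegRel A a) (hB : IsRegRel B b) (σ : Equiv.Perm V) :
    ∑ u, ∑ v, ∑ w, ∑ y, ind (A u v) * ind (B (σ w) (σ v)) * (ind (A u y) * ind (B (σ u) (σ y))) =
      a * b * overlap A B σ := by
  rw [overlap_eq, mul_sum]
  refine sum_congr rfl fun u _ => ?_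
  simp_rw [← mul_sum, ← sum_mul, ← mul_sum, hB.sum_perm, ← sum_mul, hA.deg]

lemma bad_second (hA : IsRegRel A a) (hB : IsRegRel B b) (σ : Equiv.Perm V) :
    ∑ u, ∑ v, ∑ w, ∑ y, ind (A u v) * ind (B (σ w) (σ v)) * (ind (A w y) * ind (B (σ w) (σ y))) =
      a * b * overlap A B σ := by
  rw [sum_comm]
  have : ∀ v, ∑ u, ∑ w, ∑ y, ind (A u v) * ind (B (σ w) (σ v)) *
      (ind (A w y) * ind (B (σ w) (σ y))) =
      ∑ w, a * (ind (B (σ w) (σ v)) * ∑ y, (ind (A w y) * ind (B (σ w) (σ y)))) := by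
    intro v
    rw [sum_comm]
    refine sum_congr rfl fun w _ => ?_
    simp_rw [← mul_sum, ← sum_mul, hA.deg']
    ring
  simp_rw [this]
  rw [sum_comm, overlap_eq, mul_sum]
  refine sum_congr rfl fun w _ => ?_
  simp_rw [← mul_sum, ← sum_mul, hB.sum_perm']
  ring

lemma bad_third (hA : IsRegRel A a) (hB : IsRegRel B b) :
    (Fintype.card V - 1) * ∑ σ : Equiv.Perm V, ∑ u, ∑ v, ∑ w, ∑ y,
      ind (A u v) * ind (B (σ w) (σ v)) * (ind (y ≠ v) * (ind (A u y) * ind (B (σ w) (σ y)))) ≤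
      Fintype.card V * (a ^ 2 * b ^ 2 : ℝ) * Fintype.card (Equiv.Perm V) := by
  have key : ∀ v y : V, y ≠ v → (Fintype.card V - 1) * ∑ σ : Equiv.Perm V, ∑ w,
      ind (B (σ w) (σ v)) * ind (B (σ w) (σ y)) ≤ b ^ 2 * Fintype.card (Equiv.Perm V) := by
    intro v y hyv
    have h0 : ∀ σ : Equiv.Perm V, ∑ w, ind (B (σ w) (σ v)) * ind (B (σ w) (σ y)) =
        ∑ w, ind (B w (σ v)) * ind (B w (σ y)) := fun σ =>
      Equiv.sum_comp σ fun w => ind (B w (σ v)) * ind (B w (σ y))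
    simp_rw [h0]
    rw [← sum_const_filter_ne y]
    calc _ = ∑ z, ∑ σ : Equiv.Perm V, ind (z ≠ y) * ∑ w, ind (B w (σ z)) * ind (B w (σ y)) := by
          refine sum_congr rfl fun z _ => ?_
          by_cases hz : z = y
          · simp [ind_of_not (show ¬ z ≠ y by simpa)]
          · rw [← mul_sum, ← sum_perm_mul_swap v z]
            congr 1
            refine sum_congr rfl fun σ _ => ?_
            rw [Equiv.Perm.mul_apply, Equiv.Perm.mul_apply, Equiv.swap_apply_left,
              Equiv.swap_apply_of_ne_of_ne hyv (Ne.symm hz)]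
      _ ≤ ∑ z, ∑ σ : Equiv.Perm V, ∑ w, ind (B w (σ z)) * ind (B w (σ y)) := by
          refine sum_le_sum fun z _ => sum_le_sum fun σ _ => ?_
          exact mul_le_of_le_one_left (sum_nonneg fun w _ => mul_nonneg (ind_nonneg _) (ind_nonneg _))
            (ind_le_one _)
      _ = ∑ σ : Equiv.Perm V, (b ^ 2 : ℝ) := by
          rw [sum_comm]
          refine sum_congr rfl fun σ _ => ?_
          rw [sum_comm]
          simp_rw [← sum_mul, hB.sum_perm', ← mul_sum, hB.deg']
          ring
      _ = _ := by simp [mul_comm]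
  calc _ = ∑ u, ∑ v, ∑ y, ind (A u v) * ind (A u y) * ind (y ≠ v) *
        ((Fintype.card V - 1) * ∑ σ : Equiv.Perm V, ∑ w,
          ind (B (σ w) (σ v)) * ind (B (σ w) (σ y))) := by
        rw [sum_comm, mul_sum]
        refine sum_congr rfl fun u _ => ?_
        rw [sum_comm, mul_sum]
        refine sum_congr rfl fun v _ => ?_
        have : ∀ σ : Equiv.Perm V, ∑ w, ∑ y, ind (A u v) * ind (B (σ w) (σ v)) * (ind (y ≠ v) *
            (ind (A u y) * ind (B (σ w) (σ y)))) = ∑ y, ∑ w, ind (A u v) * ind (B (σ w) (σ v)) *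
            (ind (y ≠ v) * (ind (A u y) * ind (B (σ w) (σ y)))) := fun σ => sum_comm
        simp_rw [this]
        rw [sum_comm, mul_sum]
        refine sum_congr rfl fun y _ => ?_
        simp_rw [mul_sum]
        exact sum_congr rfl fun σ _ => sum_congr rfl fun w _ => by ring
    _ ≤ ∑ u, ∑ v, ∑ y, ind (A u v) * ind (A u y) * (b ^ 2 * Fintype.card (Equiv.Perm V)) := by
        refine sum_le_sum fun u _ => sum_le_sum fun v _ => sum_le_sum fun y _ => ?_
        by_cases hyv : y = v
        · rw [ind_of_not (show ¬ y ≠ v by simpa), mul_zero, zero_mul]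
          exact mul_nonneg (mul_nonneg (ind_nonneg _) (ind_nonneg _)) (by positivity)
        · rw [ind_of hyv, mul_one]
          exact mul_le_mul_of_nonneg_left (key v y hyv) (mul_nonneg (ind_nonneg _) (ind_nonneg _))
    _ = _ := by
        simp_rw [← sum_mul, ← mul_sum, hA.deg, ← sum_mul, hA.deg]
        simp
        ring

lemma sum_const_filter_notMem (s : Finset V) (c : ℝ) :
    ∑ w, ind (w ∉ s) * c = (Fintype.card V - s.card) * c := by
  rw [← sum_mul, sum_ind]
  congr 1
  have h : (univ.filter fun w => w ∉ s) = sᶜ := by ext; simp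
  rw [h, card_compl, Nat.cast_sub (card_le_univ s)]

lemma bad_fourth (hA : IsRegRel A a) (hB : IsRegRel B b) (hV : 3 < Fintype.card V) :
    (Fintype.card V - 3) * ∑ σ : Equiv.Perm V, ∑ u, ∑ v, ∑ w, ∑ y,
      ind (A u v) * ind (B (σ w) (σ v)) *
        (ind (u ≠ w ∧ y ≠ v) * (ind (A w y) * ind (B (σ u) (σ y)))) ≤
      Fintype.card V * (a ^ 2 * b ^ 2 : ℝ) * Fintype.card (Equiv.Perm V) := by
  have key : ∀ u v w y : V, u ≠ w → v ≠ w → w ≠ y → (Fintype.card V - 3) *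
      ∑ σ : Equiv.Perm V, ind (B (σ w) (σ v)) * ind (B (σ u) (σ y)) ≤
      ∑ σ : Equiv.Perm V, b * ind (B (σ u) (σ y)) := by
    intro u v w y huw hvw hwy
    calc _ ≤ (Fintype.card V - ({u, v, y} : Finset V).card) *
          ∑ σ : Equiv.Perm V, ind (B (σ w) (σ v)) * ind (B (σ u) (σ y)) := by
          refine mul_le_mul_of_nonneg_right ?_ (sum_nonneg fun σ _ =>
            mul_nonneg (ind_nonneg _) (ind_nonneg _))
          have : (({u, v, y} : Finset V).card : ℝ) ≤ 3 := by exact_mod_cast card_le_three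
          linarith
      _ = ∑ z, ∑ σ : Equiv.Perm V, ind (z ∉ ({u, v, y} : Finset V)) *
          (ind (B (σ z) (σ v)) * ind (B (σ u) (σ y))) := by
          rw [← sum_const_filter_notMem]
          refine sum_congr rfl fun z _ => ?_
          by_cases hz : z ∈ ({u, v, y} : Finset V)
          · rw [ind_of_not (not_not.2 hz)]; simp
          · rw [← mul_sum, ← sum_perm_mul_swap w z]
            congr 1
            refine sum_congr rfl fun σ _ => ?_
            simp only [mem_insert, mem_singleton, not_or] at hz
            simp only [Equiv.Perm.mul_apply, Equiv.swap_apply_left]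
            rw [Equiv.swap_apply_of_ne_of_ne hvw (Ne.symm hz.2.1),
              Equiv.swap_apply_of_ne_of_ne huw (Ne.symm hz.1),
              Equiv.swap_apply_of_ne_of_ne (Ne.symm hwy) (Ne.symm hz.2.2)]
      _ ≤ ∑ z, ∑ σ : Equiv.Perm V, (ind (B (σ z) (σ v)) * ind (B (σ u) (σ y))) := by
          refine sum_le_sum fun z _ => sum_le_sum fun σ _ => ?_
          exact mul_le_of_le_one_left (mul_nonneg (ind_nonneg _) (ind_nonneg _)) (ind_le_one _)
      _ = _ := by
          rw [sum_comm]
          simp_rw [← sum_mul, hB.sum_perm]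
  have h3 : (0 : ℝ) ≤ Fintype.card V - 3 := by
    have : (3 : ℝ) < Fintype.card V := by exact_mod_cast hV
    linarith
  calc _ = ∑ u, ∑ v, ∑ w, ∑ y, ((Fintype.card V - 3) * ∑ σ : Equiv.Perm V,
      ind (A u v) * ind (B (σ w) (σ v)) *
        (ind (u ≠ w ∧ y ≠ v) * (ind (A w y) * ind (B (σ u) (σ y))))) := by
        rw [sum_comm, mul_sum]
        refine sum_congr rfl fun u _ => ?_
        rw [sum_comm, mul_sum]
        refine sum_congr rfl fun v _ => ?_
        rw [sum_comm, mul_sum]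
        refine sum_congr rfl fun w _ => ?_
        rw [sum_comm, mul_sum]
    _ ≤ ∑ u, ∑ v, ∑ w, ∑ y, ∑ σ : Equiv.Perm V,
        ind (A u v) * (ind (A w y) * (b * ind (B (σ u) (σ y)))) := by
        refine sum_le_sum fun u _ => sum_le_sum fun v _ => sum_le_sum fun w _ =>
          sum_le_sum fun y _ => ?_
        have hn : 0 ≤ ∑ σ : Equiv.Perm V, ind (A u v) * (ind (A w y) * (b * ind (B (σ u) (σ y)))) :=
          sum_nonneg fun σ _ => mul_nonneg (ind_nonneg _) (mul_nonneg (ind_nonneg _)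
            (mul_nonneg (Nat.cast_nonneg _) (ind_nonneg _)))
        by_cases h : u ≠ w ∧ v ≠ w ∧ w ≠ y
        · rw [mul_sum]
          have := mul_le_mul_of_nonneg_left (key u v w y h.1 h.2.1 h.2.2)
            (mul_nonneg (ind_nonneg (A u v)) (ind_nonneg (A w y)))
          rw [mul_sum, mul_sum, mul_sum] at this
          refine le_trans (sum_le_sum fun σ _ => ?_) (this.trans (le_of_eq
            (sum_congr rfl fun σ _ => by ring)))
          have h1 := ind_le_one (u ≠ w ∧ y ≠ v)
          have h2 := ind_nonneg (u ≠ w ∧ y ≠ v)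
          have h4 : 0 ≤ ind (A u v) * ind (B (σ w) (σ v)) * (ind (A w y) * ind (B (σ u) (σ y))) :=
            mul_nonneg (mul_nonneg (ind_nonneg _) (ind_nonneg _))
              (mul_nonneg (ind_nonneg _) (ind_nonneg _))
          nlinarith [mul_nonneg h3 h4]
        · refine le_trans (le_of_eq ?_) hn
          rw [sum_eq_zero, mul_zero]
          intro σ _
          by_cases h1 : u = w
          · rw [ind_of_not (show ¬ (u ≠ w ∧ y ≠ v) by simp [h1])]; ring
          by_cases h2 : v = w
          · rw [h2, ind_of_not (hB.irrefl _)]; ring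
          · have h3 : w = y := by
              by_contra h3; exact h ⟨h1, h2, h3⟩
            rw [h3, ind_of_not (hA.irrefl y)]; ring
    _ = _ := by
        have : ∀ u, ∑ v, ∑ w, ∑ y, ∑ σ : Equiv.Perm V,
            ind (A u v) * (ind (A w y) * (b * ind (B (σ u) (σ y)))) =
            a ^ 2 * b ^ 2 * Fintype.card (Equiv.Perm V) := by
          intro u
          have h1 : ∑ w, ∑ y, ∑ σ : Equiv.Perm V, (ind (A w y) * (b * ind (B (σ u) (σ y)))) =
              a * b ^ 2 * Fintype.card (Equiv.Perm V) := by
            rw [sum_comm]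
            have : ∀ y, ∑ w, ∑ σ : Equiv.Perm V, (ind (A w y) * (b * ind (B (σ u) (σ y)))) =
                ∑ σ : Equiv.Perm V, a * (b * ind (B (σ u) (σ y))) := by
              intro y
              rw [sum_comm]
              simp_rw [← sum_mul, hA.deg']
            simp_rw [this]
            rw [sum_comm]
            simp_rw [← mul_sum, hB.sum_perm']
            simp
            ring
          simp_rw [← mul_sum] at h1 ⊢
          rw [h1, ← sum_mul, hA.deg]
          ring
        simp_rw [this]
        simp
        ring

lemma sum_bad_le (hA : IsRegRel A a) (hB : IsRegRel B b) (hV : 6 ≤ Fintype.card V) :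
    ∑ σ : Equiv.Perm V, ∑ u, ∑ v, ∑ w, ind (A u v) * ind (B (σ w) (σ v)) *
      ind (BadTriple A B σ u v w) ≤ 8 * (a ^ 2 * b ^ 2) * Fintype.card (Equiv.Perm V) := by
  have hn : (6 : ℝ) ≤ Fintype.card V := by exact_mod_cast hV
  have h0 := sum_overlap hA hB
  have h3 := bad_third hA hB
  have h4 := bad_fourth hA hB (by omega)
  set N : ℝ := (Fintype.card V : ℝ)
  set S3 := ∑ σ : Equiv.Perm V, ∑ u, ∑ v, ∑ w, ∑ y,
      ind (A u v) * ind (B (σ w) (σ v)) * (ind (y ≠ v) * (ind (A u y) * ind (B (σ w) (σ y))))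
  set S4 := ∑ σ : Equiv.Perm V, ∑ u, ∑ v, ∑ w, ∑ y, ind (A u v) * ind (B (σ w) (σ v)) *
        (ind (u ≠ w ∧ y ≠ v) * (ind (A w y) * ind (B (σ u) (σ y))))
  set F : ℝ := (Fintype.card (Equiv.Perm V) : ℝ)
  have hF : 0 ≤ F := Nat.cast_nonneg _
  have hp : 0 ≤ (a ^ 2 * b ^ 2 : ℝ) * F := by positivity
  have hO : (a * b : ℝ) * ∑ σ : Equiv.Perm V, (overlap A B σ : ℝ) ≤ 2 * (a ^ 2 * b ^ 2) * F := by
    have : (N - 1) * ((a * b : ℝ) * ∑ σ : Equiv.Perm V, (overlap A B σ : ℝ)) =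
      N * ((a ^ 2 * b ^ 2) * F) := by linear_combination (a * b : ℝ) * h0
    by_contra! hcon
    nlinarith
  have hS3 : S3 ≤ 2 * (a ^ 2 * b ^ 2) * F := by
    by_contra! hcon
    nlinarith
  have hS4 : S4 ≤ 2 * (a ^ 2 * b ^ 2) * F := by
    by_contra! hcon
    nlinarith
  have main : ∑ σ : Equiv.Perm V, ∑ u, ∑ v, ∑ w, ind (A u v) * ind (B (σ w) (σ v)) *
      ind (BadTriple A B σ u v w) ≤ ∑ σ : Equiv.Perm V, (a * b : ℝ) * overlap A B σ +
        ∑ σ : Equiv.Perm V, (a * b : ℝ) * overlap A B σ + S3 + S4 := by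
    simp_rw [S3, S4]
    conv_rhs => enter [1, 1, 1, 2, σ]; rw [← bad_first hA hB σ]
    conv_rhs => enter [1, 1, 2, 2, σ]; rw [← bad_second hA hB σ]
    simp_rw [← sum_add_distrib]
    refine sum_le_sum fun σ _ => sum_le_sum fun u _ => sum_le_sum fun v _ => sum_le_sum fun w _ => ?_
    simp_rw [sum_add_distrib, ← mul_sum, ← mul_add]
    refine mul_le_mul_of_nonneg_left ?_ (mul_nonneg (ind_nonneg _) (ind_nonneg _))
    unfold BadTriple
    refine (ind_or_le _ _).trans ?_
    rw [add_assoc, add_assoc]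
    refine add_le_add ?_ ((ind_or_le _ _).trans (add_le_add ?_ ((ind_or_le _ _).trans
      (add_le_add ?_ ?_))))
    · exact (ind_exists_le _).trans (le_of_eq (sum_congr rfl fun y _ => ind_and _ _))
    · exact (ind_exists_le _).trans (le_of_eq (sum_congr rfl fun y _ => ind_and _ _))
    · exact (ind_exists_le _).trans (le_of_eq (sum_congr rfl fun y _ => by rw [ind_and, ind_and]))
    · rw [← exists_and_left]
      refine (ind_exists_le _).trans (le_of_eq (sum_congr rfl fun y _ => ?_))
      rw [← and_assoc, ind_and, ind_and (A w y)]
  rw [← mul_sum] at main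
  linarith

/-- The fraction of permutations whose image of `A` avoids `B`. -/
noncomputable def avoidFraction (A B : V → V → Prop) : ℝ :=
  (univ.filter fun σ : Equiv.Perm V => overlap A B σ = 0).card / Fintype.card (Equiv.Perm V)

/-- The number of overlaps of two regular graphs under a random relabelling is almost Poisson. -/
theorem abs_avoidFraction_sub_le (hA : IsRegRel A a) (hB : IsRegRel B b) (hV : 6 ≤ Fintype.card V) :
    |avoidFraction A B - Real.exp (-(a * b / 2))| ≤
      (16 * (a ^ 2 * b ^ 2) + 2 * (a * b)) / Fintype.card V := by
  set F : ℝ := (Fintype.card (Equiv.Perm V) : ℝ) with hFdef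
  have hF : 0 < F := by rw [hFdef]; exact_mod_cast Fintype.card_pos
  have hn : (6 : ℝ) ≤ Fintype.card V := by exact_mod_cast hV
  set N : ℝ := (Fintype.card V : ℝ) with hN
  let G : ℝ → ℝ := fun x => ∑ σ : Equiv.Perm V, x ^ overlap A B σ
  let G' : ℝ → ℝ := fun x => ∑ σ : Equiv.Perm V, overlap A B σ * x ^ (overlap A B σ - 1)
  have hG : ∀ x, HasDerivAt G (G' x) x := fun x =>
    HasDerivAt.fun_sum fun σ _ => hasDerivAt_pow (overlap A B σ) x
  have hG1 : G 1 = F := by simp [G, hFdef]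
  have hG0 : G 0 = F * avoidFraction A B := by
    rw [avoidFraction, mul_div_cancel₀ _ hF.ne', ← sum_ind]
    refine sum_congr rfl fun σ _ => ?_
    by_cases h : overlap A B σ = 0
    · rw [h, ind_of rfl, pow_zero]
    · rw [zero_pow h, ind_of_not h]
  have hbd : ∀ x, 0 ≤ x → x ≤ 1 → |G' x - a * b * (x * G x)| ≤
      ((16 * (a ^ 2 * b ^ 2) + 2 * (a * b)) / N) * F := by
    intro x h0 h1
    have e1 := sum_overlap_mul hA hB (fun σ => x ^ (overlap A B σ - 1))
    have e2 : N * (a * b) * (x * G x) = ∑ σ : Equiv.Perm V, ∑ u, ∑ v, ∑ w,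
        ind (A u v) * ind (B (σ w) (σ v)) * x ^ (overlap A B σ + 1) := by
      simp_rw [← sum_mul, sum_ind_mul_ind_eq hA hB, ← mul_sum, G, pow_succ', ← mul_sum]
      rfl
    have e3 : |(N - 1) * G' x - N * (a * b) * (x * G x)| ≤ 8 * (a ^ 2 * b ^ 2) * F := by
      rw [show (N - 1) * G' x = _ from e1, e2]
      refine le_trans ?_ (sum_bad_le hA hB hV)
      simp_rw [← sum_sub_distrib]
      refine (abs_sum_le_sum_abs _ _).trans (sum_le_sum fun σ _ => ?_)
      refine (abs_sum_le_sum_abs _ _).trans (sum_le_sum fun u _ => ?_)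
      refine (abs_sum_le_sum_abs _ _).trans (sum_le_sum fun v _ => ?_)
      refine (abs_sum_le_sum_abs _ _).trans (sum_le_sum fun w _ => ?_)
      rw [← mul_sub, abs_mul, abs_of_nonneg (mul_nonneg (ind_nonneg _) (ind_nonneg _))]
      by_cases huv : A u v
      swap
      · rw [ind_of_not huv]; simp
      by_cases hwv : B (σ w) (σ v)
      swap
      · rw [ind_of_not hwv]; simp
      refine mul_le_mul_of_nonneg_left ?_ (mul_nonneg (ind_nonneg _) (ind_nonneg _))
      by_cases hb : BadTriple A B σ u v w
      · rw [ind_of hb, abs_le]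
        have p1 := pow_nonneg h0 (overlap A B (σ * Equiv.swap u w) - 1)
        have p2 := pow_le_one₀ h0 h1 (n := overlap A B (σ * Equiv.swap u w) - 1)
        have p3 := pow_nonneg h0 (overlap A B σ + 1)
        have p4 := pow_le_one₀ h0 h1 (n := overlap A B σ + 1)
        constructor <;> linarith
      · rw [overlap_mul_swap hA hB huv hwv hb, ind_of_not hb]
        simp
    have hGb : 0 ≤ G x ∧ G x ≤ F := by
      constructor
      · exact sum_nonneg fun σ _ => pow_nonneg h0 _
      · rw [← hG1]
        exact sum_le_sum fun σ _ => by rw [one_pow]; exact pow_le_one₀ h0 h1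
    have e4 : |a * b * (x * G x)| ≤ a * b * F := by
      rw [abs_of_nonneg (mul_nonneg (by positivity) (mul_nonneg h0 hGb.1))]
      refine mul_le_mul_of_nonneg_left ?_ (by positivity)
      nlinarith
    have e5 : (N - 1) * |G' x - a * b * (x * G x)| ≤ (8 * (a ^ 2 * b ^ 2) + a * b) * F := by
      rw [← abs_of_nonneg (show 0 ≤ N - 1 by linarith), ← abs_mul]
      have : (N - 1) * (G' x - a * b * (x * G x)) = ((N - 1) * G' x - N * (a * b) * (x * G x)) +
        a * b * (x * G x) := by ring
      rw [this]
      refine (abs_add_le _ _).trans ?_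
      linarith
    rw [div_mul_eq_mul_div, le_div_iff₀ (by linarith)]
    have := abs_nonneg (G' x - a * b * (x * G x))
    nlinarith
  let h : ℝ → ℝ := fun x => G x * Real.exp (-(a * b / 2) * x ^ 2)
  have hh : ∀ x, HasDerivAt h ((G' x - a * b * (x * G x)) * Real.exp (-(a * b / 2) * x ^ 2)) x := by
    intro x
    have := (hG x).mul (((hasDerivAt_pow 2 x).const_mul (-(a * b / 2 : ℝ))).exp)
    refine this.congr_deriv ?_
    norm_num
    ring
  have hmv := (convex_Icc (0 : ℝ) 1).norm_image_sub_le_of_norm_hasDerivWithin_le (f := h)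
    (C := ((16 * (a ^ 2 * b ^ 2) + 2 * (a * b)) / N) * F)
    (fun x _ => (hh x).hasDerivWithinAt) (by
      intro x hx
      rw [Real.norm_eq_abs, abs_mul, Real.abs_exp]
      refine (mul_le_of_le_one_right (abs_nonneg _) ?_).trans (hbd x hx.1 hx.2)
      rw [Real.exp_le_one_iff]
      have : 0 ≤ (a * b / 2 : ℝ) * x ^ 2 := by positivity
      linarith) (show (1 : ℝ) ∈ Set.Icc 0 1 by simp) (show (0 : ℝ) ∈ Set.Icc 0 1 by simp)
  have : h 0 - h 1 = F * (avoidFraction A B - Real.exp (-(a * b / 2))) := by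
    simp only [h, hG0, hG1]
    norm_num
    ring
  rw [this, Real.norm_eq_abs, abs_mul, abs_of_pos hF] at hmv
  norm_num at hmv
  rw [mul_comm] at hmv
  exact le_of_mul_le_mul_right hmv hF

end Poisson

section Families
variable {V I J : Type*}

/-- A family of perfect matchings without common edges. -/
def Disj (M : I → PM V) : Prop := ∀ i j, i ≠ j → ∀ v, M i v ≠ M j v

/-- Adjacency in the union of a family of perfect matchings. -/
def adjU (M : I → PM V) (u v : V) : Prop := ∃ i, M i u = v

/-- Relabelling the points of a family of perfect matchings. -/
def conjT (σ : Equiv.Perm V) : (I → PM V) ≃ (I → PM V) := Equiv.piCongrRight fun _ => PM.congr σ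

lemma conjT_apply (σ : Equiv.Perm V) (M : I → PM V) (i : I) (x : V) :
    conjT σ M i x = σ (M i (σ.symm x)) := rfl

lemma disj_conjT (σ : Equiv.Perm V) (M : I → PM V) : Disj (conjT σ M) ↔ Disj M := by
  constructor
  · intro h i j hij v hv
    exact h i j hij (σ v) (by simp [conjT_apply, hv])
  · intro h i j hij v hv
    exact h i j hij (σ.symm v) (σ.injective hv)

lemma adjU_conjT (σ : Equiv.Perm V) (M : I → PM V) (u v : V) :
    adjU (conjT σ M) (σ u) (σ v) ↔ adjU M u v := by
  simp [adjU, conjT_apply]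

lemma Disj.isRegRel [Fintype V] [Fintype I] {M : I → PM V} (h : Disj M) :
    IsRegRel (adjU M) (Fintype.card I) where
  symm := by rintro u v ⟨i, rfl⟩; exact ⟨i, by simp⟩
  irrefl := by rintro u ⟨i, hi⟩; exact (M i).apply_ne u hi
  deg u := by
    rw [sum_ind]
    have : (univ.filter fun v => adjU M u v) = univ.image fun i => M i u := by
      ext v; rw [mem_filter]; simp [adjU]
    rw [this, card_image_of_injective, card_univ]
    intro i j hij
    by_contra hne
    exact h i j hne u hij

lemma disj_sum (M : I → PM V) (N : J → PM V) :
    Disj (Sum.elim M N) ↔ Disj M ∧ Disj N ∧ ∀ u v, adjU N u v → ¬ adjU M u v := by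
  constructor
  · intro h
    refine ⟨fun i j hij => h (.inl i) (.inl j) (by simpa), fun i j hij => h (.inr i) (.inr j)
      (by simpa), ?_⟩
    rintro u v ⟨j, hj⟩ ⟨i, hi⟩
    exact h (.inl i) (.inr j) (by simp) u (hi.trans hj.symm)
  · rintro ⟨h1, h2, h3⟩ (i | i) (j | j) hij v hv
    · exact h1 i j (by simpa using hij) v hv
    · exact h3 v _ ⟨j, rfl⟩ ⟨i, hv⟩
    · exact h3 v _ ⟨i, rfl⟩ ⟨j, hv.symm⟩
    · exact h2 i j (by simpa using hij) v hv

lemma disj_comp_equiv (e : J ≃ I) (M : I → PM V) : Disj (fun j => M (e j)) ↔ Disj M := by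
  constructor
  · intro h i j hij
    have := h (e.symm i) (e.symm j) (by simpa)
    simpa using this
  · intro h i j hij
    exact h _ _ (by simpa)

/-- A family of blocks of perfect matchings as a single family. -/
def flat {K : Type*} (H : K → I → PM V) (p : K × I) : PM V := H p.1 p.2

lemma disj_flat_snoc {K : ℕ} (H : Fin K → I → PM V) (h : I → PM V) :
    Disj (flat (Fin.snoc (α := fun _ => I → PM V) H h)) ↔
      Disj (flat H) ∧ Disj h ∧ ∀ u v, adjU h u v → ¬ adjU (flat H) u v := by
  rw [← disj_sum]
  let e : (Fin K × I) ⊕ I ≃ Fin (K + 1) × I :=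
    ((Equiv.sumCongr (Equiv.refl _) (Equiv.uniqueProd I (Fin 1)).symm).trans
      (Equiv.sumProdDistrib _ _ _).symm).trans
      (Equiv.prodCongr (finSumFinEquiv) (Equiv.refl _))
  rw [← disj_comp_equiv e]
  refine iff_of_eq (congrArg Disj ?_)
  funext p
  rcases p with ⟨k, i⟩ | i
  · show Fin.snoc (α := fun _ => I → PM V) H h (Fin.castSucc k) i = _
    simp [flat]
  · show Fin.snoc (α := fun _ => I → PM V) H h (Fin.last K) i = _
    simp

end Families

section Amplify
variable {V I : Type*} [Fintype V] [Fintype I] [DecidableEq I]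

/-- Total weight of the disjoint families of blocks under a product weight. -/
noncomputable def crossSum {K : ℕ} (t : Fin K → (I → PM V) → ℝ) : ℝ :=
  ∑ H : Fin K → I → PM V, ind (Disj (flat H)) * ∏ j, t j (H j)

/-- Invariance of a weight under relabelling. -/
def ConjInv (t : (I → PM V) → ℝ) : Prop := ∀ σ h, t (conjT σ h) = t h

lemma sum_avoid_eq {t : (I → PM V) → ℝ} (ht : ConjInv t) (U : V → V → Prop) :
    ∑ h, t h * ind (∀ u v, adjU h u v → ¬ U u v) = ∑ h, t h * avoidFraction (adjU h) U := by
  have hF : (0 : ℝ) < Fintype.card (Equiv.Perm V) := by exact_mod_cast Fintype.card_pos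
  have key : ∀ σ : Equiv.Perm V, ∑ h, t h * ind (∀ u v, adjU h u v → ¬ U u v) =
      ∑ h, t h * ind (overlap (adjU h) U σ = 0) := by
    intro σ
    rw [← Equiv.sum_comp (conjT σ)]
    refine sum_congr rfl fun h _ => ?_
    rw [ht]
    congr 2
    apply propext
    rw [overlap, card_eq_zero, filter_eq_empty_iff]
    constructor
    · rintro hh ⟨u, v⟩ _ ⟨h1, h2⟩
      exact hh (σ u) (σ v) ((adjU_conjT σ h u v).2 h1) h2
    · intro hh u v h1 h2
      refine hh (x := (σ.symm u, σ.symm v)) (mem_univ _) ⟨?_, by simpa using h2⟩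
      rw [← adjU_conjT σ]; simpa using h1
  have h2 : (Fintype.card (Equiv.Perm V) : ℝ) * ∑ h, t h * ind (∀ u v, adjU h u v → ¬ U u v) =
      Fintype.card (Equiv.Perm V) * ∑ h, t h * avoidFraction (adjU h) U := by
    rw [← nsmul_eq_mul, ← card_univ, ← sum_const, sum_congr rfl (fun σ _ => key σ), sum_comm,
      mul_sum]
    refine sum_congr rfl fun h _ => ?_
    rw [← mul_sum, sum_ind, avoidFraction, card_univ]
    field_simp
  exact mul_left_cancel₀ hF.ne' h2

lemma crossSum_snoc {K : ℕ} (t : Fin (K + 1) → (I → PM V) → ℝ)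
    (hsupp : ∀ h, ¬ Disj h → t (Fin.last K) h = 0) :
    crossSum t = ∑ H : Fin K → I → PM V, (ind (Disj (flat H)) * ∏ j, t j.castSucc (H j)) *
      ∑ h, t (Fin.last K) h * ind (∀ u v, adjU h u v → ¬ adjU (flat H) u v) := by
  unfold crossSum
  rw [← Equiv.sum_comp (Fin.snocEquiv fun _ => I → PM V), Fintype.sum_prod_type, sum_comm]
  refine sum_congr rfl fun H _ => ?_
  rw [mul_sum]
  refine sum_congr rfl fun h _ => ?_
  show ind (Disj (flat (Fin.snoc (α := fun _ => I → PM V) H h))) *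
    ∏ j, t j (Fin.snoc (α := fun _ => I → PM V) H h j) = _
  rw [disj_flat_snoc, Fin.prod_univ_castSucc, ind_and, ind_and]
  simp only [Fin.snoc_castSucc, Fin.snoc_last]
  by_cases hd : Disj h
  · rw [ind_of hd]; ring
  · rw [hsupp h hd]; ring

/-- Disjointness of blocks with independent relabellings has asymptotically constant probability. -/
theorem abs_crossSum_sub_le (K L : ℕ) : ∃ q C : ℝ, 0 < q ∧ 0 ≤ C ∧
    ∀ (V I : Type) [Fintype V] [Fintype I] [DecidableEq I], Fintype.card I = L → 6 ≤ Fintype.card V →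
      ∀ t : Fin K → (I → PM V) → ℝ, (∀ j h, 0 ≤ t j h) → (∀ j h, ¬ Disj h → t j h = 0) →
        (∀ j, j.1 ≠ 0 → ConjInv (t j)) →
        |crossSum t - q * ∏ j, ∑ h, t j h| ≤ C / Fintype.card V * ∏ j, ∑ h, t j h := by
  induction K with
  | zero =>
    refine ⟨1, 0, one_pos, le_rfl, fun V I _ _ _ hI hV t h0 hs hi => ?_⟩
    have : Disj (flat (fun i : Fin 0 => (i.elim0 : I → PM V))) := fun i => i.1.elim0
    have h2 : crossSum t = 1 := by
      unfold crossSum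
      rw [Fintype.sum_unique]
      simp only [univ_eq_empty, prod_empty, mul_one]
      exact ind_of (fun i => i.1.elim0)
    simp [h2]
  | succ K ih =>
    obtain ⟨q, C, hq, hC, ih⟩ := ih
    set B : ℝ := ((K * L : ℕ) : ℝ) with hB
    refine ⟨q * Real.exp (-(L * B / 2)), C + (16 * (L ^ 2 * B ^ 2) + 2 * (L * B)), by positivity,
      by positivity, fun V I _ _ _ hI hV t h0 hs hi => ?_⟩
    have hn : (6 : ℝ) ≤ Fintype.card V := by exact_mod_cast hV
    set N : ℝ := (Fintype.card V : ℝ) with hN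
    set D : ℝ := 16 * (L ^ 2 * B ^ 2) + 2 * (L * B) with hD
    have hD0 : 0 ≤ D := by positivity
    set e := Real.exp (-(L * B / 2)) with he
    have he0 : 0 < e := Real.exp_pos _
    have he1 : e ≤ 1 := by
      rw [he, Real.exp_le_one_iff]
      have : 0 ≤ L * B / 2 := by positivity
      linarith
    set T := ∑ h, t (Fin.last K) h with hT
    have hT0 : 0 ≤ T := sum_nonneg fun h _ => h0 _ h
    set P := ∏ j : Fin K, ∑ h, t j.castSucc h with hP
    have hP0 : 0 ≤ P := prod_nonneg fun j _ => sum_nonneg fun h _ => h0 _ h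
    have hrec := ih V I hI hV (fun j => t j.castSucc) (fun j => h0 _) (fun j => hs _)
      (fun j hj => hi _ (by simpa using hj))
    have hinner : ∀ H : Fin K → I → PM V, Disj (flat H) →
        |∑ h, t (Fin.last K) h * ind (∀ u v, adjU h u v → ¬ adjU (flat H) u v) - e * T| ≤
          D / N * T := by
      intro H hH
      by_cases hK : K = 0
      · subst hK
        have h1 : ∑ h, t (Fin.last 0) h * ind (∀ u v, adjU h u v → ¬ adjU (flat H) u v) = T := by
          refine sum_congr rfl fun h _ => ?_
          rw [ind_of, mul_one]
          rintro u v _ ⟨⟨k, _⟩, _⟩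
          exact k.elim0
        have h2 : e = 1 := by rw [he, hB]; simp
        rw [h1, h2]
        simp only [one_mul, sub_self, abs_zero]
        positivity
      · rw [sum_avoid_eq (hi _ (by simpa using hK)), hT, mul_sum, mul_sum, ← sum_sub_distrib]
        refine (abs_sum_le_sum_abs _ _).trans (sum_le_sum fun h _ => ?_)
        by_cases hd : Disj h
        · have hr := hH.isRegRel
          have := abs_avoidFraction_sub_le hd.isRegRel hr hV
          rw [Fintype.card_prod, Fintype.card_fin, hI] at this
          rw [mul_comm e, ← mul_sub, abs_mul, abs_of_nonneg (h0 _ h), mul_comm (D / N)]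
          exact mul_le_mul_of_nonneg_left this (h0 _ h)
        · rw [hs _ h hd]; simp
    rw [Fin.prod_univ_castSucc, crossSum_snoc _ (hs _)]
    set Z := crossSum fun j : Fin K => t j.castSucc with hZ
    set W := ∑ H : Fin K → I → PM V, (ind (Disj (flat H)) * ∏ j, t j.castSucc (H j)) *
      ∑ h, t (Fin.last K) h * ind (∀ u v, adjU h u v → ¬ adjU (flat H) u v)
    have h1 : |W - Z * (e * T)| ≤ Z * (D / N * T) := by
      simp only [W, hZ, crossSum]
      rw [sum_mul, sum_mul, ← sum_sub_distrib]
      refine (abs_sum_le_sum_abs _ _).trans (sum_le_sum fun H _ => ?_)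
      have hp : 0 ≤ ind (Disj (flat H)) * ∏ j : Fin K, t j.castSucc (H j) :=
        mul_nonneg (ind_nonneg _) (prod_nonneg fun j _ => h0 _ _)
      rw [← mul_sub, abs_mul, abs_of_nonneg hp]
      by_cases hH : Disj (flat H)
      · exact mul_le_mul_of_nonneg_left (hinner H hH) hp
      · rw [ind_of_not hH]; simp
    have hZP : Z ≤ P := by
      simp only [hZ, crossSum, hP]
      rw [prod_univ_sum, Fintype.piFinset_univ]
      refine sum_le_sum fun H _ => ?_
      exact mul_le_of_le_one_left (prod_nonneg fun j _ => h0 _ _) (ind_le_one _)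
    have hDT : 0 ≤ D / N * T := by positivity
    have hCP : 0 ≤ C / N * P := by positivity
    have h2 : |(Z - q * P) * (e * T)| ≤ C / N * P * T := by
      rw [abs_mul, abs_of_nonneg (by positivity : 0 ≤ e * T)]
      refine (mul_le_mul_of_nonneg_right hrec (by positivity)).trans ?_
      refine mul_le_mul_of_nonneg_left ?_ hCP
      nlinarith
    calc |W - q * e * (P * T)| = |(W - Z * (e * T)) + (Z - q * P) * (e * T)| := by ring_nf
      _ ≤ Z * (D / N * T) + C / N * P * T := (abs_add_le _ _).trans (add_le_add h1 h2)
      _ ≤ P * (D / N * T) + C / N * P * T := by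
        have := mul_le_mul_of_nonneg_right hZP hDT
        linarith
      _ = _ := by ring

end Amplify

section Amplify
variable {V I : Type*} [Fintype V] [Fintype I] [DecidableEq I]

lemma crossSum_comp_perm {K : ℕ} (t : Fin K → (I → PM V) → ℝ) (e : Equiv.Perm (Fin K)) :
    crossSum (fun j => t (e j)) = crossSum t := by
  unfold crossSum
  rw [← Equiv.sum_comp (Equiv.arrowCongr e.symm (Equiv.refl (I → PM V)))]
  refine sum_congr rfl fun H _ => ?_
  have h1 : Disj (flat (Equiv.arrowCongr e.symm (Equiv.refl (I → PM V)) H)) ↔ Disj (flat H) :=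
    disj_comp_equiv (Equiv.prodCongr e (Equiv.refl I)) (flat H)
  rw [h1]
  exact congrArg _ (Equiv.prod_comp e fun j => t j (H j))

lemma conjInv_ind_disj (c : ℝ) : ConjInv fun h : I → PM V => ind (Disj h) / c := by
  intro σ h
  simp only [disj_conjT]

lemma disj_block {K : ℕ} {H : Fin K → I → PM V} (h : Disj (flat H)) (j : Fin K) : Disj (H j) :=
  fun i i' hii v => h (j, i) (j, i') (by simpa using hii) v

end Amplify

/-- Bounds for joint densities of at most two of the blocks. -/
lemma exists_block_bounds (K L : ℕ) {η : ℝ} (hη : 0 < η) :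
    ∃ q : ℝ, ∃ N₀ : ℕ, 0 < q ∧ ∀ (V I : Type) [Fintype V] [Fintype I] [DecidableEq I], Fintype.card I = L →
      N₀ ≤ Fintype.card V → ∀ D : ℝ, D = ∑ h : I → PM V, ind (Disj h) → 0 < D →
      (|(∑ H : Fin K → I → PM V, ind (Disj (flat H))) / D ^ K - q| ≤ η * q) ∧
      (∀ f : (I → PM V) → ℝ, (∀ h, 0 ≤ f h) → (∀ h, ¬ Disj h → f h = 0) → ∀ j : Fin K,
        |(∑ H : Fin K → I → PM V, ind (Disj (flat H)) * f (H j)) / D ^ K - q * ((∑ h, f h) / D)| ≤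
          η * q * ((∑ h, f h) / D)) ∧
      (∀ f : (I → PM V) → ℝ, (∀ h, 0 ≤ f h) → (∀ h, ¬ Disj h → f h = 0) → ConjInv f →
        ∀ i j : Fin K, i ≠ j →
        |(∑ H : Fin K → I → PM V, ind (Disj (flat H)) * (f (H i) * f (H j))) / D ^ K -
          q * ((∑ h, f h) / D) ^ 2| ≤ η * q * ((∑ h, f h) / D) ^ 2) := by
  obtain ⟨q, C, hq, hC, main⟩ := abs_crossSum_sub_le K L
  refine ⟨q, max 6 ⌈C / (η * q)⌉₊, hq, fun V I _ _ _ hI hV D hD hD0 => ?_⟩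
  have hV6 : 6 ≤ Fintype.card V := le_trans (le_max_left _ _) hV
  have hN : (0 : ℝ) < Fintype.card V := by exact_mod_cast (by omega : 0 < Fintype.card V)
  have hCN : C / Fintype.card V ≤ η * q := by
    rw [div_le_iff₀ hN, ← div_le_iff₀' (by positivity)]
    exact (Nat.le_ceil _).trans (by exact_mod_cast le_trans (le_max_right _ _) hV)
  have main' : ∀ t : Fin K → (I → PM V) → ℝ, (∀ j h, 0 ≤ t j h) → (∀ j h, ¬ Disj h → t j h = 0) →
      (∃ j₀, ∀ j, j ≠ j₀ → ConjInv (t j)) ∨ (∀ j, ConjInv (t j)) →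
      |crossSum t - q * ∏ j, ∑ h, t j h| ≤ η * q * ∏ j, ∑ h, t j h := by
    intro t h0 hs hi
    refine le_trans ?_ (mul_le_mul_of_nonneg_right hCN
      (prod_nonneg fun j _ => sum_nonneg fun h _ => h0 j h))
    rcases hi with ⟨j₀, hj⟩ | hi
    · have hK : 0 < K := j₀.pos
      have := main V I hI hV6 (fun j => t (Equiv.swap ⟨0, hK⟩ j₀ j)) (fun j => h0 _) (fun j => hs _)
        (fun j hj0 => hj _ (by
          intro h
          rw [← Equiv.swap_apply_left ⟨0, hK⟩ j₀] at h
          have := (Equiv.swap ⟨0, hK⟩ j₀).injective h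
          rw [this] at hj0
          exact hj0 rfl))
      rwa [crossSum_comp_perm, Equiv.prod_comp (Equiv.swap ⟨0, hK⟩ j₀) fun j => ∑ h, t j h] at this
    · exact main V I hI hV6 t h0 hs fun j _ => hi j
  have hb0 : ∀ h : I → PM V, 0 ≤ ind (Disj h) / D := fun h => div_nonneg (ind_nonneg _) hD0.le
  have hbs : ∀ h : I → PM V, ¬ Disj h → ind (Disj h) / D = 0 := fun h hh => by
    rw [ind_of_not hh, zero_div]
  have hb1 : ∑ h : I → PM V, ind (Disj h) / D = 1 := by
    rw [← sum_div, ← hD, div_self hD0.ne']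
  have hmul : ∀ (t : Fin K → (I → PM V) → ℝ) (g : (Fin K → I → PM V) → ℝ),
      (∀ H, Disj (flat H) → ∏ j, t j (H j) = g H / D ^ K) →
      crossSum t = (∑ H, ind (Disj (flat H)) * g H) / D ^ K := by
    intro t g h
    rw [sum_div]
    refine sum_congr rfl fun H _ => ?_
    by_cases hH : Disj (flat H)
    · rw [h H hH, mul_div_assoc]
    · rw [ind_of_not hH]; simp
  refine ⟨?_, ?_, ?_⟩
  · have h1 := main' (fun _ h => ind (Disj h) / D) (fun _ => hb0) (fun _ => hbs)
      (Or.inr fun _ => conjInv_ind_disj D)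
    rw [hmul _ (fun _ => 1) fun H hH => ?_] at h1
    · simpa [hb1] using h1
    · simp [ind_of (disj_block hH _)]
  · intro f f0 fs j
    have h1 := main' (fun j' h => if j' = j then f h / D else ind (Disj h) / D)
      (fun j' h => by split_ifs; exacts [div_nonneg (f0 h) hD0.le, hb0 h])
      (fun j' h hh => by split_ifs; exacts [by rw [fs h hh, zero_div], hbs h hh])
      (Or.inl ⟨j, fun j' hj' => by simpa [hj'] using conjInv_ind_disj D⟩)
    rw [hmul _ (fun H => f (H j)) fun H hH => ?_] at h1
    · have h2 : ∏ j', ∑ h : I → PM V, (if j' = j then f h / D else ind (Disj h) / D) =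
        (∑ h, f h) / D := by
        have : ∀ j', ∑ h : I → PM V, (if j' = j then f h / D else ind (Disj h) / D) =
            if j' = j then (∑ h, f h) / D else 1 := by
          intro j'
          split_ifs
          · rw [sum_div]
          · exact hb1
        simp_rw [this]
        simp
      rwa [h2] at h1
    · have : ∀ j', (if j' = j then f (H j') / D else ind (Disj (H j')) / D) =
          (if j' = j then f (H j) else 1) / D := by
        intro j'
        split_ifs with h
        · rw [h]
        · rw [ind_of (disj_block hH _)]
      simp_rw [this, prod_div_distrib]
      simp
  · intro f f0 fs hf i j hij
    have hfi : ConjInv fun h => f h / D := fun σ h => by simp only [hf σ h]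
    have h1 := main' (fun j' h => if j' = i ∨ j' = j then f h / D else ind (Disj h) / D)
      (fun j' h => by split_ifs; exacts [div_nonneg (f0 h) hD0.le, hb0 h])
      (fun j' h hh => by split_ifs; exacts [by rw [fs h hh, zero_div], hbs h hh])
      (Or.inr fun j' => by
        by_cases h : j' = i ∨ j' = j
        · simpa [h] using hfi
        · simpa [h] using conjInv_ind_disj D)
    rw [hmul _ (fun H => f (H i) * f (H j)) fun H hH => ?_] at h1
    · have h2 : ∏ j', ∑ h : I → PM V, (if j' = i ∨ j' = j then f h / D else ind (Disj h) / D) =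
        ((∑ h, f h) / D) ^ 2 := by
        have : ∀ j', ∑ h : I → PM V, (if j' = i ∨ j' = j then f h / D else ind (Disj h) / D) =
            (if j' = i then (∑ h, f h) / D else 1) * (if j' = j then (∑ h, f h) / D else 1) := by
          intro j'
          by_cases c1 : j' = i
          · subst c1; simp [hij, sum_div]
          · by_cases c2 : j' = j
            · subst c2; simp [c1, sum_div]
            · simp [c1, c2, hb1]
        simp_rw [this, prod_mul_distrib]
        simp [sq]
      rwa [h2] at h1
    · have : ∀ j', (if j' = i ∨ j' = j then f (H j') / D else ind (Disj (H j')) / D) =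
          (if j' = i then f (H i) else 1) * (if j' = j then f (H j) else 1) / D := by
        intro j'
        by_cases c1 : j' = i
        · subst c1; simp [hij]
        · by_cases c2 : j' = j
          · subst c2; simp [c1]
          · simp [c1, c2, ind_of (disj_block hH _)]
      simp_rw [this, prod_div_distrib, prod_mul_distrib]
      simp

set_option maxHeartbeats 1000000 in
/-- Amplification: a kernel hitting each graph with the right frequency from one block of
matchings yields a partial coupling using many independent blocks. -/
theorem exists_partial_coupling (L : ℕ) {ε θ : ℝ} (hε : 0 < ε) (hε1 : ε ≤ 1) (hθ : 0 < θ) :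
    ∃ K : ℕ, 1 ≤ K ∧ ∃ N₀ : ℕ, ∀ (V I 𝒢 : Type) [Fintype V] [Fintype I] [DecidableEq I] [Fintype 𝒢],
      Fintype.card I = L → N₀ ≤ Fintype.card V →
      ∀ (D : ℝ) (μ : 𝒢 → ℝ) (κ : (I → PM V) → 𝒢 → ℝ),
      D = ∑ h : I → PM V, ind (Disj h) → 0 < D → ∑ G, μ G = 1 → (∀ h G, 0 ≤ κ h G) →
      (∀ h G, ¬ Disj h → κ h G = 0) → (∀ h, ∑ G, κ h G ≤ 1) →
      ConjInv (fun h => ∑ G, κ h G) → (∀ G, ∑ h, κ h G ≤ θ * D * μ G) →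
      (1 - ε ^ 2 / 16) * (θ * D) ≤ ∑ h, ∑ G, κ h G →
      ∃ a : (Fin K → I → PM V) → 𝒢 → ℝ, (∀ H G, 0 ≤ a H G) ∧ (∀ G, ∑ H, a H G ≤ μ G) ∧
        0 < ∑ H : Fin K → I → PM V, ind (Disj (flat H)) ∧
        (∀ H, ∑ G, a H G ≤
          ind (Disj (flat H)) / ∑ H : Fin K → I → PM V, ind (Disj (flat H))) ∧
        (∀ H G, a H G ≠ 0 → ∃ j, κ (H j) G ≠ 0) ∧ 1 - ε ≤ ∑ H, ∑ G, a H G := by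
  set K : ℕ := max 1 ⌈4 / (θ * ε ^ 2)⌉₊ with hK
  have hK1 : 1 ≤ K := le_max_left _ _
  have hKθ : 4 / (θ * ε ^ 2) ≤ K :=
    (Nat.le_ceil _).trans (by exact_mod_cast le_max_right 1 _)
  have hK0 : (0 : ℝ) < K := by exact_mod_cast hK1
  set η : ℝ := ε ^ 2 / 32 with hη
  have hη0 : 0 < η := by positivity
  have hη1 : η ≤ 1 / 32 := by rw [hη]; nlinarith
  obtain ⟨q, N₀, hq, hb⟩ := exists_block_bounds K L (η := η / 4) (by positivity)
  refine ⟨K, hK1, N₀, fun V I 𝒢 _ _ _ _ hI hV D μ κ hD hD0 hμ κ0 κs κ1 κi κrow κtot => ?_⟩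
  obtain ⟨hb0, hb1, hb2⟩ := hb V I hI hV D hD hD0
  set J : ℝ := ∑ H : Fin K → I → PM V, ind (Disj (flat H)) with hJ
  set p := q - η / 4 * q with hp
  set P := q + η / 4 * q with hP
  have hp0 : 0 < p := by rw [hp]; nlinarith
  have hPp : P ≤ (1 + η) * p := by rw [hP, hp]; nlinarith [mul_pos hq hη0]
  have hDK : 0 < D ^ K := by positivity
  have hJl : p * D ^ K ≤ J := by
    rw [← le_div_iff₀ hDK]; have := (abs_le.1 hb0).1; linarith
  have hJu : J ≤ P * D ^ K := by
    rw [← div_le_iff₀ hDK]; have := (abs_le.1 hb0).2; linarith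
  have hJ0 : 0 < J := lt_of_lt_of_le (by positivity) hJl
  have hP0 : 0 < P := by positivity
  set t : (I → PM V) → ℝ := fun h => ∑ G, κ h G with ht
  have t0 : ∀ h, 0 ≤ t h := fun h => sum_nonneg fun G _ => κ0 h G
  have ts : ∀ h, ¬ Disj h → t h = 0 := fun h hh => sum_eq_zero fun G _ => κs h G hh
  set S : (Fin K → I → PM V) → ℝ := fun H => ∑ j, t (H j) with hS
  have S0 : ∀ H, 0 ≤ S H := fun H => sum_nonneg fun j _ => t0 _
  set lam : ℝ := K * θ * (1 + η) with hlam
  have lam0 : 0 < lam := by positivity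
  have hmax : ∀ H, 0 < max (S H) lam := fun H => lt_max_of_lt_right lam0
  set T : ℝ := (∑ h, t h) / D with hT
  have hTu : T ≤ θ := by
    rw [hT, div_le_iff₀ hD0]
    simp only [ht]
    rw [sum_comm]
    calc _ ≤ ∑ G, θ * D * μ G := sum_le_sum fun G _ => κrow G
      _ = _ := by rw [← mul_sum, hμ, mul_one]
  have hTl : (1 - ε ^ 2 / 16) * θ ≤ T := by
    rw [hT, le_div_iff₀ hD0]; linarith
  have hT0 : 0 ≤ T := div_nonneg (sum_nonneg fun h _ => t0 h) hD0.le
  -- block sums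
  have b1u : ∀ f : (I → PM V) → ℝ, (∀ h, 0 ≤ f h) → (∀ h, ¬ Disj h → f h = 0) → ∀ j : Fin K,
      ∑ H : Fin K → I → PM V, ind (Disj (flat H)) * f (H j) ≤ P * ((∑ h, f h) / D) * D ^ K := by
    intro f f0 fs j
    rw [← div_le_iff₀ hDK]
    have := (abs_le.1 (hb1 f f0 fs j)).2
    rw [hP]; linarith
  have b1l : ∀ j : Fin K, p * T * D ^ K ≤
      ∑ H : Fin K → I → PM V, ind (Disj (flat H)) * t (H j) := by
    intro j
    rw [← le_div_iff₀ hDK]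
    have := (abs_le.1 (hb1 t t0 ts j)).1
    rw [hp]; linarith
  have b2u : ∀ i j : Fin K, i ≠ j →
      ∑ H : Fin K → I → PM V, ind (Disj (flat H)) * (t (H i) * t (H j)) ≤ P * T ^ 2 * D ^ K := by
    intro i j hij
    rw [← div_le_iff₀ hDK]
    have := (abs_le.1 (hb2 t t0 ts κi i j hij)).2
    rw [hP]; linarith
  refine ⟨fun H G => ind (Disj (flat H)) / J * ((∑ j, κ (H j) G) / max (S H) lam), ?_, ?_, hJ0,
    ?_, ?_, ?_⟩
  · exact fun H G => mul_nonneg (div_nonneg (ind_nonneg _) hJ0.le)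
      (div_nonneg (sum_nonneg fun j _ => κ0 _ _) (hmax H).le)
  · intro G
    have hμ0 : 0 ≤ θ * μ G := by
      have h1 : 0 ≤ θ * D * μ G := (sum_nonneg fun h _ => κ0 h G).trans (κrow G)
      by_contra! hcon
      nlinarith
    calc _ ≤ ∑ H : Fin K → I → PM V, 1 / (J * lam) * ∑ j, ind (Disj (flat H)) * κ (H j) G := by
          refine sum_le_sum fun H _ => ?_
          dsimp only
          rw [← mul_sum, div_mul_div_comm, one_div_mul_eq_div]
          refine div_le_div_of_nonneg_left (mul_nonneg (ind_nonneg _)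
            (sum_nonneg fun j _ => κ0 _ _)) (by positivity) ?_
          exact mul_le_mul_of_nonneg_left (le_max_right _ _) hJ0.le
      _ = 1 / (J * lam) * ∑ j, ∑ H : Fin K → I → PM V, ind (Disj (flat H)) * κ (H j) G := by
          rw [← mul_sum, sum_comm]
      _ ≤ 1 / (J * lam) * ∑ j : Fin K, P * (θ * μ G) * D ^ K := by
          refine mul_le_mul_of_nonneg_left (sum_le_sum fun j _ => ?_) (by positivity)
          refine (b1u (fun h => κ h G) (fun h => κ0 h G) (fun h hh => κs h G hh) j).trans ?_
          refine mul_le_mul_of_nonneg_right (mul_le_mul_of_nonneg_left ?_ hP0.le) hDK.le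
          rw [div_le_iff₀ hD0]
          linarith [κrow G]
      _ ≤ μ G := by
          rw [sum_const, card_univ, Fintype.card_fin, nsmul_eq_mul, one_div_mul_eq_div,
            div_le_iff₀ (by positivity)]
          have hm : 0 ≤ μ G := by
            by_contra! hcon
            nlinarith
          have h1 : P * D ^ K ≤ (1 + η) * J := by
            calc P * D ^ K ≤ (1 + η) * p * D ^ K := mul_le_mul_of_nonneg_right hPp hDK.le
              _ = (1 + η) * (p * D ^ K) := by ring
              _ ≤ _ := mul_le_mul_of_nonneg_left hJl (by positivity)
          calc (K : ℝ) * (P * (θ * μ G) * D ^ K) = (P * D ^ K) * (K * θ * μ G) := by ring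
            _ ≤ ((1 + η) * J) * (K * θ * μ G) := mul_le_mul_of_nonneg_right h1 (by positivity)
            _ = _ := by rw [hlam]; ring
  · intro H
    rw [← mul_sum, ← sum_div, sum_comm]
    refine mul_le_of_le_one_right (div_nonneg (ind_nonneg _) hJ0.le) ?_
    rw [div_le_one (hmax H)]
    exact le_max_left _ _
  · intro H G h
    by_contra! hcon
    refine h ?_
    dsimp only
    rw [sum_eq_zero fun j _ => hcon j]
    simp
  · have hE1 : (K : ℝ) * (p * T * D ^ K) ≤ ∑ H, ind (Disj (flat H)) * S H := by
      simp only [hS, mul_sum]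
      rw [sum_comm]
      calc _ = ∑ j : Fin K, p * T * D ^ K := by simp
        _ ≤ _ := sum_le_sum fun j _ => b1l j
    have hE2 : ∑ H, ind (Disj (flat H)) * S H ^ 2 ≤
        K * (P * T * D ^ K) + K * (K * (P * T ^ 2 * D ^ K)) := by
      have : ∀ H, ind (Disj (flat H)) * S H ^ 2 =
          ∑ i, ∑ j, ind (Disj (flat H)) * (t (H i) * t (H j)) := by
        intro H
        simp only [hS, sq, sum_mul_sum]
        simp only [mul_sum]
      simp_rw [this]
      rw [sum_comm]
      have hcomm : ∀ i : Fin K, ∑ H, ∑ j, ind (Disj (flat H)) * (t (H i) * t (H j)) =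
        ∑ j, ∑ H, ind (Disj (flat H)) * (t (H i) * t (H j)) := fun i => sum_comm
      simp_rw [hcomm]
      have hpt : 0 ≤ P * T ^ 2 * D ^ K := by positivity
      have hpt' : 0 ≤ P * T * D ^ K := by positivity
      calc _ ≤ ∑ i : Fin K, ∑ j : Fin K, ((if i = j then P * T * D ^ K else 0) +
            P * T ^ 2 * D ^ K) := by
            refine sum_le_sum fun i _ => sum_le_sum fun j _ => ?_
            by_cases hij : i = j
            · subst hij
              rw [if_pos rfl]
              refine le_trans ?_ (le_add_of_nonneg_right hpt)
              refine le_trans (sum_le_sum fun H _ => ?_) (b1u t t0 ts i)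
              exact mul_le_mul_of_nonneg_left (mul_le_of_le_one_right (t0 _) (κ1 _)) (ind_nonneg _)
            · rw [if_neg hij, zero_add]
              exact b2u i j hij
        _ = _ := by simp [sum_add_distrib]
    have hpoint : ∀ x : ℝ, 0 ≤ x → 1 - ε / 2 - (1 - 2 * (x / lam) + (x / lam) ^ 2) / (2 * ε) ≤
        x / max x lam := by
      intro x hx
      have hy : 1 - |1 - x / lam| ≤ x / max x lam := by
        rcases le_total x lam with h | h
        · rw [max_eq_right h, abs_of_nonneg (sub_nonneg.2 ((div_le_one lam0).2 h))]; linarith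
        · rw [max_eq_left h, div_self (lam0.trans_le h).ne']
          linarith [abs_nonneg (1 - x / lam)]
      refine le_trans ?_ hy
      have h1 : |1 - x / lam| ≤ ε / 2 + |1 - x / lam| ^ 2 / (2 * ε) := by
        rw [← sub_le_iff_le_add', le_div_iff₀ (by positivity)]
        nlinarith [sq_nonneg (|1 - x / lam| - ε)]
      rw [sq_abs] at h1
      have : (1 - x / lam) ^ 2 = 1 - 2 * (x / lam) + (x / lam) ^ 2 := by ring
      rw [this] at h1
      linarith
    have hJsum : ∑ H : Fin K → I → PM V, ind (Disj (flat H)) / J = 1 := by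
      rw [← sum_div, div_self hJ0.ne']
    have htot : ∑ H : Fin K → I → PM V, ∑ G, ind (Disj (flat H)) / J *
        ((∑ j, κ (H j) G) / max (S H) lam) =
        ∑ H : Fin K → I → PM V, ind (Disj (flat H)) / J * (S H / max (S H) lam) := by
      refine sum_congr rfl fun H _ => ?_
      rw [← mul_sum, ← sum_div, sum_comm]
    rw [htot]
    have hlow : (∑ H : Fin K → I → PM V, ind (Disj (flat H)) / J *
        (1 - ε / 2 - (1 - 2 * (S H / lam) + (S H / lam) ^ 2) / (2 * ε))) =
        1 - ε / 2 - (1 - 2 * ((∑ H, ind (Disj (flat H)) * S H) / (J * lam)) +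
          (∑ H, ind (Disj (flat H)) * S H ^ 2) / (J * lam ^ 2)) / (2 * ε) := by
      calc _ = ∑ H : Fin K → I → PM V, ((ind (Disj (flat H)) / J) * (1 - ε / 2 - 1 / (2 * ε)) +
            (ind (Disj (flat H)) * S H) * (1 / (J * lam) / ε) -
            (ind (Disj (flat H)) * S H ^ 2) * (1 / (J * lam ^ 2) / (2 * ε))) := by
            refine sum_congr rfl fun H _ => ?_
            field_simp
            ring
        _ = _ := by
            rw [sum_sub_distrib, sum_add_distrib, ← sum_mul, ← sum_mul, ← sum_mul, hJsum]
            field_simp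
            ring
    refine le_trans ?_ (le_trans hlow.ge (sum_le_sum fun H _ =>
      mul_le_mul_of_nonneg_left (hpoint (S H) (S0 H)) (div_nonneg (ind_nonneg _) hJ0.le)))
    have hx1 : 1 - ε ^ 2 / 8 ≤ (∑ H, ind (Disj (flat H)) * S H) / (J * lam) := by
      rw [le_div_iff₀ (by positivity)]
      refine le_trans ?_ hE1
      have hJ2 : J ≤ (1 + η) * p * D ^ K := hJu.trans (mul_le_mul_of_nonneg_right hPp hDK.le)
      have hη2 : (1 - ε ^ 2 / 8) * (1 + η) ^ 2 ≤ 1 - ε ^ 2 / 16 := by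
        have key : ∀ e : ℝ, 0 ≤ e → (1 - e / 8) * (1 + e / 32) ^ 2 ≤ 1 - e / 16 := by
          intro e he
          have h2 := pow_nonneg he 2
          have h3 := pow_nonneg he 3
          have : (1 - e / 8) * (1 + e / 32) ^ 2 = 1 - e / 16 - 7 / 1024 * e ^ 2 - e ^ 3 / 8192 := by
            ring
          linarith
        exact key _ (sq_nonneg ε)
      have h8 : 0 ≤ 1 - ε ^ 2 / 8 := by nlinarith
      calc (1 - ε ^ 2 / 8) * (J * lam) ≤ (1 - ε ^ 2 / 8) * ((1 + η) * p * D ^ K * lam) :=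
            mul_le_mul_of_nonneg_left (mul_le_mul_of_nonneg_right hJ2 lam0.le) h8
        _ = ((1 - ε ^ 2 / 8) * (1 + η) ^ 2) * (K * θ * p * D ^ K) := by rw [hlam]; ring
        _ ≤ (1 - ε ^ 2 / 16) * (K * θ * p * D ^ K) :=
            mul_le_mul_of_nonneg_right hη2 (by positivity)
        _ = K * p * D ^ K * ((1 - ε ^ 2 / 16) * θ) := by ring
        _ ≤ K * p * D ^ K * T := mul_le_mul_of_nonneg_left hTl (by positivity)
        _ = _ := by ring
    have hx2 : (∑ H, ind (Disj (flat H)) * S H ^ 2) / (J * lam ^ 2) ≤ 1 + ε ^ 2 / 4 := by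
      rw [div_le_iff₀ (by positivity)]
      refine hE2.trans ?_
      have hKθ' : 1 ≤ K * θ * (ε ^ 2 / 4) := by
        rw [div_le_iff₀ (by positivity)] at hKθ
        linarith
      calc K * (P * T * D ^ K) + K * (K * (P * T ^ 2 * D ^ K))
          = (P * D ^ K) * (K * T + (K * T) ^ 2) := by ring
        _ ≤ (P * D ^ K) * (K * θ + (K * θ) ^ 2) := by
            have hKT : K * T ≤ K * θ := mul_le_mul_of_nonneg_left hTu hK0.le
            have hKT0 : 0 ≤ K * T := by positivity
            refine mul_le_mul_of_nonneg_left ?_ (by positivity)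
            nlinarith
        _ ≤ ((1 + η) * (p * D ^ K)) * ((1 + ε ^ 2 / 4) * (K * θ) ^ 2) := by
            refine mul_le_mul ?_ ?_ (by positivity) (by positivity)
            · rw [← mul_assoc]
              exact mul_le_mul_of_nonneg_right hPp hDK.le
            · nlinarith [mul_pos hK0 hθ]
        _ ≤ ((1 + η) * J) * ((1 + ε ^ 2 / 4) * (K * θ) ^ 2) := by
            refine mul_le_mul_of_nonneg_right (mul_le_mul_of_nonneg_left hJl (by positivity))
              (by positivity)
        _ = (1 + ε ^ 2 / 4) * (J * ((K * θ) ^ 2 * (1 + η))) := by ring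
        _ ≤ (1 + ε ^ 2 / 4) * (J * lam ^ 2) := by
            refine mul_le_mul_of_nonneg_left (mul_le_mul_of_nonneg_left ?_ hJ0.le) (by positivity)
            rw [hlam, mul_pow (K * θ : ℝ)]
            refine mul_le_mul_of_nonneg_left ?_ (by positivity)
            nlinarith
    have hfin : (1 - 2 * ((∑ H, ind (Disj (flat H)) * S H) / (J * lam)) +
          (∑ H, ind (Disj (flat H)) * S H ^ 2) / (J * lam ^ 2)) / (2 * ε) ≤ ε / 4 := by
      rw [div_le_iff₀ (by positivity)]
      nlinarith
    linarith

lemma exists_coupling_of_partial {α β : Type*} [Fintype α] [Fintype β] (μ : α → ℝ) (ν : β → ℝ)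
    (a : α → β → ℝ) (hμ : ∑ x, μ x = 1) (hν : ∑ y, ν y = 1) (ha : ∀ x y, 0 ≤ a x y)
    (hr : ∀ x, ∑ y, a x y ≤ μ x) (hc : ∀ y, ∑ x, a x y ≤ ν y) :
    ∃ π : α × β → ℝ, (∀ z, 0 ≤ π z) ∧ (∀ x, ∑ y, π (x, y) = μ x) ∧ (∀ y, ∑ x, π (x, y) = ν y) ∧
      ∀ x y, a x y ≤ π (x, y) := by
  set r : α → ℝ := fun x => μ x - ∑ y, a x y
  set s : β → ℝ := fun y => ν y - ∑ x, a x y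
  set R : ℝ := ∑ x, r x with hR
  have hr0 : ∀ x, 0 ≤ r x := fun x => sub_nonneg.2 (hr x)
  have hs0 : ∀ y, 0 ≤ s y := fun y => sub_nonneg.2 (hc y)
  have hS : ∑ y, s y = R := by
    simp only [s, r, hR, sum_sub_distrib, hμ, hν]
    rw [sum_comm]
  have hR0 : 0 ≤ R := sum_nonneg fun x _ => hr0 x
  have hdiv : ∀ c : ℝ, (R = 0 → c = 0) → c * R / R = c := by
    intro c h
    by_cases h0 : R = 0
    · simp [h h0]
    · field_simp
  refine ⟨fun z => a z.1 z.2 + r z.1 * s z.2 / R, fun z => add_nonneg (ha _ _)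
    (div_nonneg (mul_nonneg (hr0 _) (hs0 _)) hR0), fun x => ?_, fun y => ?_, fun x y => ?_⟩
  · simp only [sum_add_distrib]
    rw [← sum_div, ← mul_sum, hS, hdiv]
    · simp [r]
    · intro h
      exact (sum_eq_zero_iff_of_nonneg fun x _ => hr0 x).1 h x (mem_univ x)
  · simp only [sum_add_distrib]
    rw [← sum_div, ← sum_mul, mul_comm, hdiv]
    · simp [s]
    · intro h
      rw [← hS] at h
      exact (sum_eq_zero_iff_of_nonneg fun x _ => hs0 x).1 h y (mem_univ y)
  · exact le_add_of_nonneg_right (div_nonneg (mul_nonneg (hr0 _) (hs0 _)) hR0)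

lemma sum_sum_ind_eq {X Y : Type*} [Fintype X] [Fintype Y] (g : X → Y) (f : X → ℝ) :
    ∑ y, ∑ x, f x * ind (g x = y) = ∑ x, f x := by
  rw [sum_comm]
  refine sum_congr rfl fun x _ => ?_
  rw [← mul_sum, sum_eq_single (g x), ind_of rfl, mul_one]
  · intro y _ hy
    exact ind_of_not (Ne.symm hy)
  · intro h
    exact absurd (mem_univ _) h

section Graphs
variable {n : ℕ} {I : Type*}

/-- The union of a family of perfect matchings as a graph. -/
def unionGraph (M : I → PM (Fin n)) : SimpleGraph (Fin n) where
  Adj := adjU M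
  symm := ⟨by rintro u v ⟨i, rfl⟩; exact ⟨i, by simp⟩⟩
  loopless := ⟨by rintro u ⟨i, hi⟩; exact (M i).apply_ne u hi⟩

/-- A perfect matching as a graph. -/
def matchingGraph (M : PM (Fin n)) : SimpleGraph (Fin n) where
  Adj u v := M u = v
  symm := ⟨by rintro u v rfl; simp⟩
  loopless := ⟨fun u hu => M.apply_ne u hu⟩

lemma matchingGraph_adj {M : PM (Fin n)} {u v : Fin n} : (matchingGraph M).Adj u v ↔ M u = v :=
  Iff.rfl

lemma matchingGraph_injective : Function.Injective (matchingGraph (n := n)) := by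
  intro M N h
  ext v
  have : (matchingGraph N).Adj v (M v) := by rw [← h]; rfl
  exact congrArg Fin.val (matchingGraph_adj.1 this).symm

lemma isRegularGraph_matchingGraph (M : PM (Fin n)) : IsRegularGraph (matchingGraph M) 1 := by
  intro v
  rw [gDeg, Nat.card_eq_one_iff_unique]
  exact ⟨⟨fun a b => Subtype.ext ((matchingGraph_adj.1 a.2).symm.trans (matchingGraph_adj.1 b.2))⟩, ⟨⟨M v, rfl⟩⟩⟩

lemma exists_matchingGraph {G : SimpleGraph (Fin n)} (h : IsRegularGraph G 1) :
    ∃ M, matchingGraph M = G := by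
  have h1 : ∀ v, ∃ w, G.Adj v w ∧ ∀ w', G.Adj v w' → w' = w := by
    intro v
    have := h v
    rw [gDeg, Nat.card_eq_one_iff_unique] at this
    obtain ⟨⟨hs⟩, ⟨w, hw⟩⟩ := this
    exact ⟨w, hw, fun w' hw' => congrArg Subtype.val (hs ⟨w', hw'⟩ ⟨w, hw⟩)⟩
  choose f hf hf' using h1
  refine ⟨PM.mk f (fun v => (hf' _ _ (hf v).symm).symm) (fun v hv => ?_), ?_⟩
  · have := hf v
    rw [hv] at this
    exact G.irrefl this
  · ext u v
    constructor
    · rintro rfl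
      exact hf u
    · intro huv
      exact (hf' u v huv).symm

lemma unionGraph_eq_iSup (M : I → PM (Fin n)) : unionGraph M = ⨆ i, matchingGraph (M i) := by
  ext u v
  rw [SimpleGraph.iSup_adj]
  rfl

lemma disjoint_matchingGraph (M N : PM (Fin n)) :
    Disjoint (matchingGraph M) (matchingGraph N) ↔ ∀ v, M v ≠ N v := by
  rw [SimpleGraph.disjoint_left]
  constructor
  · intro h v hv
    exact h v (M v) rfl hv.symm
  · rintro h u v rfl h2
    exact h u (matchingGraph_adj.1 h2).symm

lemma nFact_eq_card (d : ℕ) (f : Fin d ≃ I) (G : SimpleGraph (Fin n)) :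
    nFact d G = Nat.card {M : I → PM (Fin n) // Disj M ∧ unionGraph M = G} := by
  rw [nFact]
  have key : ∀ M : {M : I → PM (Fin n) // Disj M ∧ unionGraph M = G},
      (∀ i, IsRegularGraph (matchingGraph (M.1 (f i))) 1) ∧ (∀ i j, i ≠ j →
        Disjoint (matchingGraph (M.1 (f i))) (matchingGraph (M.1 (f j)))) ∧
        ⨆ i, matchingGraph (M.1 (f i)) = G := by
    intro M
    refine ⟨fun i => isRegularGraph_matchingGraph _, fun i j hij => ?_, ?_⟩
    · rw [disjoint_matchingGraph]
      exact M.2.1 _ _ (by simpa)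
    · refine Eq.trans ?_ M.2.2
      rw [unionGraph_eq_iSup]
      exact f.iSup_comp (g := fun i => matchingGraph (M.1 i))
  refine (Nat.card_congr (Equiv.ofBijective (fun M => ⟨fun i => matchingGraph (M.1 (f i)), key M⟩)
    ⟨?_, ?_⟩)).symm
  · rintro ⟨M, hM⟩ ⟨N, hN⟩ h
    rw [Subtype.mk.injEq] at h ⊢
    funext i
    have := matchingGraph_injective (congrFun h (f.symm i))
    simpa using this
  · rintro ⟨g, hg1, hg2, hg3⟩
    choose M hM using fun i => exists_matchingGraph (hg1 i)
    refine ⟨⟨fun i => M (f.symm i), ?_, ?_⟩, ?_⟩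
    · intro i j hij
      rw [← disjoint_matchingGraph, hM, hM]
      exact hg2 _ _ (by simpa)
    · rw [unionGraph_eq_iSup, ← hg3]
      simp_rw [hM]
      exact f.symm.iSup_comp (g := g)
    · rw [Subtype.mk.injEq]
      funext i
      simp [hM]

end Graphs

lemma nFact_eq_sum {n K L : ℕ} (G : SimpleGraph (Fin n)) :
    (nFact (K * L) G : ℝ) = ∑ H : Fin K → Fin L → PM (Fin n),
      ind (Disj (flat H)) * ind (unionGraph (flat H) = G) := by
  rw [nFact_eq_card _ finProdFinEquiv.symm]
  simp_rw [← ind_and]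
  rw [sum_ind, Nat.cast_inj, ← Fintype.card_subtype, ← Nat.card_eq_fintype_card]
  refine Nat.card_congr ?_
  exact (Equiv.curry _ _ _).subtypeEquiv fun M => Iff.rfl

set_option maxHeartbeats 1000000 in
/-- The conclusion of the coupling statement follows from a good kernel for one block. -/
theorem exists_coupling_of_kernel (d : ℕ) (hkernel : ∀ ε : ℝ, 0 < ε → ∃ l : ℕ, 1 ≤ l ∧
      ∃ θ : ℝ, 0 < θ ∧ ∃ N₀ : ℕ, ∀ m, N₀ ≤ 2 * m →
      ∃ (D : ℝ) (κ : (Fin (l * d) → PM (Fin (2 * m))) → SimpleGraph (Fin (2 * m)) → ℝ),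
      D = ∑ h : Fin (l * d) → PM (Fin (2 * m)), ind (Disj h) ∧ 0 < D ∧
      ∑ G, mu (2 * m) d G = 1 ∧ (∀ h G, 0 ≤ κ h G) ∧
      (∀ h G, κ h G ≠ 0 → Disj h ∧ G ≤ unionGraph h) ∧ (∀ h, ∑ G, κ h G ≤ 1) ∧
      ConjInv (fun h => ∑ G, κ h G) ∧ (∀ G, ∑ h, κ h G ≤ θ * D * mu (2 * m) d G) ∧
      (1 - ε) * (θ * D) ≤ ∑ h, ∑ G, κ h G) (ε : ℝ) (hε : 0 < ε) :
    ∃ k : ℕ, 1 ≤ k ∧ ∃ n₀ : ℕ, ∀ m : ℕ, n₀ ≤ 2*m →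
      ∃ π : SimpleGraph (Fin (2*m)) × SimpleGraph (Fin (2*m)) → ℝ,
        IsCoupling π (mu (2*m) d) (nu (2*m) (k*d)) ∧
        1 - ε ≤ probOf π {p | p.1 ≤ p.2} := by
  set δ := min ε 1 with hδ
  have hδ0 : 0 < δ := lt_min hε one_pos
  obtain ⟨l, hl, θ, hθ, N₁, hN₁⟩ := hkernel (δ ^ 2 / 16) (by positivity)
  obtain ⟨K, hK, N₂, hN₂⟩ := exists_partial_coupling (l * d) hδ0 (min_le_right _ _) hθ
  refine ⟨K * l, Nat.one_le_iff_ne_zero.2 (by positivity), max N₁ N₂, fun m hm => ?_⟩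
  obtain ⟨D, κ, hD, hD0, hμ, κ0, κs, κ1, κi, κrow, κtot⟩ := hN₁ m (le_trans (le_max_left _ _) hm)
  obtain ⟨a, a0, arow, hJ, acol, asupp, atot⟩ := hN₂ (Fin (2 * m)) (Fin (l * d))
    (SimpleGraph (Fin (2 * m))) (Fintype.card_fin _)
    (by rw [Fintype.card_fin]; exact le_trans (le_max_right _ _) hm) D (mu (2 * m) d) κ hD hD0 hμ κ0
    (fun h G hh => by by_contra hne; exact hh (κs h G hne).1) κ1 κi κrow κtot
  set J := ∑ H : Fin K → Fin (l * d) → PM (Fin (2 * m)), ind (Disj (flat H)) with hJdef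
  have hnu : ∀ G, nu (2 * m) (K * l * d) G = (∑ H : Fin K → Fin (l * d) → PM (Fin (2 * m)),
      ind (Disj (flat H)) * ind (unionGraph (flat H) = G)) / J := by
    intro G
    rw [nu, tsum_fintype, mul_assoc]
    simp_rw [nFact_eq_sum]
    rw [sum_sum_ind_eq fun H => unionGraph (flat H)]
  have hasum : ∀ H G, a H G ≠ 0 → G ≤ unionGraph (flat H) := by
    intro H G h
    obtain ⟨j, hj⟩ := asupp H G h
    refine (κs _ _ hj).2.trans ?_
    rintro u v ⟨i, hi⟩
    exact ⟨(j, i), hi⟩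
  have hfib : ∀ f : (Fin K → Fin (l * d) → PM (Fin (2 * m))) → ℝ,
      ∑ G, ∑ H, f H * ind (unionGraph (flat H) = G) = ∑ H, f H :=
    sum_sum_ind_eq fun H => unionGraph (flat H)
  obtain ⟨π, π0, πr, πc, πa⟩ := exists_coupling_of_partial (mu (2 * m) d)
    (nu (2 * m) (K * l * d)) (fun G G' => ∑ H, a H G * ind (unionGraph (flat H) = G')) hμ
    (by
      simp_rw [hnu]
      rw [← sum_div, hfib, div_self hJ.ne'])
    (fun G G' => sum_nonneg fun H _ => mul_nonneg (a0 _ _) (ind_nonneg _))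
    (fun G => by rw [hfib]; exact arow G)
    (fun G' => by
      rw [hnu, sum_comm, sum_div]
      refine sum_le_sum fun H _ => ?_
      rw [← sum_mul, mul_div_right_comm]
      exact mul_le_mul_of_nonneg_right (acol H) (ind_nonneg _))
  refine ⟨π, ⟨⟨π0, ?_⟩, fun G => ?_, fun G' => ?_⟩, ?_⟩
  · rw [tsum_fintype, Fintype.sum_prod_type]
    simp_rw [πr]
    exact hμ
  · rw [tsum_fintype]; exact πr G
  · rw [tsum_fintype]; exact πc G'
  · have hle : 1 - ε ≤ 1 - δ := by have := min_le_left ε 1; linarith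
    refine hle.trans (atot.trans ?_)
    rw [probOf, _root_.tsum_subtype _ π, tsum_fintype, Fintype.sum_prod_type]
    rw [sum_comm]
    refine sum_le_sum fun G _ => ?_
    rw [← hfib]
    refine sum_le_sum fun G' _ => ?_
    by_cases h : G ≤ G'
    · rw [Set.indicator_of_mem (by exact h)]
      exact πa G G'
    · rw [Set.indicator_of_notMem (by exact h)]
      refine le_of_eq (sum_eq_zero fun H _ => ?_)
      by_cases ha : a H G = 0
      · rw [ha, zero_mul]
      · rw [ind_of_not, mul_zero]
        rintro rfl
        exact h (hasum H G ha)

section Maclaurin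
variable {I : Type*}

lemma mul_one_sub_pow_le {s t : ℝ} (ht : t ≤ 1) (d : ℕ) (hd : (d : ℝ) ≤ s) :
    (1 + s * t) * (1 - t) ^ d ≤ 1 + (s - d) * t := by
  induction d with
  | zero => simp
  | succ d ih =>
    push_cast at hd ⊢
    have h := mul_le_mul_of_nonneg_right (ih (by linarith)) (sub_nonneg.2 ht)
    rw [pow_succ, ← mul_assoc]
    refine h.trans ?_
    nlinarith [mul_nonneg (show 0 ≤ s - d by linarith) (sq_nonneg t)]

/-- Sum over the injective `d`-tuples of elements of `S` of the product of the weights. -/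
noncomputable def injSum (w : I → ℝ) : ℕ → Finset I → ℝ
  | 0, _ => 1
  | d + 1, S => ∑ a ∈ S, w a * injSum w d (S.erase a)

lemma injSum_le {w : I → ℝ} (hw : ∀ a, 0 ≤ w a) (d : ℕ) (S : Finset I) (hd : d ≤ S.card) :
    injSum w d S ≤ S.card.descFactorial d * ((∑ a ∈ S, w a) / S.card) ^ d := by
  induction d generalizing S with
  | zero => simp [injSum]
  | succ d ih =>
    obtain ⟨s, hs⟩ : ∃ s, S.card = s + 1 := ⟨S.card - 1, by omega⟩
    set W := ∑ a ∈ S, w a with hW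
    have hW0 : 0 ≤ W := sum_nonneg fun a _ => hw a
    rw [injSum, hs, Nat.succ_descFactorial_succ]
    have hds : d ≤ s := by omega
    have h1 : ∀ a ∈ S, w a * injSum w d (S.erase a) ≤
        w a * (s.descFactorial d * ((W - w a) / s) ^ d) := by
      intro a ha
      have hc : (S.erase a).card = s := by rw [card_erase_of_mem ha, hs]; rfl
      have := ih (S.erase a) (by omega)
      rw [hc] at this
      have h2 : ∑ b ∈ S.erase a, w b = W - w a := by
        rw [hW, ← add_sum_erase S w ha]; ring
      rw [h2] at this
      exact mul_le_mul_of_nonneg_left this (hw a)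
    refine (sum_le_sum h1).trans ?_
    rcases Nat.eq_zero_or_pos s with h0 | hs0
    · subst h0
      have : d = 0 := by omega
      subst this
      simp [hW]
    have hsr : (0 : ℝ) < s := by exact_mod_cast hs0
    rcases hW0.eq_or_lt with hW00 | hWpos
    · rw [← hW00]
      have : ∀ a ∈ S, w a = 0 := fun a ha =>
        (sum_eq_zero_iff_of_nonneg fun a _ => hw a).1 hW00.symm a ha
      rw [sum_eq_zero fun a ha => by rw [this a ha, zero_mul]]
      simp
    set μ := W / ((s + 1 : ℕ) : ℝ) with hμ
    have hμ0 : 0 < μ := by positivity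
    have hWμ : W = (s + 1) * μ := by
      rw [hμ]; push_cast; field_simp
    have h2 : ∀ a ∈ S, w a * (s.descFactorial d * ((W - w a) / s) ^ d) ≤
        s.descFactorial d * μ ^ d * (μ + (s - d) * ((w a - μ) / s)) := by
      intro a ha
      have hle : w a ≤ W := single_le_sum (fun b _ => hw b) ha
      set t := (w a / μ - 1) / s with ht
      have ht1 : t ≤ 1 := by
        rw [ht, div_le_one hsr, sub_le_iff_le_add, div_le_iff₀ hμ0]
        linarith
      have key := mul_one_sub_pow_le ht1 d (s := s) (by exact_mod_cast hds)
      have e1 : 1 + s * t = w a / μ := by rw [ht]; field_simp; ring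
      have e2 : (W - w a) / s = μ * (1 - t) := by
        rw [ht, hWμ]; field_simp; ring
      have e3 : (w a - μ) / s = μ * t := by rw [ht]; field_simp
      rw [e1] at key
      rw [e2, e3, mul_pow]
      have e4 : w a = μ * (w a / μ) := by field_simp
      calc w a * (s.descFactorial d * (μ ^ d * (1 - t) ^ d))
          = s.descFactorial d * μ ^ d * μ * (w a / μ * (1 - t) ^ d) := by
            conv_lhs => rw [e4]
            ring
        _ ≤ s.descFactorial d * μ ^ d * μ * (1 + (s - d) * t) :=
            mul_le_mul_of_nonneg_left key (by positivity)
        _ = _ := by ring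
    refine (sum_le_sum h2).trans (le_of_eq ?_)
    have h3 : ∑ a ∈ S, (w a - μ) / s = 0 := by
      rw [← sum_div, sum_sub_distrib, sum_const, hs, ← hW, nsmul_eq_mul]
      push_cast
      rw [← hWμ, sub_self, zero_div]
    rw [← mul_sum, sum_add_distrib, ← mul_sum, h3, sum_const, hs, nsmul_eq_mul]
    push_cast
    ring

lemma sum_injective_eq_injSum [Fintype I] (w : I → ℝ) (d : ℕ) (S : Finset I) :
    ∑ f : Fin d → I, ind (Function.Injective f ∧ ∀ i, f i ∈ S) * ∏ i, w (f i) = injSum w d S := by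
  induction d generalizing S with
  | zero =>
    rw [Fintype.sum_unique, ind_of ⟨fun i => i.elim0, fun i => i.elim0⟩]
    simp [injSum]
  | succ d ih =>
    rw [← Equiv.sum_comp (Fin.consEquiv fun _ => I), Fintype.sum_prod_type, injSum]
    have h1 : ∀ a, ∑ f : Fin d → I, ind (Function.Injective (Fin.consEquiv (fun _ => I) (a, f)) ∧
        ∀ i, Fin.consEquiv (fun _ => I) (a, f) i ∈ S) *
          ∏ i, w (Fin.consEquiv (fun _ => I) (a, f) i) =
        if a ∈ S then w a * injSum w d (S.erase a) else 0 := by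
      intro a
      split_ifs with ha
      · rw [← ih, mul_sum]
        refine sum_congr rfl fun f _ => ?_
        have : (Function.Injective (Fin.consEquiv (fun _ => I) (a, f)) ∧
            ∀ i, Fin.consEquiv (fun _ => I) (a, f) i ∈ S) ↔
            Function.Injective f ∧ ∀ i, f i ∈ S.erase a := by
          change (Function.Injective (Fin.cons a f : Fin (d + 1) → I) ∧
            ∀ i, (Fin.cons a f : Fin (d + 1) → I) i ∈ S) ↔ _
          rw [Fin.cons_injective_iff, Fin.forall_fin_succ]
          simp only [Fin.cons_zero, Fin.cons_succ, Set.mem_range, not_exists, mem_erase, ne_eq]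
          constructor
          · rintro ⟨⟨h1, h2⟩, -, h4⟩
            exact ⟨h2, fun i => ⟨h1 i, h4 i⟩⟩
          · rintro ⟨h1, h2⟩
            exact ⟨⟨fun i => (h2 i).1, h1⟩, ha, fun i => (h2 i).2⟩
        rw [show ind _ = ind _ from congrArg ind (propext this)]
        simp only [Fin.consEquiv_apply, Fin.prod_univ_succ, Fin.cons_zero, Fin.cons_succ]
        ring
      · refine sum_eq_zero fun f _ => ?_
        rw [ind_of_not, zero_mul]
        rintro ⟨-, h⟩
        exact ha (by simpa using h 0)
    simp_rw [h1]
    simp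

lemma sum_embedding_prod_le [Fintype I] [DecidableEq I] {w : I → ℝ} (hw : ∀ a, 0 ≤ w a) (d : ℕ)
    (hd : d ≤ Fintype.card I) :
    ∑ ω : Fin d ↪ I, ∏ i, w (ω i) ≤
      Fintype.card (Fin d ↪ I) * ((∑ a, w a) / Fintype.card I) ^ d := by
  have h := injSum_le hw d univ (by simpa using hd)
  rw [← sum_injective_eq_injSum] at h
  rw [Fintype.card_embedding_eq, Fintype.card_fin]
  refine le_trans (le_of_eq ?_) h
  simp only [mem_univ, implies_true, and_true]
  rw [← Equiv.sum_comp (Equiv.subtypeInjectiveEquivEmbedding (Fin d) I)]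
  have : ∀ f : Fin d → I, ind (Function.Injective f) * ∏ i, w (f i) =
      if Function.Injective f then ∏ i, w (f i) else 0 := by
    intro f
    by_cases hf : Function.Injective f
    · simp [hf, ind_of]
    · simp [hf, ind_of_not]
  simp_rw [this]
  rw [← sum_filter, sum_subtype (p := fun f => Function.Injective f)]
  · rfl
  · intro f; simp

end Maclaurin

lemma mul_log_lower {x : ℝ} (hx : 0 < x) :
    5 / 2 * (x - 1) ^ 2 / (x + 200) ≤ x * Real.log x - x + 1 := by
  obtain ⟨y, hy, rfl⟩ : ∃ y : ℝ, 0 < y ∧ x = y ^ 4 :=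
    ⟨x ^ ((4 : ℕ) : ℝ)⁻¹, by positivity, (Real.rpow_inv_natCast_pow hx.le (by norm_num)).symm⟩
  have h1 : 1 - y⁻¹ ≤ Real.log y := Real.one_sub_inv_le_log_of_pos hy
  have h2 : 4 * (y ^ 4 - y ^ 3) ≤ y ^ 4 * Real.log (y ^ 4) := by
    rw [Real.log_pow]
    push_cast
    have := mul_le_mul_of_nonneg_left h1 (show 0 ≤ 4 * y ^ 4 by positivity)
    have e : 4 * y ^ 4 * (1 - y⁻¹) = 4 * (y ^ 4 - y ^ 3) := by field_simp
    linarith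
  have h3 : 5 / 2 * (y ^ 4 - 1) ^ 2 ≤ (3 * y ^ 4 - 4 * y ^ 3 + 1) * (y ^ 4 + 200) := by
    have h4 : 0 ≤ 1 / 2 * y ^ 4 - 3 * y ^ 3 - 13 / 2 * y ^ 2 - 10 * y + 500 := by
      nlinarith [sq_nonneg (y ^ 2 - 3 * y - 16), sq_nonneg (y - 6)]
    have h5 : (3 * y ^ 4 - 4 * y ^ 3 + 1) * (y ^ 4 + 200) - 5 / 2 * (y ^ 4 - 1) ^ 2 =
        (y - 1) ^ 2 * (y ^ 2 * (1 / 2 * y ^ 4 - 3 * y ^ 3 - 13 / 2 * y ^ 2 - 10 * y + 500) +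
          (185 / 2 * y ^ 2 + 395 * y + 395 / 2)) := by ring
    have h6 : 0 ≤ (y - 1) ^ 2 * (y ^ 2 * (1 / 2 * y ^ 4 - 3 * y ^ 3 - 13 / 2 * y ^ 2 - 10 * y + 500)
          + (185 / 2 * y ^ 2 + 395 * y + 395 / 2)) := by positivity
    linarith
  rw [div_le_iff₀ (by positivity)]
  refine h3.trans (mul_le_mul_of_nonneg_right (by linarith) (by positivity))

lemma mul_log_div_le {p q : ℝ} (hp : 0 ≤ p) (hq : 0 < q) : p * Real.log (q / p) ≤ q - p := by
  rcases hp.eq_or_lt with rfl | hp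
  · simpa using hq.le
  have h := Real.log_le_sub_one_of_pos (div_pos hq hp)
  have := mul_le_mul_of_nonneg_left h hp.le
  have e : p * (q / p - 1) = q - p := by field_simp
  linarith

lemma entropy_vertex_le {m r a b : ℝ} (hm : 0 < m) (hm1 : m ≤ 1) (hr : 0 < r) (hr' : r ≤ 1 / 2000)
    (ha : 0 < a) (hb : 0 < b) :
    2 / 3 * (m * Real.log a + (1 - m) * Real.log b) - m * Real.log (m / r) ≤
      2 / 3 * Real.log (r * a + (1 - r) * b) + (r - m) := by
  have hr1 : 0 < 1 - r := by linarith
  set S := r * a + (1 - r) * b with hS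
  have hS0 : 0 < S := by positivity
  have k1 := mul_log_div_le hm.le (show 0 < r * a / S by positivity)
  have k2 := mul_log_div_le (sub_nonneg.2 hm1) (show 0 < (1 - r) * b / S by positivity)
  have hsum : r * a / S + (1 - r) * b / S = 1 := by rw [← add_div, ← hS, div_self hS0.ne']
  have e1 : Real.log (r * a / S / m) = Real.log a - Real.log (m / r) - Real.log S := by
    rw [Real.log_div (by positivity) hm.ne', Real.log_div (by positivity) hS0.ne',
      Real.log_mul hr.ne' ha.ne', Real.log_div hm.ne' hr.ne']
    ring
  have e2 : (1 - m) * Real.log ((1 - r) * b / S / (1 - m)) =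
      (1 - m) * (Real.log b - Real.log ((1 - m) / (1 - r)) - Real.log S) := by
    rcases hm1.eq_or_lt with rfl | hm1
    · simp
    have : 0 < 1 - m := by linarith
    rw [Real.log_div (by positivity) this.ne', Real.log_div (by positivity) hS0.ne',
      Real.log_mul hr1.ne' hb.ne', Real.log_div this.ne' hr1.ne']
    ring
  rw [e1] at k1
  rw [e2] at k2
  have k3 : (1 - m) * Real.log ((1 - m) / (1 - r)) ≤ (r - m) + (r - m) ^ 2 / (1 - r) := by
    rcases hm1.eq_or_lt with rfl | hm1
    · simp only [sub_self, zero_mul]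
      have : (r - 1) ^ 2 / (1 - r) = 1 - r := by field_simp; ring
      linarith
    have h1 : 0 < 1 - m := by linarith
    have h := Real.log_le_sub_one_of_pos (div_pos h1 hr1)
    have := mul_le_mul_of_nonneg_left h h1.le
    have e : (1 - m) * ((1 - m) / (1 - r) - 1) = (r - m) + (r - m) ^ 2 / (1 - r) := by
      field_simp; ring
    linarith
  have k4 : (r - m) ^ 2 / (1 - r) ≤ 1 / 2 * (m * Real.log (m / r) - m + r) := by
    have h := mul_log_lower (div_pos hm hr)
    have h' := mul_le_mul_of_nonneg_left h hr.le
    have e : r * (m / r * Real.log (m / r) - m / r + 1) = m * Real.log (m / r) - m + r := by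
      field_simp
    rw [e] at h'
    have e' : r * (5 / 2 * (m / r - 1) ^ 2 / (m / r + 200)) =
        5 / 2 * ((m - r) ^ 2 / (m + 200 * r)) := by field_simp
    rw [e'] at h'
    have h2 : (r - m) ^ 2 / (1 - r) ≤ 5 / 4 * ((m - r) ^ 2 / (m + 200 * r)) := by
      rw [← mul_div_assoc, div_le_div_iff₀ hr1 (by positivity)]
      have : m + 200 * r ≤ 5 / 4 * (1 - r) := by linarith
      have := mul_le_mul_of_nonneg_left this (sq_nonneg (m - r))
      nlinarith
    linarith
  nlinarith

section Vertex
variable {I : Type*}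

/-- Whether the colour `j` is used by the tuple `ω`. -/
noncomputable def cov {d : ℕ} (ω : Fin d ↪ I) (j : I) : Bool := decide (∃ i, ω i = j)

lemma cov_eq_true {d : ℕ} {ω : Fin d ↪ I} {j : I} : cov ω j = true ↔ ∃ i, ω i = j := by
  simp [cov]

lemma exists_embedding_cov [Fintype I] {d : ℕ} (hd : 1 ≤ d) (hL : d ≤ Fintype.card I) (j : I) :
    ∃ ω : Fin d ↪ I, cov ω j = true := by
  obtain ⟨ω⟩ := Function.Embedding.nonempty_of_card_le (α := Fin d) (β := I) (by simpa using hL)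
  refine ⟨ω.trans (Equiv.swap (ω ⟨0, hd⟩) j).toEmbedding, cov_eq_true.2 ⟨⟨0, hd⟩, ?_⟩⟩
  simp

lemma sum_cov [Fintype I] {d : ℕ} (ω : Fin d ↪ I) (f : I → ℝ) :
    ∑ j, ind (cov ω j = true) * f j = ∑ i, f (ω i) := by
  rw [← sum_map univ ω f]
  rw [← sum_filter_add_sum_filter_not univ (fun j => cov ω j = true)]
  rw [sum_eq_zero (s := univ.filter fun j => ¬ cov ω j = true), add_zero]
  · refine sum_congr ?_ ?_
    · ext j
      simp [cov_eq_true]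
    · intro j hj
      rw [Finset.mem_map] at hj
      obtain ⟨i, -, rfl⟩ := hj
      rw [ind_of (cov_eq_true.2 ⟨i, rfl⟩), one_mul]
  · intro j hj
    rw [mem_filter] at hj
    rw [ind_of_not hj.2, zero_mul]

lemma sum_embedding_prod_rpow_le [Fintype I] [DecidableEq I] {d : ℕ} (hd : 1 ≤ d)
    (hL : 2000 * d ≤ Fintype.card I) {g : I → Bool → ℝ} (hg : ∀ j b, 0 < g j b) {r : ℝ}
    (hr : r = d / Fintype.card I) :
    ∑ ω : Fin d ↪ I, ∏ j, g j (cov ω j) ^ (2 / 3 : ℝ) ≤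
      Fintype.card (Fin d ↪ I) * ∏ j, (r * g j true + (1 - r) * g j false) ^ (2 / 3 : ℝ) := by
  have hdr : (1 : ℝ) ≤ d := by exact_mod_cast hd
  have hLr : (2000 : ℝ) * d ≤ Fintype.card I := by exact_mod_cast hL
  set N : ℝ := (Fintype.card I : ℝ) with hN
  have hN0 : 0 < N := by linarith
  have hr0 : 0 < r := by rw [hr]; positivity
  have hr1 : r ≤ 1 / 2000 := by
    rw [hr, div_le_iff₀ hN0]; linarith
  have hdL : d ≤ Fintype.card I := by omega
  set u : (Fin d ↪ I) → ℝ := fun ω => ∏ j, g j (cov ω j) ^ (2 / 3 : ℝ) with hu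
  have hu0 : ∀ ω, 0 < u ω := fun ω => prod_pos fun j _ => Real.rpow_pos_of_pos (hg _ _) _
  have hne : Nonempty (Fin d ↪ I) :=
    Function.Embedding.nonempty_of_card_le (by simpa using hdL)
  set Z := ∑ ω, u ω with hZ
  have hZ0 : 0 < Z := sum_pos (fun ω _ => hu0 ω) univ_nonempty
  set P : (Fin d ↪ I) → ℝ := fun ω => u ω / Z with hP
  have hP0 : ∀ ω, 0 < P ω := fun ω => div_pos (hu0 ω) hZ0
  have hP1 : ∑ ω, P ω = 1 := by rw [← sum_div, ← hZ, div_self hZ0.ne']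
  set m : I → ℝ := fun j => ∑ ω, P ω * ind (cov ω j = true) with hm
  have hm0 : ∀ j, 0 < m j := by
    intro j
    obtain ⟨ω, hω⟩ := exists_embedding_cov hd hdL j
    refine sum_pos' (fun ω _ => mul_nonneg (hP0 ω).le (ind_nonneg _)) ⟨ω, mem_univ _, ?_⟩
    rw [ind_of hω, mul_one]; exact hP0 ω
  have hm1 : ∀ j, m j ≤ 1 := by
    intro j
    rw [← hP1]
    exact sum_le_sum fun ω _ => mul_le_of_le_one_right (hP0 ω).le (ind_le_one _)
  have hswap : ∀ f : I → ℝ, ∑ ω, P ω * ∑ i, f (ω i) = ∑ j, m j * f j := by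
    intro f
    simp_rw [← sum_cov, mul_sum, hm, sum_mul]
    rw [sum_comm]
    refine sum_congr rfl fun j _ => sum_congr rfl fun ω _ => by ring
  have hmsum : ∑ j, m j = d := by
    have := hswap fun _ => 1
    simp only [sum_const, card_univ, Fintype.card_fin, nsmul_eq_mul, mul_one] at this
    rw [← this, ← sum_mul, hP1, one_mul]
  set K : ℝ := (Fintype.card (Fin d ↪ I) : ℝ) with hK
  have hK0 : 0 < K := by rw [hK]; exact_mod_cast Fintype.card_pos
  -- lower bound on the entropy term
  have hmac : ∑ ω : Fin d ↪ I, (∏ i, m (ω i) / r) / K ≤ 1 := by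
    rw [← sum_div, div_le_one hK0]
    refine (sum_embedding_prod_le (fun a => (div_pos (hm0 a) hr0).le) d hdL).trans (le_of_eq ?_)
    rw [← sum_div, hmsum, hr, ← hN]
    have : (d : ℝ) / (d / N) / N = 1 := by
      have : (d : ℝ) ≠ 0 := by positivity
      field_simp
    rw [this, one_pow, mul_one]
  have hent : ∑ ω, P ω * (∑ i, Real.log (m (ω i) / r) - Real.log K - Real.log (P ω)) ≤ 0 := by
    have h : ∀ ω : Fin d ↪ I, P ω * (∑ i, Real.log (m (ω i) / r) - Real.log K - Real.log (P ω)) ≤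
        (∏ i, m (ω i) / r) / K - P ω := by
      intro ω
      have hw : 0 < ∏ i, m (ω i) / r := prod_pos fun i _ => div_pos (hm0 _) hr0
      have := mul_log_div_le (hP0 ω).le (div_pos hw hK0)
      rwa [Real.log_div (div_pos hw hK0).ne' (hP0 ω).ne', Real.log_div hw.ne' hK0.ne',
        Real.log_prod fun i _ => (div_pos (hm0 _) hr0).ne'] at this
    refine (sum_le_sum fun ω _ => h ω).trans ?_
    rw [sum_sub_distrib, hP1]
    linarith
  have hent' : ∑ j, m j * Real.log (m j / r) - Real.log K ≤ ∑ ω, P ω * Real.log (P ω) := by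
    have e : ∑ ω, P ω * (∑ i, Real.log (m (ω i) / r) - Real.log K - Real.log (P ω)) =
        ∑ j, m j * Real.log (m j / r) - Real.log K - ∑ ω, P ω * Real.log (P ω) := by
      rw [← hswap fun j => Real.log (m j / r)]
      simp only [mul_sub, sum_sub_distrib, ← sum_mul, hP1, one_mul]
    linarith
  have hlogP : ∀ ω, Real.log (P ω) =
      2 / 3 * ∑ j, Real.log (g j (cov ω j)) - Real.log Z := by
    intro ω
    rw [hP]
    dsimp only
    rw [Real.log_div (hu0 ω).ne' hZ0.ne', hu]
    dsimp only
    rw [Real.log_prod fun j _ => (Real.rpow_pos_of_pos (hg _ _) _).ne', mul_sum]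
    congr 1
    exact sum_congr rfl fun j _ => Real.log_rpow (hg _ _) _
  have hcovlog : ∑ ω, P ω * ∑ j, Real.log (g j (cov ω j)) =
      ∑ j, (m j * Real.log (g j true) + (1 - m j) * Real.log (g j false)) := by
    simp_rw [mul_sum]
    rw [sum_comm]
    refine sum_congr rfl fun j _ => ?_
    have : ∀ ω : Fin d ↪ I, P ω * Real.log (g j (cov ω j)) =
        P ω * ind (cov ω j = true) * Real.log (g j true) +
          (P ω - P ω * ind (cov ω j = true)) * Real.log (g j false) := by
      intro ω
      cases h : cov ω j
      · rw [ind_of_not (by simp)]; ring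
      · rw [ind_of rfl]; ring
    simp_rw [this]
    rw [sum_add_distrib, ← sum_mul, ← sum_mul, sum_sub_distrib, hP1]
  have hPlogP : ∑ ω, P ω * Real.log (P ω) =
      2 / 3 * ∑ j, (m j * Real.log (g j true) + (1 - m j) * Real.log (g j false)) -
        Real.log Z := by
    rw [← hcovlog]
    simp_rw [hlogP, mul_sub]
    rw [sum_sub_distrib, ← sum_mul, hP1, one_mul, mul_sum (s := univ) (a := (2 / 3 : ℝ))]
    congr 1
    exact sum_congr rfl fun ω _ => by ring
  have hfin : 2 / 3 * ∑ j, (m j * Real.log (g j true) + (1 - m j) * Real.log (g j false)) -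
      ∑ j, m j * Real.log (m j / r) ≤
        ∑ j, 2 / 3 * Real.log (r * g j true + (1 - r) * g j false) := by
    rw [mul_sum, ← sum_sub_distrib]
    refine (sum_le_sum fun j _ =>
      entropy_vertex_le (hm0 j) (hm1 j) hr0 hr1 (hg j true) (hg j false)).trans (le_of_eq ?_)
    rw [sum_add_distrib, sum_sub_distrib, hmsum, sum_const, card_univ, nsmul_eq_mul, ← hN, hr]
    have : N * (d / N) - d = 0 := by field_simp; ring
    rw [this, add_zero]
  have hpos : ∀ j, 0 < r * g j true + (1 - r) * g j false := fun j =>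
    add_pos (mul_pos hr0 (hg _ _)) (mul_pos (by linarith) (hg _ _))
  have hlogle : Real.log Z ≤ Real.log (K * ∏ j, (r * g j true + (1 - r) * g j false) ^ (2 / 3 : ℝ)) := by
    rw [Real.log_mul hK0.ne' (prod_pos fun j _ => Real.rpow_pos_of_pos (hpos j) _).ne',
      Real.log_prod fun j _ => (Real.rpow_pos_of_pos (hpos j) _).ne']
    have : ∑ j, Real.log ((r * g j true + (1 - r) * g j false) ^ (2 / 3 : ℝ)) =
        ∑ j, 2 / 3 * Real.log (r * g j true + (1 - r) * g j false) :=
      sum_congr rfl fun j _ => Real.log_rpow (hpos j) _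
    linarith
  exact (Real.log_le_log_iff hZ0
    (mul_pos hK0 (prod_pos fun j _ => Real.rpow_pos_of_pos (hpos j) _))).1 hlogle

end Vertex

/-- The product Bernoulli weight of a zero-one vector. -/
noncomputable def bernWeight {W : Type*} [Fintype W] (r : ℝ) (x : W → Bool) : ℝ :=
  ∏ v, if x v then r else 1 - r

lemma bernWeight_pos {W : Type*} [Fintype W] {r : ℝ} (hr : 0 < r) (hr1 : r < 1) (x : W → Bool) :
    0 < bernWeight r x :=
  prod_pos fun v _ => by split_ifs <;> linarith

lemma sum_bernWeight {W : Type*} [Fintype W] [DecidableEq W] (r : ℝ) :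
    ∑ x : W → Bool, bernWeight r x = 1 := by
  unfold bernWeight
  rw [← Fintype.prod_sum (fun (_ : W) (b : Bool) => if b then r else 1 - r)]
  simp

section
variable {I : Type*} [Fintype I] [DecidableEq I]

lemma sum_tuple_prod_rpow_le {d : ℕ} (hd : 1 ≤ d)
    (hL : 2000 * d ≤ Fintype.card I) {r : ℝ} (hr : r = d / Fintype.card I) (N : ℕ)
    {g : I → (Fin N → Bool) → ℝ} (hg : ∀ j x, 0 < g j x) :
    ∑ c : Fin N → Fin d ↪ I, ∏ j, g j (fun v => cov (c v) j) ^ (2 / 3 : ℝ) ≤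
      (Fintype.card (Fin d ↪ I) : ℝ) ^ N * ∏ j, (∑ x, bernWeight r x * g j x) ^ (2 / 3 : ℝ) := by
  have hdr : (1 : ℝ) ≤ d := by exact_mod_cast hd
  have hLr : (2000 : ℝ) * d ≤ Fintype.card I := by exact_mod_cast hL
  have hr0 : 0 < r := by rw [hr]; apply div_pos <;> linarith
  have hr1 : r < 1 := by rw [hr, div_lt_one] <;> linarith
  induction N with
  | zero =>
    rw [Fintype.sum_unique, pow_zero, one_mul]
    refine le_of_eq (prod_congr rfl fun j _ => ?_)
    rw [Fintype.sum_unique]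
    congr 1
    have : ∀ x : Fin 0 → Bool, bernWeight r x = 1 := fun x => by simp [bernWeight]
    rw [this, one_mul]
    congr 1
    exact Subsingleton.elim _ _
  | succ N ih =>
    rw [← Equiv.sum_comp (Fin.consEquiv fun _ => Fin d ↪ I), Fintype.sum_prod_type]
    have h1 : ∀ (ω : Fin d ↪ I) (c : Fin N → Fin d ↪ I) (j : I),
        (fun v => cov (Fin.consEquiv (fun _ => Fin d ↪ I) (ω, c) v) j) =
          (Fin.cons (cov ω j) (fun v => cov (c v) j) : Fin (N + 1) → Bool) := by
      intro ω c j
      ext v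
      refine Fin.cases ?_ (fun v => ?_) v <;> rfl
    simp_rw [h1]
    have h2 : ∀ ω : Fin d ↪ I, ∑ c : Fin N → Fin d ↪ I, ∏ j,
        g j (Fin.cons (cov ω j) fun v => cov (c v) j) ^ (2 / 3 : ℝ) ≤
        (Fintype.card (Fin d ↪ I) : ℝ) ^ N *
          ∏ j, (∑ x, bernWeight r x * g j (Fin.cons (cov ω j) x)) ^ (2 / 3 : ℝ) := fun ω =>
      ih (g := fun j x => g j (Fin.cons (cov ω j) x)) fun j x => hg _ _
    refine (sum_le_sum fun ω _ => h2 ω).trans ?_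
    rw [← mul_sum, pow_succ, mul_assoc]
    refine mul_le_mul_of_nonneg_left ?_ (by positivity)
    refine (sum_embedding_prod_rpow_le hd hL
      (g := fun j b => ∑ x, bernWeight r x * g j (Fin.cons b x)) ?_ hr).trans (le_of_eq ?_)
    · intro j b
      exact sum_pos (fun x _ => mul_pos (bernWeight_pos hr0 hr1 x) (hg _ _)) univ_nonempty
    congr 1
    refine prod_congr rfl fun j _ => ?_
    congr 1
    rw [← Equiv.sum_comp (Fin.consEquiv fun _ => Bool), Fintype.sum_prod_type, Fintype.sum_bool,
      mul_sum, mul_sum]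
    congr 1 <;>
    · refine sum_congr rfl fun x _ => ?_
      rw [← mul_assoc]
      congr 1
      simp only [bernWeight, Fin.prod_univ_succ]
      rfl

end

section Ratio

lemma centralBinom_sq_le (n : ℕ) : n.centralBinom ^ 2 * (2 * n + 1) ≤ 16 ^ n := by
  induction n with
  | zero => simp
  | succ n ih =>
    have h := Nat.succ_mul_centralBinom_succ n
    refine Nat.le_of_mul_le_mul_left ?_ (show 0 < (n + 1) ^ 2 by positivity)
    calc (n + 1) ^ 2 * ((n + 1).centralBinom ^ 2 * (2 * (n + 1) + 1))
        = ((n + 1) * (n + 1).centralBinom) ^ 2 * (2 * (n + 1) + 1) := by ring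
      _ = 4 * (2 * n + 1) * (2 * n + 3) * (n.centralBinom ^ 2 * (2 * n + 1)) := by rw [h]; ring
      _ ≤ 4 * (2 * n + 1) * (2 * n + 3) * 16 ^ n := Nat.mul_le_mul_left _ ih
      _ ≤ (16 * (n + 1) ^ 2) * 16 ^ n := Nat.mul_le_mul_right _ (by nlinarith)
      _ = _ := by ring

lemma pow_le_centralBinom_sq (n : ℕ) (hn : 1 ≤ n) : 16 ^ n ≤ 4 * n * n.centralBinom ^ 2 := by
  induction n, hn using Nat.le_induction with
  | base => norm_num [Nat.centralBinom]
  | succ n hn ih =>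
    have h := Nat.succ_mul_centralBinom_succ n
    refine Nat.le_of_mul_le_mul_left ?_ (show 0 < (n + 1) by positivity)
    calc (n + 1) * 16 ^ (n + 1) = 16 * (n + 1) * 16 ^ n := by ring
      _ ≤ 16 * (n + 1) * (4 * n * n.centralBinom ^ 2) := Nat.mul_le_mul_left _ ih
      _ = 16 * n.centralBinom ^ 2 * (4 * n * (n + 1)) := by ring
      _ ≤ 16 * n.centralBinom ^ 2 * (2 * n + 1) ^ 2 := Nat.mul_le_mul_left _ (by nlinarith)
      _ = 4 * (2 * (2 * n + 1) * n.centralBinom) ^ 2 := by ring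
      _ = 4 * ((n + 1) * (n + 1).centralBinom) ^ 2 := by rw [h]
      _ = _ := by ring

lemma choose_sq_mul_centralBinom (k l : ℕ) :
    (k + l).choose k ^ 2 * (k + l).centralBinom =
      (2 * (k + l)).choose (2 * k) * (k.centralBinom * l.centralBinom) := by
  have h1 := Nat.add_choose_mul_factorial_mul_factorial k l
  have h2 := Nat.add_choose_mul_factorial_mul_factorial (2 * k) (2 * l)
  have h3 := Nat.add_choose_mul_factorial_mul_factorial k k
  have h4 := Nat.add_choose_mul_factorial_mul_factorial l l
  have h5 := Nat.add_choose_mul_factorial_mul_factorial (k + l) (k + l)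
  rw [← Nat.choose_symm_add] at h1 h2
  simp only [← two_mul, ← mul_add, ← Nat.centralBinom_eq_two_mul_choose] at h2 h3 h4 h5
  refine Nat.eq_of_mul_eq_mul_right (show 0 < (k.factorial * l.factorial) ^ 2 by positivity) ?_
  calc (k + l).choose k ^ 2 * (k + l).centralBinom * (k.factorial * l.factorial) ^ 2
      = (k + l).centralBinom * ((k + l).choose k * k.factorial * l.factorial) ^ 2 := by ring
    _ = (2 * (k + l)).factorial := by rw [h1, ← h5]; ring
    _ = _ := by rw [← h2, ← h3, ← h4]; ring

/-- The ratio `C(m,k)² / C(2m,2k)`. -/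
noncomputable def chooseRatio (m k : ℕ) : ℝ := (m.choose k : ℝ) ^ 2 / (2 * m).choose (2 * k)

lemma chooseRatio_nonneg (m k : ℕ) : 0 ≤ chooseRatio m k := by unfold chooseRatio; positivity

lemma chooseRatio_le_one (m k : ℕ) : chooseRatio m k ≤ 1 := by
  unfold chooseRatio
  refine div_le_one_of_le₀ ?_ (by positivity)
  exact_mod_cast choose_sq_le m k

lemma chooseRatio_sq_le {k l : ℕ} (h : 1 ≤ k + l) :
    chooseRatio (k + l) k ^ 2 * ((2 * k + 1) * (2 * l + 1)) ≤ 4 * (k + l) := by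
  have hc : (0 : ℝ) < (2 * (k + l)).choose (2 * k) := by
    exact_mod_cast Nat.choose_pos (by omega)
  have hb : (0 : ℝ) < (k + l).centralBinom := by exact_mod_cast Nat.centralBinom_pos _
  have e : chooseRatio (k + l) k = k.centralBinom * l.centralBinom / (k + l).centralBinom := by
    unfold chooseRatio
    rw [div_eq_div_iff hc.ne' hb.ne']
    have := choose_sq_mul_centralBinom k l
    have h2 : ((k + l).choose k : ℝ) ^ 2 * (k + l).centralBinom =
      (2 * (k + l)).choose (2 * k) * (k.centralBinom * l.centralBinom) := by exact_mod_cast this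
    rw [h2]; ring
  rw [e, div_pow, div_mul_eq_mul_div, div_le_iff₀ (by positivity)]
  have h1 : (k.centralBinom : ℝ) ^ 2 * (2 * k + 1) ≤ 16 ^ k := by
    exact_mod_cast centralBinom_sq_le k
  have h2 : (l.centralBinom : ℝ) ^ 2 * (2 * l + 1) ≤ 16 ^ l := by
    exact_mod_cast centralBinom_sq_le l
  have h3 : (16 : ℝ) ^ (k + l) ≤ 4 * (k + l) * (k + l).centralBinom ^ 2 := by
    exact_mod_cast pow_le_centralBinom_sq (k + l) h
  calc ((k.centralBinom : ℝ) * l.centralBinom) ^ 2 * ((2 * k + 1) * (2 * l + 1))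
      = (k.centralBinom ^ 2 * (2 * k + 1)) * (l.centralBinom ^ 2 * (2 * l + 1)) := by ring
    _ ≤ 16 ^ k * 16 ^ l := mul_le_mul h1 h2 (by positivity) (by positivity)
    _ ≤ _ := by rw [← pow_add]; exact h3

end Ratio

section Lorentz

/-- A bounded increasing function whose increments dominate the Lorentzian kernel. -/
lemma inv_sq_le_increment {s t : ℝ} (hs : 1 ≤ s) :
    s / (s ^ 2 + t ^ 2) ≤ 4 * ((t + 1) / (s + |t + 1|) - t / (s + |t|)) := by
  have hs0 : 0 < s := by linarith
  have hq : 0 < s ^ 2 + t ^ 2 := by positivity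
  rcases le_or_gt 0 t with h | h
  · rw [abs_of_nonneg h, abs_of_nonneg (by linarith)]
    have e : (t + 1) / (s + (t + 1)) - t / (s + t) = s / ((s + (t + 1)) * (s + t)) := by
      field_simp; ring
    rw [e, ← mul_div_assoc, div_le_div_iff₀ hq (by positivity)]
    have : (s + (t + 1)) * (s + t) ≤ 4 * (s ^ 2 + t ^ 2) := by nlinarith [sq_nonneg (s - t)]
    nlinarith
  rcases le_or_gt (t + 1) 0 with h1 | h1
  · rw [abs_of_neg h, abs_of_nonpos h1]
    have p1 : 0 < s + -(t + 1) := by linarith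
    have p2 : 0 < s + -t := by linarith
    have e : (t + 1) / (s + -(t + 1)) - t / (s + -t) = s / ((s + -(t + 1)) * (s + -t)) := by
      field_simp; ring
    rw [e, ← mul_div_assoc, div_le_div_iff₀ hq (by positivity)]
    have : (s + -(t + 1)) * (s + -t) ≤ 4 * (s ^ 2 + t ^ 2) := by nlinarith [sq_nonneg (s + t)]
    nlinarith
  · rw [abs_of_neg h, abs_of_pos h1]
    have p2 : 0 < s + -t := by linarith
    have h2 : (t + 1) / (s + 1) ≤ (t + 1) / (s + (t + 1)) :=
      div_le_div_of_nonneg_left h1.le (by positivity) (by linarith)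
    have h3 : (-t) / (s + 1) ≤ (-t) / (s + -t) :=
      div_le_div_of_nonneg_left (by linarith) p2 (by linarith)
    have h4 : s / (s ^ 2 + t ^ 2) ≤ 1 / s := by
      rw [div_le_div_iff₀ hq hs0]; nlinarith [sq_nonneg t]
    have h5 : 1 / s ≤ 4 * (1 / (s + 1)) := by
      rw [← mul_div_assoc, div_le_div_iff₀ hs0 (by positivity)]; linarith
    have h6 : (t + 1) / (s + 1) + (-t) / (s + 1) = 1 / (s + 1) := by rw [← add_div]; congr 1; ring
    have h7 : (-t) / (s + -t) = - (t / (s + -t)) := neg_div _ _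
    linarith

lemma sum_lorentz_le {s : ℝ} (hs : 1 ≤ s) (x : ℝ) (M : ℕ) :
    ∑ k ∈ range M, s / (s ^ 2 + (k - x) ^ 2) ≤ 8 := by
  have hs0 : 0 < s := by linarith
  have hb : ∀ t : ℝ, |t / (s + |t|)| ≤ 1 := by
    intro t
    have := abs_nonneg t
    rw [abs_div, abs_of_pos (show 0 < s + |t| by linarith), div_le_one (by linarith)]
    linarith
  calc ∑ k ∈ range M, s / (s ^ 2 + (k - x) ^ 2)
      ≤ ∑ k ∈ range M, 4 * ((fun k : ℕ => ((k : ℝ) - x) / (s + |(k : ℝ) - x|)) (k + 1) -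
          (fun k : ℕ => ((k : ℝ) - x) / (s + |(k : ℝ) - x|)) k) := by
        refine sum_le_sum fun k _ => ?_
        have := inv_sq_le_increment (t := k - x) hs
        rw [show (k : ℝ) - x + 1 = ((k + 1 : ℕ) : ℝ) - x by push_cast; ring] at this
        exact this
    _ = 4 * (((M : ℕ) - x) / (s + |(M : ℝ) - x|) - (((0 : ℕ) : ℝ) - x) / (s + |((0 : ℕ) : ℝ) - x|)) := by
        rw [← mul_sum, sum_range_sub fun k : ℕ => ((k : ℝ) - x) / (s + |(k : ℝ) - x|)]
    _ ≤ 8 := by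
        have h1 := abs_le.1 (hb (M - x))
        have h2 := abs_le.1 (hb (((0 : ℕ) : ℝ) - x))
        linarith [h1.2, h2.1]

end Lorentz

/-- The probability that a binomial variable with parameters `m`, `r` equals `k`. -/
noncomputable def binomWeight (r : ℝ) (m k : ℕ) : ℝ := m.choose k * (r ^ k * (1 - r) ^ (m - k))

lemma binomWeight_nonneg {r : ℝ} (hr : 0 ≤ r) (hr1 : r ≤ 1) (m k : ℕ) : 0 ≤ binomWeight r m k := by
  have : 0 ≤ 1 - r := by linarith
  unfold binomWeight; positivity

lemma sum_binomWeight (r : ℝ) (m : ℕ) : ∑ k ∈ range (m + 1), binomWeight r m k = 1 := by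
  have := add_pow r (1 - r) m
  rw [add_sub_cancel, one_pow] at this
  rw [this]
  exact sum_congr rfl fun k _ => by unfold binomWeight; ring

lemma sum_binomWeight_mul_sq (r : ℝ) (m : ℕ) :
    ∑ k ∈ range (m + 1), binomWeight r m k * (k - r * m) ^ 2 = m * r * (1 - r) := by
  have h := congrArg (Polynomial.eval r) (bernsteinPolynomial.variance ℝ m)
  simp only [Polynomial.eval_finsetSum, bernsteinPolynomial, Polynomial.eval_mul,
    Polynomial.eval_pow, Polynomial.eval_sub, Polynomial.eval_X,
    Polynomial.eval_natCast, Polynomial.eval_one, nsmul_eq_mul] at h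
  rw [← h]
  refine sum_congr rfl fun k _ => ?_
  unfold binomWeight
  ring

lemma sum_sqrt_binomWeight_mul_chooseRatio_le {r : ℝ} (hr : 0 < r) (hr2 : r ≤ 1 / 2) (m : ℕ) :
    ∑ k ∈ range (m + 1), √(binomWeight r m k * chooseRatio m k) ≤ 2 + 16 / r + 8 / r ^ 2 := by
  have hr1 : r ≤ 1 := by linarith
  rcases Nat.eq_zero_or_pos m with rfl | hm
  · simp [binomWeight, chooseRatio]
    have : 0 ≤ 16 / r + 8 / r ^ 2 := by positivity
    linarith
  have hm0 : (0 : ℝ) < m := by exact_mod_cast hm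
  have hm1 : (1 : ℝ) ≤ m := by exact_mod_cast hm
  set g : ℕ → ℝ := fun k => 1 + (k - r * m) ^ 2 / m with hg
  have hg0 : ∀ k, 0 < g k := fun k => by simp only [hg]; positivity
  have h1 : ∀ k, √(binomWeight r m k * chooseRatio m k) ≤
      binomWeight r m k * g k + chooseRatio m k / g k := by
    intro k
    have p1 := mul_nonneg (binomWeight_nonneg hr.le hr1 m k) (hg0 k).le
    have p2 := div_nonneg (chooseRatio_nonneg m k) (hg0 k).le
    refine Real.sqrt_le_iff.2 ⟨add_nonneg p1 p2, ?_⟩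
    have e : binomWeight r m k * chooseRatio m k =
        (binomWeight r m k * g k) * (chooseRatio m k / g k) := by
      have := (hg0 k).ne'
      field_simp
    rw [e]
    nlinarith [mul_nonneg p1 p2, sq_nonneg (binomWeight r m k * g k), sq_nonneg (chooseRatio m k / g k)]
  have h2 : ∑ k ∈ range (m + 1), binomWeight r m k * g k ≤ 2 := by
    have : ∀ k, binomWeight r m k * g k =
        binomWeight r m k + binomWeight r m k * (k - r * m) ^ 2 / m := fun k => by
      simp only [hg]; ring
    simp_rw [this]
    rw [sum_add_distrib, sum_binomWeight, ← sum_div, sum_binomWeight_mul_sq]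
    have : m * r * (1 - r) / m = r * (1 - r) := by field_simp
    rw [this]
    nlinarith
  have hsq : √(m : ℝ) ^ 2 = m := Real.sq_sqrt hm0.le
  have hs1 : 1 ≤ √(m : ℝ) := Real.one_le_sqrt.2 hm1
  have h3 : ∀ k ∈ range (m + 1), chooseRatio m k / g k ≤
      2 / r * (√m / (√m ^ 2 + (k - r * m) ^ 2)) + 4 / (r ^ 2 * m) := by
    intro k hk
    have hk : k ≤ m := by simpa [Nat.lt_succ_iff] using hk
    have q1 : 0 ≤ 2 / r * (√m / (√m ^ 2 + (k - r * m) ^ 2)) := by positivity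
    have q2 : 0 ≤ 4 / (r ^ 2 * m) := by positivity
    rcases le_or_gt (|(k : ℝ) - r * m|) (r * m / 2) with hn | hf
    · obtain ⟨hn1, hn2⟩ := abs_le.1 hn
      obtain ⟨l, rfl⟩ := Nat.exists_eq_add_of_le hk
      have hA := chooseRatio_sq_le (k := k) (l := l) hm
      push_cast at *
      have hk1 : r * (k + l) ≤ 2 * k + 1 := by linarith
      have hl1 : r * (k + l) ≤ 2 * l + 1 := by nlinarith
      have hprod : (r * (k + l)) ^ 2 ≤ (2 * k + 1) * (2 * l + 1) := by
        rw [sq]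
        exact mul_le_mul hk1 hl1 (by positivity) (by positivity)
      have hA2 : (chooseRatio (k + l) k * (r * √((k : ℝ) + l))) ^ 2 ≤ 2 ^ 2 := by
        refine le_of_mul_le_mul_right ?_ hm0
        calc (chooseRatio (k + l) k * (r * √((k : ℝ) + l))) ^ 2 * (k + l)
            = chooseRatio (k + l) k ^ 2 * (r * (k + l)) ^ 2 := by
              rw [mul_pow, mul_pow, hsq]; ring
          _ ≤ chooseRatio (k + l) k ^ 2 * ((2 * k + 1) * (2 * l + 1)) :=
              mul_le_mul_of_nonneg_left hprod (sq_nonneg _)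
          _ ≤ 4 * (k + l) := hA
          _ = _ := by norm_num
      have hA3 := (le_abs_self _).trans (abs_le_of_sq_le_sq hA2 (by norm_num))
      have hsp : 0 < √((k : ℝ) + l) := by linarith
      have hge : g k = (√((k : ℝ) + l) ^ 2 + (k - r * (k + l)) ^ 2) / √((k : ℝ) + l) ^ 2 := by
        simp only [hg]
        rw [hsq]
        field_simp
      have hA4 : chooseRatio (k + l) k / g k ≤
          2 / r * (√((k : ℝ) + l) / (√((k : ℝ) + l) ^ 2 + (k - r * (k + l)) ^ 2)) := by
        have hgk := hg0 k
        rw [div_le_iff₀ hgk, hge]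
        have hden : 0 < √((k : ℝ) + l) ^ 2 + (k - r * (k + l)) ^ 2 := by positivity
        have e : 2 / r * (√((k : ℝ) + l) / (√((k : ℝ) + l) ^ 2 + (k - r * (k + l)) ^ 2)) *
            ((√((k : ℝ) + l) ^ 2 + (k - r * (k + l)) ^ 2) / √((k : ℝ) + l) ^ 2) =
            2 / (r * √((k : ℝ) + l)) := by
          field_simp
        rw [e, le_div_iff₀ (by positivity)]
        exact hA3
      linarith
    · have hg2 : r ^ 2 * m / 4 ≤ g k := by
        have : (r * m / 2) ^ 2 ≤ (k - r * m) ^ 2 := by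
          rw [← sq_abs ((k : ℝ) - r * m)]
          exact pow_le_pow_left₀ (by positivity) hf.le 2
        simp only [hg]
        have h := div_le_div_of_nonneg_right this hm0.le
        have e : (r * m / 2) ^ 2 / m = r ^ 2 * m / 4 := by field_simp; ring
        linarith
      have : chooseRatio m k / g k ≤ 4 / (r ^ 2 * m) := by
        calc chooseRatio m k / g k ≤ 1 / (r ^ 2 * m / 4) :=
              div_le_div₀ zero_le_one (chooseRatio_le_one m k) (by positivity) hg2
          _ = _ := by field_simp
      linarith
  have h4 := sum_lorentz_le hs1 (r * m) (m + 1)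
  calc ∑ k ∈ range (m + 1), √(binomWeight r m k * chooseRatio m k)
      ≤ ∑ k ∈ range (m + 1), (binomWeight r m k * g k + chooseRatio m k / g k) :=
        sum_le_sum fun k _ => h1 k
    _ ≤ 2 + ∑ k ∈ range (m + 1),
          (2 / r * (√m / (√m ^ 2 + (k - r * m) ^ 2)) + 4 / (r ^ 2 * m)) := by
        rw [sum_add_distrib]
        exact add_le_add h2 (sum_le_sum h3)
    _ ≤ 2 + (2 / r * 8 + 8 / r ^ 2) := by
        rw [sum_add_distrib, ← mul_sum, sum_const, card_range, nsmul_eq_mul]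
        have : ((m + 1 : ℕ) : ℝ) * (4 / (r ^ 2 * m)) ≤ 8 / r ^ 2 := by
          push_cast
          rw [mul_div_assoc', div_le_div_iff₀ (by positivity) (by positivity)]
          have : 0 < r ^ 2 := by positivity
          nlinarith
        have h5 := mul_le_mul_of_nonneg_left h4 (show 0 ≤ 2 / r by positivity)
        linarith
    _ = _ := by ring

lemma pm_eq_zero_iff {n : ℕ} : pm n = 0 ↔ ¬ Even n := by
  refine ⟨fun h he => ?_, pm_eq_zero⟩
  obtain ⟨m, rfl⟩ := he
  have := pm_pos m
  rw [two_mul] at this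
  omega

/-- Normalised number of perfect matchings preserving a set of size `a` with complement of size
`b`. -/
noncomputable def pmRatio (r : ℝ) (a b : ℕ) : ℝ :=
  (pm a * pm b : ℝ) / pm (a + b) / √(r ^ a * (1 - r) ^ b)

lemma pmRatio_nonneg (r : ℝ) (a b : ℕ) : 0 ≤ pmRatio r a b := by unfold pmRatio; positivity

lemma pm_mul_pm_eq {r : ℝ} (hr : 0 < r) (hr1 : r < 1) (a b : ℕ) :
    (pm a * pm b : ℝ) = pm (a + b) * √(r ^ a * (1 - r) ^ b) * pmRatio r a b := by
  have : 0 < 1 - r := by linarith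
  have hs : 0 < √(r ^ a * (1 - r) ^ b) := by positivity
  unfold pmRatio
  rcases eq_or_ne (pm (a + b)) 0 with h | h
  · have h' := pm_eq_zero_iff.1 h
    rw [h]
    have : pm a = 0 ∨ pm b = 0 := by
      rw [pm_eq_zero_iff, pm_eq_zero_iff]
      by_contra hc
      push Not at hc
      exact h' (hc.1.add hc.2)
    rcases this with h | h <;> simp [h]
  · have h0 : (pm (a + b) : ℝ) ≠ 0 := by exact_mod_cast h
    field_simp

lemma sum_range_even {f : ℕ → ℝ} (hf : ∀ a, ¬ Even a → f a = 0) (m : ℕ) :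
    ∑ a ∈ range (2 * m + 1), f a = ∑ k ∈ range (m + 1), f (2 * k) := by
  induction m with
  | zero => simp
  | succ m ih =>
    rw [show 2 * (m + 1) + 1 = 2 * m + 1 + 1 + 1 by ring, sum_range_succ, sum_range_succ, ih,
      sum_range_succ _ (m + 1), hf (2 * m + 1) (by simp [parity_simps]), add_zero]
    rfl

lemma choose_mul_pmRatio_rpow {r : ℝ} (hr : 0 < r) (hr1 : r < 1) {m k : ℕ} (hk : k ≤ m) :
    (2 * m).choose (2 * k) * (r ^ (2 * k) * (1 - r) ^ (2 * m - 2 * k) *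
      pmRatio r (2 * k) (2 * m - 2 * k) ^ (3 / 2 : ℝ)) =
        √(binomWeight r m k * chooseRatio m k) := by
  obtain ⟨l, rfl⟩ := Nat.exists_eq_add_of_le hk
  have hr2 : 0 < 1 - r := by linarith
  rw [show 2 * (k + l) - 2 * k = 2 * l by omega]
  have hc : (0 : ℝ) < (2 * (k + l)).choose (2 * k) := by
    exact_mod_cast Nat.choose_pos (by omega)
  have hd : (0 : ℝ) < (k + l).choose k := by exact_mod_cast Nat.choose_pos (by omega)
  have hp : (0 : ℝ) < pm (2 * (k + l)) := by exact_mod_cast pm_pos _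
  set w : ℝ := r ^ k * (1 - r) ^ l with hw
  have hw0 : 0 < w := by positivity
  have e1 : r ^ (2 * k) * (1 - r) ^ (2 * l) = w ^ 2 := by rw [hw]; ring
  have e2 : pmRatio r (2 * k) (2 * l) =
      (k + l).choose k / (2 * (k + l)).choose (2 * k) / w := by
    unfold pmRatio
    rw [e1, Real.sqrt_sq hw0.le, ← mul_add]
    congr 1
    rw [div_eq_div_iff hp.ne' hc.ne']
    exact_mod_cast pm_mul_pm k l
  have hb : binomWeight r (k + l) k = (k + l).choose k * w := by
    unfold binomWeight; rw [show k + l - k = l by omega]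
  have hx : ∀ x : ℝ, 0 ≤ x → x ^ (3 / 2 : ℝ) = √(x ^ 3) := by
    intro x hx
    rw [Real.sqrt_eq_rpow, ← Real.rpow_natCast, ← Real.rpow_mul hx]
    norm_num
  rw [e1, e2, hb, chooseRatio, hx _ (by positivity)]
  set C : ℝ := (((2 * (k + l)).choose (2 * k) : ℕ) : ℝ)
  set D : ℝ := (((k + l).choose k : ℕ) : ℝ)
  symm
  rw [Real.sqrt_eq_iff_mul_self_eq (by positivity) (by positivity)]
  have e3 : √((D / C / w) ^ 3) * √((D / C / w) ^ 3) = (D / C / w) ^ 3 :=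
    Real.mul_self_sqrt (by positivity)
  symm
  calc C * (w ^ 2 * √((D / C / w) ^ 3)) * (C * (w ^ 2 * √((D / C / w) ^ 3)))
      = C ^ 2 * w ^ 4 * (√((D / C / w) ^ 3) * √((D / C / w) ^ 3)) := by ring
    _ = _ := by rw [e3]; field_simp

/-- The bound for the `3/2`-moment of `pmRatio`. -/
noncomputable def momentBound (r : ℝ) : ℝ := 2 + 16 / r + 8 / r ^ 2

lemma sum_choose_mul_pmRatio_rpow_le {r : ℝ} (hr : 0 < r) (hr2 : r ≤ 1 / 2) (N : ℕ) :
    ∑ a ∈ range (N + 1), N.choose a * (r ^ a * (1 - r) ^ (N - a) *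
      pmRatio r a (N - a) ^ (3 / 2 : ℝ)) ≤ momentBound r := by
  have hr1 : r < 1 := by linarith
  have hzero : ∀ a b, pm a = 0 ∨ pm (a + b) = 0 → pmRatio r a b ^ (3 / 2 : ℝ) = 0 := by
    intro a b h
    have : pmRatio r a b = 0 := by
      unfold pmRatio; rcases h with h | h <;> simp [h]
    rw [this, Real.zero_rpow (by norm_num)]
  rcases Nat.even_or_odd' N with ⟨m, rfl | rfl⟩
  · refine le_trans (le_of_eq ?_) (sum_sqrt_binomWeight_mul_chooseRatio_le hr hr2 m)
    rw [sum_range_even]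
    · refine sum_congr rfl fun k hk => ?_
      exact choose_mul_pmRatio_rpow hr hr1 (by simpa [Nat.lt_succ_iff] using hk)
    · intro a ha
      rw [hzero _ _ (Or.inl (pm_eq_zero ha)), mul_zero, mul_zero]
  · rw [sum_eq_zero]
    · unfold momentBound; positivity
    · intro a ha
      have ha : a ≤ 2 * m + 1 := by simpa [Nat.lt_succ_iff] using ha
      rw [hzero, mul_zero, mul_zero]
      right
      rw [Nat.add_sub_cancel' ha]
      exact pm_eq_zero (by simp [parity_simps])

section Bool
variable {W : Type*} [Fintype W]

/-- The number of coordinates of `x` equal to `b`. -/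
noncomputable def boolCount (x : W → Bool) (b : Bool) : ℕ := Fintype.card {v // x v = b}

lemma boolCount_add (x : W → Bool) : boolCount x true + boolCount x false = Fintype.card W := by
  unfold boolCount
  have h := Fintype.card_subtype_compl (fun v => x v = true)
  have h2 : Fintype.card {v // x v = true} ≤ Fintype.card W := Fintype.card_subtype_le _
  simp only [Bool.not_eq_true] at h
  rw [h]; omega

lemma bernWeight_eq (r : ℝ) (x : W → Bool) :
    bernWeight r x = r ^ boolCount x true * (1 - r) ^ boolCount x false := by
  unfold bernWeight boolCount
  rw [prod_ite, prod_const, prod_const, Fintype.card_subtype, Fintype.card_subtype]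
  simp only [Bool.not_eq_true]

lemma sum_bool_eq [DecidableEq W] (f : ℕ → ℝ) :
    ∑ x : W → Bool, f (boolCount x true) =
      ∑ a ∈ range (Fintype.card W + 1), (Fintype.card W).choose a * f a := by
  have h := sum_powerset_apply_card f (x := (univ : Finset W))
  simp only [nsmul_eq_mul, card_univ] at h
  rw [← h]
  refine sum_nbij' (fun x => univ.filter fun v => x v = true) (fun s v => decide (v ∈ s))
    ?_ ?_ ?_ ?_ ?_
  · intro x _; simp
  · intro s _; simp
  · intro x _; ext v; simp
  · intro s _; ext v; simp
  · intro x _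
    unfold boolCount
    rw [Fintype.card_subtype]

lemma sum_bernWeight_mul_pmRatio_le [DecidableEq W] {r : ℝ} (hr : 0 < r) (hr2 : r ≤ 1 / 2) :
    ∑ x : W → Bool, bernWeight r x * pmRatio r (boolCount x true) (boolCount x false) ^ (3 / 2 : ℝ) ≤
      momentBound r := by
  refine le_trans (le_of_eq ?_) (sum_choose_mul_pmRatio_rpow_le hr hr2 (Fintype.card W))
  rw [← sum_bool_eq (W := W) fun a => r ^ a * (1 - r) ^ (Fintype.card W - a) *
      pmRatio r a (Fintype.card W - a) ^ (3 / 2 : ℝ)]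
  refine sum_congr rfl fun x _ => ?_
  have h := boolCount_add x
  have : Fintype.card W - boolCount x true = boolCount x false := by omega
  rw [this, bernWeight_eq]

/-- The restriction of `y` to the level set `x = b`. -/
def restr (x y : W → Bool) (b : Bool) : {v // x v = b} → Bool := fun v => y v

/-- Normalised number of perfect matchings preserving two sets. -/
noncomputable def pmRatio₂ (r : ℝ) (x y : W → Bool) : ℝ :=
  pmRatio r (boolCount x true) (boolCount x false) *
    ∏ b, pmRatio r (boolCount (restr x y b) true) (boolCount (restr x y b) false)

lemma pmRatio₂_nonneg (r : ℝ) (x y : W → Bool) : 0 ≤ pmRatio₂ r x y :=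
  mul_nonneg (pmRatio_nonneg _ _ _) (prod_nonneg fun _ _ => pmRatio_nonneg _ _ _)

lemma bernWeight_eq_prod_restr (r : ℝ) (x y : W → Bool) :
    bernWeight r y = ∏ b, bernWeight r (restr x y b) := by
  unfold bernWeight restr
  exact (Fintype.prod_fiberwise x fun v => if y v then r else 1 - r).symm

lemma card_preserving_two (x y : W → Bool) [DecidablePred fun M : PM W =>
      ∀ v, (x (M v), y (M v)) = (x v, y v)] :
    (univ.filter fun M : PM W => ∀ v, (x (M v), y (M v)) = (x v, y v)).card =
      ∏ b, pm (boolCount (restr x y b) true) * pm (boolCount (restr x y b) false) := by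
  rw [← Fintype.card_subtype, card_PM_preserving (fun v => (x v, y v)), Fintype.prod_prod_type]
  refine prod_congr rfl fun b _ => ?_
  rw [Fintype.prod_bool]
  have : ∀ s, Fintype.card (PM {v // (x v, y v) = (b, s)}) = pm (boolCount (restr x y b) s) := by
    intro s
    rw [card_PM]
    unfold boolCount restr
    congr 1
    refine Fintype.card_congr ?_
    refine (Equiv.subtypeEquivRight fun v => ?_).trans (Equiv.subtypeSubtypeEquivSubtypeInter
      (fun v => x v = b) (fun v => y v = s)).symm
    simp
  rw [this, this]

lemma card_preserving_two_eq {r : ℝ} (hr : 0 < r) (hr1 : r < 1) (x y : W → Bool)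
    [DecidablePred fun M : PM W => ∀ v, (x (M v), y (M v)) = (x v, y v)] :
    ((univ.filter fun M : PM W => ∀ v, (x (M v), y (M v)) = (x v, y v)).card : ℝ) =
      pm (Fintype.card W) * (√(bernWeight r x) * √(bernWeight r y)) * pmRatio₂ r x y := by
  rw [card_preserving_two]
  have h : ∀ b, boolCount (restr x y b) true + boolCount (restr x y b) false = boolCount x b :=
    fun b => boolCount_add _
  have h2 := boolCount_add x
  push_cast
  simp_rw [pm_mul_pm_eq hr hr1, prod_mul_distrib, h, ← bernWeight_eq]
  rw [Fintype.prod_bool (f := fun b => (pm (boolCount x b) : ℝ)), pm_mul_pm_eq hr hr1, h2,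
    ← bernWeight_eq, bernWeight_eq_prod_restr r x y, pmRatio₂,
    Fintype.prod_bool (f := fun b => √(bernWeight r (restr x y b))),
    Fintype.prod_bool (f := fun b => bernWeight r (restr x y b)),
    Real.sqrt_mul (bernWeight_pos hr hr1 _).le]
  ring

lemma sum_sum_bernWeight_mul_pmRatio₂_le [DecidableEq W] {r : ℝ} (hr : 0 < r) (hr2 : r ≤ 1 / 2) :
    ∑ y : W → Bool, bernWeight r y * ∑ x : W → Bool, bernWeight r x *
      pmRatio₂ r x y ^ (3 / 2 : ℝ) ≤ momentBound r ^ 3 := by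
  have hr1 : r < 1 := by linarith
  have hK : 0 ≤ momentBound r := by unfold momentBound; positivity
  simp_rw [mul_sum]
  rw [sum_comm]
  have key : ∀ x : W → Bool, ∑ y : W → Bool, bernWeight r y * (bernWeight r x *
      pmRatio₂ r x y ^ (3 / 2 : ℝ)) ≤ bernWeight r x *
        pmRatio r (boolCount x true) (boolCount x false) ^ (3 / 2 : ℝ) * momentBound r ^ 2 := by
    intro x
    set c := bernWeight r x * pmRatio r (boolCount x true) (boolCount x false) ^ (3 / 2 : ℝ) with hc
    have hc0 : 0 ≤ c := mul_nonneg (bernWeight_pos hr hr1 x).le (Real.rpow_nonneg (pmRatio_nonneg _ _ _) _)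
    let φ : ∀ b, ({v // x v = b} → Bool) → ℝ := fun b z =>
      bernWeight r z * pmRatio r (boolCount z true) (boolCount z false) ^ (3 / 2 : ℝ)
    have e : ∀ y : W → Bool, bernWeight r y * (bernWeight r x * pmRatio₂ r x y ^ (3 / 2 : ℝ)) =
        c * ∏ b, φ b (restr x y b) := by
      intro y
      rw [pmRatio₂, Real.mul_rpow (pmRatio_nonneg _ _ _) (prod_nonneg fun _ _ => pmRatio_nonneg _ _ _),
        ← Real.finsetProd_rpow _ _ fun _ _ => pmRatio_nonneg _ _ _, bernWeight_eq_prod_restr r x y,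
        prod_mul_distrib]
      ring
    simp_rw [e]
    rw [← mul_sum]
    refine mul_le_mul_of_nonneg_left ?_ hc0
    have e2 : ∑ y : W → Bool, ∏ b, φ b (restr x y b) = ∏ b, ∑ z, φ b z := by
      rw [Fintype.prod_sum]
      refine Fintype.sum_bijective (fun y b => restr x y b) ⟨?_, ?_⟩ _ _ fun y => rfl
      · intro y y' h
        ext v
        exact congrFun (congrFun h (x v)) ⟨v, rfl⟩
      · intro z
        refine ⟨fun v => z (x v) ⟨v, rfl⟩, ?_⟩
        funext b v
        obtain ⟨v, rfl⟩ := v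
        rfl
    rw [e2, Fintype.prod_bool, sq]
    refine mul_le_mul (sum_bernWeight_mul_pmRatio_le hr hr2) (sum_bernWeight_mul_pmRatio_le hr hr2)
      (sum_nonneg fun z _ => ?_) hK
    exact mul_nonneg (bernWeight_pos hr hr1 _).le (Real.rpow_nonneg (pmRatio_nonneg _ _ _) _)
  refine (sum_le_sum fun x _ => key x).trans ?_
  rw [← sum_mul, pow_succ' _ 2]
  exact mul_le_mul_of_nonneg_right (sum_bernWeight_mul_pmRatio_le hr hr2) (by positivity)

end Bool

lemma ind_forall {X : Type*} [Fintype X] (P : X → Prop) : ind (∀ x, P x) = ∏ x, ind (P x) := by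
  by_cases h : ∀ x, P x
  · rw [ind_of h, prod_eq_one fun x _ => ind_of (h x)]
  · push Not at h
    obtain ⟨x, hx⟩ := h
    rw [ind_of_not fun h => hx (h x), prod_eq_zero (mem_univ x) (ind_of_not hx)]

section
variable {I V : Type*} [Fintype I] [DecidableEq I] [Fintype V] {d : ℕ}

/-- Every vertex has the same status as its partner in each of the matchings. -/
def Compat (M : I → PM V) (c : V → Fin d ↪ I) : Prop :=
  ∀ i v, cov (c (M i v)) i = cov (c v) i

lemma prod_bernWeight_cov (r : ℝ) (c : V → Fin d ↪ I) :
    ∏ i, bernWeight r (fun v => cov (c v) i) =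
      (r ^ d * (1 - r) ^ (Fintype.card I - d)) ^ Fintype.card V := by
  unfold bernWeight
  rw [Finset.prod_comm]
  have : ∀ v, ∏ i, (if cov (c v) i then r else 1 - r) =
      r ^ d * (1 - r) ^ (Fintype.card I - d) := by
    intro v
    rw [prod_ite, prod_const, prod_const]
    have h : (univ.filter fun i => cov (c v) i = true) = univ.map (c v) := by
      ext i; simp [cov_eq_true]
    have h1 : (univ.filter fun i => cov (c v) i = true).card = d := by
      rw [h, card_map, card_univ, Fintype.card_fin]
    have h2 := card_filter_add_card_filter_not (s := (univ : Finset I)) fun i => cov (c v) i = true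
    rw [h1, card_univ] at h2
    rw [h1]
    congr 2
    omega
  simp_rw [this]
  rw [prod_const, card_univ]

/-- The number of tuples of colours that are compatible with `M`. -/
noncomputable def numCompat (d : ℕ) {N : ℕ} (M : I → PM (Fin N)) : ℝ :=
  ∑ c : Fin N → Fin d ↪ I, ind (Compat M c)

/-- The typical number of compatible tuples. -/
noncomputable def bethe (r : ℝ) (L d N : ℕ) (K : ℝ) : ℝ :=
  K ^ N * √((r ^ d * (1 - r) ^ (L - d)) ^ N)

lemma sum_numCompat_sq_le (hd : 1 ≤ d)
    (hL : 2000 * d ≤ Fintype.card I) {r : ℝ} (hr : r = d / Fintype.card I) (N : ℕ) :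
    ∑ M : I → PM (Fin N), numCompat d M ^ 2 ≤ (pm N : ℝ) ^ Fintype.card I *
      bethe r (Fintype.card I) d N (Fintype.card (Fin d ↪ I)) ^ 2 *
        ((momentBound r ^ 3 + 1) ^ (2 / 3 : ℝ)) ^ Fintype.card I := by
  have hdr : (1 : ℝ) ≤ d := by exact_mod_cast hd
  have hLr : (2000 : ℝ) * d ≤ Fintype.card I := by exact_mod_cast hL
  have hr0 : 0 < r := by rw [hr]; apply div_pos <;> linarith
  have hr2 : r ≤ 1 / 2 := by rw [hr, div_le_iff₀] <;> linarith
  have hr1 : r < 1 := by linarith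
  set K : ℝ := (Fintype.card (Fin d ↪ I) : ℝ) with hK
  set S : ℝ := √((r ^ d * (1 - r) ^ (Fintype.card I - d)) ^ N) with hS
  let x : (Fin N → Fin d ↪ I) → I → Fin N → Bool := fun c i v => cov (c v) i
  have hsqrt : ∀ c : Fin N → Fin d ↪ I, ∏ i, √(bernWeight r (x c i)) = S := by
    intro c
    rw [hS, ← Real.sqrt_prod _ fun i _ => (bernWeight_pos hr0 hr1 _).le, prod_bernWeight_cov,
      Fintype.card_fin]
  have h1 : ∑ M : I → PM (Fin N), numCompat d M ^ 2 =
      ∑ c' : Fin N → Fin d ↪ I, ∑ c : Fin N → Fin d ↪ I,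
        (pm N : ℝ) ^ Fintype.card I * S ^ 2 * ∏ i, pmRatio₂ r (x c i) (x c' i) := by
    unfold numCompat
    simp_rw [sq, sum_mul_sum, ← ind_and]
    rw [sum_comm, sum_congr rfl fun c _ => sum_comm, sum_comm]
    refine sum_congr rfl fun c' _ => sum_congr rfl fun c _ => ?_
    have e : ∀ M : I → PM (Fin N), ind (Compat M c ∧ Compat M c') =
        ∏ i, ind (∀ v, (x c i (M i v), x c' i (M i v)) = (x c i v, x c' i v)) := by
      intro M
      rw [← ind_forall]
      congr 1
      simp only [Compat, Prod.mk.injEq, x, eq_iff_iff]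
      exact ⟨fun h i v => ⟨h.1 i v, h.2 i v⟩, fun h => ⟨fun i v => (h i v).1, fun i v => (h i v).2⟩⟩
    simp_rw [e]
    rw [← Fintype.prod_sum fun i (M : PM (Fin N)) =>
      ind (∀ v, (x c i (M v), x c' i (M v)) = (x c i v, x c' i v))]
    simp_rw [sum_ind, card_preserving_two_eq hr0 hr1, prod_mul_distrib, hsqrt, prod_const,
      card_univ, Fintype.card_fin]
  have h2 : ∑ c' : Fin N → Fin d ↪ I, ∑ c : Fin N → Fin d ↪ I,
      ∏ i, pmRatio₂ r (x c i) (x c' i) ≤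
        K ^ N * (K ^ N * ((momentBound r ^ 3 + 1) ^ (2 / 3 : ℝ)) ^ Fintype.card I) := by
    let G : (Fin N → Bool) → (Fin N → Bool) → ℝ := fun z y => pmRatio₂ r z y ^ (3 / 2 : ℝ) + 1
    have hG : ∀ z y, 0 < G z y := fun z y =>
      add_pos_of_nonneg_of_pos (Real.rpow_nonneg (pmRatio₂_nonneg _ _ _) _) one_pos
    have hGle : ∀ z y, pmRatio₂ r z y ≤ G z y ^ (2 / 3 : ℝ) := by
      intro z y
      have h := pmRatio₂_nonneg r z y
      calc pmRatio₂ r z y = (pmRatio₂ r z y ^ (3 / 2 : ℝ)) ^ (2 / 3 : ℝ) := by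
            rw [← Real.rpow_mul h]; norm_num
        _ ≤ _ := Real.rpow_le_rpow (Real.rpow_nonneg h _) (by simp [G]) (by norm_num)
    have h3 : ∀ c' : Fin N → Fin d ↪ I, ∑ c : Fin N → Fin d ↪ I,
        ∏ i, pmRatio₂ r (x c i) (x c' i) ≤
          K ^ N * ∏ i, (∑ z, bernWeight r z * G z (x c' i)) ^ (2 / 3 : ℝ) := by
      intro c'
      refine le_trans (sum_le_sum fun c _ => prod_le_prod (fun i _ => pmRatio₂_nonneg _ _ _)
        fun i _ => hGle _ _) ?_
      exact sum_tuple_prod_rpow_le hd hL hr N (g := fun i z => G z (x c' i)) fun i z => hG _ _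
    refine (sum_le_sum fun c' _ => h3 c').trans ?_
    rw [← mul_sum]
    refine mul_le_mul_of_nonneg_left ?_ (by positivity)
    have hpos : ∀ y, 0 < ∑ z, bernWeight r z * G z y := fun y =>
      sum_pos (fun z _ => mul_pos (bernWeight_pos hr0 hr1 _) (hG _ _)) univ_nonempty
    refine (sum_tuple_prod_rpow_le hd hL hr N
      (g := fun _ y => ∑ z, bernWeight r z * G z y) fun i y => hpos y).trans ?_
    rw [prod_const, card_univ]
    refine mul_le_mul_of_nonneg_left ?_ (by positivity)
    have h4 : ∑ y, bernWeight r y * ∑ z, bernWeight r z * G z y ≤ momentBound r ^ 3 + 1 := by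
      have e : ∀ y : Fin N → Bool, bernWeight r y * ∑ z, bernWeight r z * G z y =
          bernWeight r y * ∑ z, bernWeight r z * pmRatio₂ r z y ^ (3 / 2 : ℝ) + bernWeight r y := by
        intro y
        simp only [G, mul_add, mul_one, sum_add_distrib, sum_bernWeight]
      simp_rw [e]
      rw [sum_add_distrib, sum_bernWeight]
      linarith [sum_sum_bernWeight_mul_pmRatio₂_le (W := Fin N) hr0 hr2]
    have h5 : 0 ≤ ∑ y, bernWeight r y * ∑ z, bernWeight r z * G z y :=
      sum_nonneg fun y _ => mul_nonneg (bernWeight_pos hr0 hr1 _).le (hpos y).le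
    exact pow_le_pow_left₀ (Real.rpow_nonneg h5 _) (Real.rpow_le_rpow h5 h4 (by norm_num)) _
  rw [h1]
  simp_rw [← mul_sum]
  refine (mul_le_mul_of_nonneg_left h2 (by positivity)).trans (le_of_eq ?_)
  unfold bethe
  ring

end

lemma exists_truncated_kernel {H Γ : Type*} [Fintype H] [Fintype Γ] (Dis : H → Prop)
    (X : H → Γ → ℝ) (hX : ∀ h G, 0 ≤ X h G) (μ : Γ → ℝ) (hμ0 : ∀ G, 0 ≤ μ G)
    (hμ1 : ∑ G, μ G = 1) {P B C c ε D : ℝ} (hB : 0 < B) (hC : 0 < C) (hc : 0 < c) (hε : 0 < ε)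
    (hD0 : 0 ≤ D) (hDP : D ≤ P) (h2 : ∑ h, (∑ G, X h G) ^ 2 ≤ P * B ^ 2 * C)
    (hlow : ∀ A : Finset Γ, ε ≤ ∑ G ∈ A, μ G → c * B * P ≤ ∑ h, ind (Dis h) * ∑ G ∈ A, X h G) :
    ∃ κ : H → Γ → ℝ, (∀ h G, 0 ≤ κ h G) ∧ (∀ h G, κ h G ≠ 0 → Dis h ∧ X h G ≠ 0) ∧
      (∀ h, ∑ G, κ h G ≤ 1) ∧
      (∀ (e : H ≃ H) (f : Γ ≃ Γ), (∀ h, Dis (e h) ↔ Dis h) → (∀ h G, X (e h) (f G) = X h G) →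
        (∀ G, μ (f G) = μ G) → ∀ h, ∑ G, κ (e h) G = ∑ G, κ h G) ∧
      (∀ G, ∑ h, κ h G ≤ c ^ 2 / (4 * C) * D * μ G) ∧
      (1 - ε) * (c ^ 2 / (4 * C) * D) ≤ ∑ h, ∑ G, κ h G := by
  set Λ : ℝ := 2 * C / c * B with hΛ
  have hΛ0 : 0 < Λ := by positivity
  set θ : ℝ := c ^ 2 / (4 * C) with hθ
  have hθ0 : 0 < θ := by positivity
  let Y : H → ℝ := fun h => ∑ G, X h G
  have hY : ∀ h, 0 ≤ Y h := fun h => sum_nonneg fun G _ => hX h G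
  let κ₀ : H → Γ → ℝ := fun h G => ind (Dis h) * ind (Y h ≤ Λ) * (X h G / Λ)
  have hκ₀ : ∀ h G, 0 ≤ κ₀ h G := fun h G =>
    mul_nonneg (mul_nonneg (ind_nonneg _) (ind_nonneg _)) (div_nonneg (hX h G) hΛ0.le)
  let ρ : Γ → ℝ := fun G => ∑ h, κ₀ h G
  have hρ : ∀ G, 0 ≤ ρ G := fun G => sum_nonneg fun h _ => hκ₀ h G
  have hq : ∀ G, 0 ≤ θ * D * μ G / ρ G := fun G =>
    div_nonneg (mul_nonneg (mul_nonneg hθ0.le hD0) (hμ0 G)) (hρ G)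
  have hκsum : ∀ G, ∑ h, κ₀ h G * min 1 (θ * D * μ G / ρ G) = min (ρ G) (θ * D * μ G) := by
    intro G
    rw [← sum_mul]
    change ρ G * _ = _
    rcases (hρ G).eq_or_lt with h | h
    · rw [← h, zero_mul, min_eq_left]
      exact mul_nonneg (mul_nonneg hθ0.le hD0) (hμ0 G)
    · rw [mul_min_of_nonneg _ _ h.le, mul_one, mul_div_cancel₀ _ h.ne']
  refine ⟨fun h G => κ₀ h G * min 1 (θ * D * μ G / ρ G), ?_, ?_, ?_, ?_, ?_, ?_⟩
  · exact fun h G => mul_nonneg (hκ₀ h G) (le_min zero_le_one (hq G))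
  · intro h G hne
    dsimp only at hne
    constructor
    · by_contra hd
      exact hne (by simp [κ₀, ind_of_not hd])
    · intro hx
      exact hne (by simp [κ₀, hx])
  · intro h
    calc ∑ G, κ₀ h G * min 1 (θ * D * μ G / ρ G) ≤ ∑ G, κ₀ h G :=
          sum_le_sum fun G _ => mul_le_of_le_one_right (hκ₀ h G) (min_le_left _ _)
      _ = ind (Dis h) * ind (Y h ≤ Λ) * (Y h / Λ) := by
          simp only [κ₀, Y]
          rw [← mul_sum, sum_div]
      _ ≤ 1 := by
          by_cases hy : Y h ≤ Λ
          · rw [ind_of hy, mul_one]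
            exact mul_le_one₀ (ind_le_one _) (div_nonneg (hY h) hΛ0.le)
              (div_le_one_of_le₀ hy hΛ0.le)
          · rw [ind_of_not hy]; simp
  · intro e f hDis hXe hμ h
    have hYe : ∀ h, Y (e h) = Y h := by
      intro h
      change ∑ G, X (e h) G = ∑ G, X h G
      rw [← Equiv.sum_comp f]
      exact sum_congr rfl fun G _ => hXe h G
    have hκe : ∀ h G, κ₀ (e h) (f G) = κ₀ h G := by
      intro h G
      simp only [κ₀, hYe, hXe, hDis]
    have hρe : ∀ G, ρ (f G) = ρ G := by
      intro G
      change ∑ h, κ₀ h (f G) = ∑ h, κ₀ h G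
      rw [← Equiv.sum_comp e]
      exact sum_congr rfl fun h _ => hκe h G
    rw [← Equiv.sum_comp f]
    refine sum_congr rfl fun G _ => ?_
    change κ₀ (e h) (f G) * min 1 (θ * D * μ (f G) / ρ (f G)) = _
    rw [hκe, hρe, hμ]
  · intro G
    rw [hκsum]
    exact min_le_right _ _
  · have hbig : ∀ A : Finset Γ, ε ≤ ∑ G ∈ A, μ G → θ * D ≤ ∑ G ∈ A, ρ G := by
      intro A hA
      have h3 := hlow A hA
      have h4 : ∀ h, ind (Dis h) * ∑ G ∈ A, X h G ≤ Λ * ∑ G ∈ A, κ₀ h G + Y h ^ 2 / Λ := by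
        intro h
        have hXA : ∑ G ∈ A, X h G ≤ Y h :=
          sum_le_sum_of_subset_of_nonneg (subset_univ _) fun G _ _ => hX h G
        have hXA0 : 0 ≤ ∑ G ∈ A, X h G := sum_nonneg fun G _ => hX h G
        have e : Λ * ∑ G ∈ A, κ₀ h G = ind (Dis h) * ind (Y h ≤ Λ) * ∑ G ∈ A, X h G := by
          simp only [κ₀]
          rw [← mul_sum, ← sum_div]
          field_simp
        rw [e]
        by_cases hy : Y h ≤ Λ
        · rw [ind_of hy, mul_one]
          have : 0 ≤ Y h ^ 2 / Λ := by positivity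
          linarith
        · rw [ind_of_not hy, mul_zero, zero_mul, zero_add, le_div_iff₀ hΛ0]
          push Not at hy
          have h5 : ind (Dis h) * ∑ G ∈ A, X h G ≤ Y h :=
            (mul_le_of_le_one_left hXA0 (ind_le_one _)).trans hXA
          rw [sq]
          exact mul_le_mul h5 hy.le hΛ0.le (hY h)
      have h5 := (h3.trans (sum_le_sum fun h _ => h4 h))
      rw [sum_add_distrib, ← mul_sum, sum_comm, ← sum_div] at h5
      have h6 : (∑ h, Y h ^ 2) / Λ ≤ c / 2 * B * P := by
        rw [div_le_iff₀ hΛ0]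
        refine h2.trans (le_of_eq ?_)
        rw [hΛ]
        field_simp
      have h7 : c / 2 * B * P ≤ Λ * ∑ G ∈ A, ρ G := by
        have : c / 2 * B * P + c / 2 * B * P = c * B * P := by ring
        change _ ≤ Λ * ∑ G ∈ A, ∑ h, κ₀ h G
        linarith
      have h8 : Λ * (θ * D) ≤ c / 2 * B * P := by
        have e : Λ * (θ * D) = c / 2 * B * D := by rw [hΛ, hθ]; field_simp; ring
        rw [e]
        exact mul_le_mul_of_nonneg_left hDP (by positivity)
      exact le_of_mul_le_mul_left (h8.trans h7) hΛ0
    rw [sum_comm]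
    simp_rw [hκsum]
    set A := univ.filter fun G => ρ G < θ * D * μ G with hA
    have hAε : ∑ G ∈ A, μ G ≤ ε := by
      by_contra! hlt
      have h3 := hbig A hlt.le
      have hne : A.Nonempty := by
        by_contra! hemp
        rw [hemp, sum_empty] at hlt
        linarith
      have h4 : ∑ G ∈ A, ρ G < ∑ G ∈ A, θ * D * μ G :=
        sum_lt_sum_of_nonempty hne fun G hG => by
          rw [hA, mem_filter] at hG
          exact hG.2
      rw [← mul_sum] at h4
      have h5 : ∑ G ∈ A, μ G ≤ 1 := by
        rw [← hμ1]
        exact sum_le_sum_of_subset_of_nonneg (subset_univ _) fun G _ _ => hμ0 G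
      have h6 : θ * D * ∑ G ∈ A, μ G ≤ θ * D :=
        mul_le_of_le_one_right (mul_nonneg hθ0.le hD0) h5
      linarith
    have h9 : ∑ G, θ * D * (μ G - if G ∈ A then μ G else 0) ≤ ∑ G, min (ρ G) (θ * D * μ G) := by
      refine sum_le_sum fun G _ => ?_
      have hn : 0 ≤ θ * D * μ G := mul_nonneg (mul_nonneg hθ0.le hD0) (hμ0 G)
      split_ifs with hG
      · rw [sub_self, mul_zero]
        exact le_min (hρ G) hn
      · rw [sub_zero]
        rw [hA, mem_filter] at hG
        push Not at hG
        exact le_min (hG (mem_univ _)) le_rfl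
    refine le_trans ?_ h9
    rw [← mul_sum, sum_sub_distrib, hμ1, sum_ite_mem, univ_inter, mul_comm]
    exact mul_le_mul_of_nonneg_left (by linarith) (mul_nonneg hθ0.le hD0)

section
variable {I : Type*} [Fintype I] [DecidableEq I] {n d : ℕ}

/-- The graph formed by the edges of the matchings selected by the colours at the vertices. -/
def colGraph (M : I → PM (Fin n)) (c : Fin n → Fin d ↪ I) : SimpleGraph (Fin n) :=
  SimpleGraph.fromRel fun u v => ∃ a, M (c u a) u = v

lemma colGraph_le (M : I → PM (Fin n)) (c : Fin n → Fin d ↪ I) : colGraph M c ≤ unionGraph M := by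
  intro u v h
  rw [colGraph, SimpleGraph.fromRel_adj] at h
  obtain ⟨-, ⟨a, ha⟩ | ⟨a, ha⟩⟩ := h
  · exact ⟨_, ha⟩
  · exact SimpleGraph.Adj.symm (G := unionGraph M) ⟨_, ha⟩

/-- The number of compatible tuples of colours that select the graph `G`. -/
noncomputable def numGraph (d : ℕ) (M : I → PM (Fin n)) (G : SimpleGraph (Fin n)) : ℝ :=
  ∑ c : Fin n → Fin d ↪ I, ind (Compat M c ∧ colGraph M c = G)

lemma sum_numGraph (M : I → PM (Fin n)) : ∑ G, numGraph d M G = numCompat d M := by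
  unfold numGraph numCompat
  rw [sum_comm]
  refine sum_congr rfl fun c _ => ?_
  simp_rw [ind_and]
  rw [← mul_sum, Fintype.sum_eq_single (colGraph M c) fun G hG => ind_of_not hG.symm, ind_of rfl,
    mul_one]

lemma compat_conjT (σ : Equiv.Perm (Fin n)) (M : I → PM (Fin n)) (c : Fin n → Fin d ↪ I) :
    Compat (conjT σ M) (c ∘ σ.symm) ↔ Compat M c := by
  constructor
  · intro h i v
    simpa [conjT_apply] using h i (σ v)
  · intro h i v
    simpa [conjT_apply] using h i (σ.symm v)

lemma colGraph_conjT (σ : Equiv.Perm (Fin n)) (M : I → PM (Fin n)) (c : Fin n → Fin d ↪ I) :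
    colGraph (conjT σ M) (c ∘ σ.symm) = Equiv.simpleGraph σ (colGraph M c) := by
  ext u v
  simp only [colGraph, SimpleGraph.fromRel_adj, Equiv.simpleGraph, Equiv.coe_fn_mk,
    SimpleGraph.comap_adj, conjT_apply, Function.comp_apply, Equiv.eq_symm_apply, ne_eq,
    Equiv.apply_symm_apply]

lemma numGraph_conjT (σ : Equiv.Perm (Fin n)) (M : I → PM (Fin n)) (G : SimpleGraph (Fin n)) :
    numGraph d (conjT σ M) (Equiv.simpleGraph σ G) = numGraph d M G := by
  unfold numGraph
  rw [← Equiv.sum_comp (Equiv.arrowCongr σ (Equiv.refl (Fin d ↪ I)))]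
  refine sum_congr rfl fun c _ => ?_
  change ind (Compat (conjT σ M) (c ∘ σ.symm) ∧ colGraph (conjT σ M) (c ∘ σ.symm) = _) = _
  rw [compat_conjT, colGraph_conjT, EmbeddingLike.apply_eq_iff_eq]

lemma mu_simpleGraph (σ : Equiv.Perm (Fin n)) (G : SimpleGraph (Fin n)) :
    mu n d (Equiv.simpleGraph σ G) = mu n d G := by
  have h : ∀ v, gDeg (Equiv.simpleGraph σ G) v = gDeg G (σ.symm v) := fun v =>
    Nat.card_congr (σ.symm.subtypeEquiv fun w => Iff.rfl)
  have h2 : IsRegularGraph (Equiv.simpleGraph σ G) d ↔ IsRegularGraph G d := by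
    constructor
    · intro hr v
      have := hr (σ v)
      rwa [h, Equiv.symm_apply_apply] at this
    · intro hr v
      rw [h]; exact hr _
  unfold mu
  simp only [h2]

end

lemma mu_nonneg (n d : ℕ) (G : SimpleGraph (Fin n)) : 0 ≤ mu n d G := by
  unfold mu; split_ifs <;> positivity

lemma exists_kernel_of_lower_bound (d : ℕ) (hd : 1 ≤ d)
    (hlow : ∀ ε : ℝ, 0 < ε → ∃ l : ℕ, 2000 ≤ l ∧ ∃ c : ℝ, 0 < c ∧ ∃ N₀ : ℕ, ∀ m, N₀ ≤ 2 * m →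
      ∑ G, mu (2 * m) d G = 1 ∧
      ∀ A : Finset (SimpleGraph (Fin (2 * m))), ε ≤ ∑ G ∈ A, mu (2 * m) d G →
        c * bethe (d / (l * d : ℕ)) (l * d) d (2 * m) (Fintype.card (Fin d ↪ Fin (l * d))) *
          (pm (2 * m) : ℝ) ^ (l * d) ≤
        ∑ h : Fin (l * d) → PM (Fin (2 * m)), ind (Disj h) * ∑ G ∈ A, numGraph d h G) (ε : ℝ)
    (hε : 0 < ε) : ∃ l : ℕ, 1 ≤ l ∧
      ∃ θ : ℝ, 0 < θ ∧ ∃ N₀ : ℕ, ∀ m, N₀ ≤ 2 * m →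
      ∃ (D : ℝ) (κ : (Fin (l * d) → PM (Fin (2 * m))) → SimpleGraph (Fin (2 * m)) → ℝ),
      D = ∑ h : Fin (l * d) → PM (Fin (2 * m)), ind (Disj h) ∧ 0 < D ∧
      ∑ G, mu (2 * m) d G = 1 ∧ (∀ h G, 0 ≤ κ h G) ∧
      (∀ h G, κ h G ≠ 0 → Disj h ∧ G ≤ unionGraph h) ∧ (∀ h, ∑ G, κ h G ≤ 1) ∧
      ConjInv (fun h => ∑ G, κ h G) ∧ (∀ G, ∑ h, κ h G ≤ θ * D * mu (2 * m) d G) ∧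
      (1 - ε) * (θ * D) ≤ ∑ h, ∑ G, κ h G := by
  set δ := min ε 1 with hδ
  have hδ0 : 0 < δ := lt_min hε one_pos
  obtain ⟨l, hl, c, hc, N₀, hN⟩ := hlow δ hδ0
  set r : ℝ := d / (l * d : ℕ) with hr
  have hL : 2000 * d ≤ l * d := Nat.mul_le_mul_right d hl
  have hLd : d < l * d := by nlinarith
  have hr0 : 0 < r := by
    rw [hr]
    have h1 : (0 : ℝ) < d := by exact_mod_cast hd
    have h2 : (0 : ℝ) < (l * d : ℕ) := by exact_mod_cast (by omega : 0 < l * d)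
    positivity
  have hr1 : r < 1 := by
    rw [hr, div_lt_one (by exact_mod_cast (by omega : 0 < l * d))]
    exact_mod_cast hLd
  set C : ℝ := ((momentBound r ^ 3 + 1) ^ (2 / 3 : ℝ)) ^ (l * d) with hC
  have hC0 : 0 < C := by
    have : 0 < momentBound r := by unfold momentBound; positivity
    positivity
  refine ⟨l, by omega, c ^ 2 / (4 * C), by positivity, N₀, fun m hm => ?_⟩
  obtain ⟨hμ1, hA⟩ := hN m hm
  set D := ∑ h : Fin (l * d) → PM (Fin (2 * m)), ind (Disj h) with hD
  set B := bethe r (l * d) d (2 * m) (Fintype.card (Fin d ↪ Fin (l * d))) with hB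
  have hB0 : 0 < B := by
    rw [hB, bethe]
    have h1 : 0 < Fintype.card (Fin d ↪ Fin (l * d)) :=
      Fintype.card_pos_iff.2 (Function.Embedding.nonempty_of_card_le (by simpa using hLd.le))
    have h2 : 0 < 1 - r := by linarith
    positivity
  have hP0 : (0 : ℝ) < (pm (2 * m) : ℝ) ^ (l * d) := by
    have := pm_pos m
    positivity
  have hD0 : 0 ≤ D := sum_nonneg fun h _ => ind_nonneg _
  have hDpos : 0 < D := by
    refine lt_of_le_of_ne hD0 fun h0 => ?_
    have h1 := hA univ (by rw [hμ1]; exact min_le_right _ _)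
    rw [sum_eq_zero] at h1
    · have : 0 < c * B * (pm (2 * m) : ℝ) ^ (l * d) := by positivity
      linarith
    · intro h hh
      rw [(sum_eq_zero_iff_of_nonneg fun h _ => ind_nonneg _).1 h0.symm h hh, zero_mul]
  have hDP : D ≤ (pm (2 * m) : ℝ) ^ (l * d) := by
    refine (sum_le_sum fun h _ => ind_le_one _).trans (le_of_eq ?_)
    rw [sum_const, card_univ, Fintype.card_pi, prod_const, card_PM, Fintype.card_fin, card_univ,
      Fintype.card_fin]
    simp
  have h2 := sum_numCompat_sq_le (I := Fin (l * d)) hd (by rwa [Fintype.card_fin])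
    (r := r) (by rw [Fintype.card_fin]) (2 * m)
  rw [Fintype.card_fin] at h2
  simp_rw [← sum_numGraph] at h2
  obtain ⟨κ, k0, ks, k1, ke, krow, ktot⟩ := exists_truncated_kernel
    (fun h : Fin (l * d) → PM (Fin (2 * m)) => Disj h) (fun h G => numGraph d h G)
    (fun h G => sum_nonneg fun c _ => ind_nonneg _) (mu (2 * m) d) (mu_nonneg _ _) hμ1
    hB0 hC0 hc hδ0 hD0 hDP h2 hA
  refine ⟨D, κ, rfl, hDpos, hμ1, k0, ?_, k1, ?_, krow, ?_⟩
  · intro h G hne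
    obtain ⟨h3, h4⟩ := ks h G hne
    refine ⟨h3, ?_⟩
    obtain ⟨c, -, hc⟩ := exists_ne_zero_of_sum_ne_zero h4
    have : Compat h c ∧ colGraph h c = G := by
      by_contra hn
      exact hc (ind_of_not hn)
    rw [← this.2]
    exact colGraph_le h c
  · intro σ h
    exact ke (conjT σ) (Equiv.simpleGraph σ) (fun h => disj_conjT σ h)
      (fun h G => numGraph_conjT σ h G) (fun G => mu_simpleGraph σ G) h
  · refine le_trans ?_ ktot
    exact mul_le_mul_of_nonneg_right (by linarith [min_le_left ε 1]) (by positivity)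

section
variable {V I : Type*} [Fintype V] [Fintype I] [Nonempty I]

lemma sum_prod_div_card_le_prod_sqrt {f : V → I → ℝ} (hf : ∀ v a, 0 ≤ f v a) {u w : V}
    (huw : u ≠ w) (hc : ∀ v, v ≠ u → v ≠ w → ∀ a b, f v a = f v b) :
    (∑ a, ∏ v, f v a) / Fintype.card I ≤ ∏ v, √((∑ a, f v a ^ 2) / Fintype.card I) := by
  have hL : (0 : ℝ) < Fintype.card I := by exact_mod_cast Fintype.card_pos
  obtain ⟨a₀⟩ := ‹Nonempty I›
  have hw : w ∈ univ.erase u := by simp [huw.symm]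
  have split : ∀ g : V → ℝ, ∏ v, g v = g u * (g w * ∏ v ∈ (univ.erase u).erase w, g v) := by
    intro g
    rw [mul_prod_erase _ _ hw, mul_prod_erase _ _ (mem_univ u)]
  have hrest : ∀ v ∈ (univ.erase u).erase w, ∀ a, f v a = f v a₀ := by
    intro v hv a
    simp only [mem_erase, mem_univ, and_true] at hv
    exact hc v hv.2 hv.1 a a₀
  have hP : ∏ v ∈ (univ.erase u).erase w, √((∑ a, f v a ^ 2) / Fintype.card I) =
      ∏ v ∈ (univ.erase u).erase w, f v a₀ := by
    refine prod_congr rfl fun v hv => ?_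
    rw [sum_congr rfl fun a _ => by rw [hrest v hv a], sum_const, nsmul_eq_mul, card_univ,
      mul_div_cancel_left₀ _ hL.ne', Real.sqrt_sq (hf _ _)]
  rw [split, hP]
  have h1 : ∑ a, ∏ v, f v a = (∑ a, f u a * f w a) * ∏ v ∈ (univ.erase u).erase w, f v a₀ := by
    rw [sum_mul]
    refine sum_congr rfl fun a _ => ?_
    rw [split, prod_congr rfl fun v hv => hrest v hv a, mul_assoc]
  rw [h1, ← mul_assoc, mul_div_right_comm]
  refine mul_le_mul_of_nonneg_right ?_ (prod_nonneg fun v _ => hf _ _)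
  rw [Real.sqrt_div' _ hL.le, Real.sqrt_div' _ hL.le, div_mul_div_comm, Real.mul_self_sqrt hL.le]
  exact div_le_div_of_nonneg_right (Real.sum_mul_le_sqrt_mul_sqrt _ _ _) hL.le

/-- A Finner-type inequality: every coordinate is used by at most two of the functions. -/
theorem sum_prod_div_pow_le_prod_sqrt (M : ℕ) (g : V → (Fin M → I) → ℝ) (hg : ∀ v x, 0 ≤ g v x)
    (p q : Fin M → V) (hpq : ∀ k, p k ≠ q k)
    (hdep : ∀ v x y, (∀ k, p k = v ∨ q k = v → x k = y k) → g v x = g v y) :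
    (∑ x, ∏ v, g v x) / (Fintype.card I : ℝ) ^ M ≤
      ∏ v, √((∑ x, g v x ^ 2) / (Fintype.card I : ℝ) ^ M) := by
  have hL : (0 : ℝ) < Fintype.card I := by exact_mod_cast Fintype.card_pos
  induction M with
  | zero =>
    simp only [univ_unique, sum_singleton, pow_zero, div_one]
    exact (prod_congr rfl fun v _ => (Real.sqrt_sq (hg _ _)).symm).le
  | succ M ih =>
    have hsum : ∀ F : (Fin (M + 1) → I) → ℝ, ∑ x, F x = ∑ x : Fin M → I, ∑ a, F (Fin.cons a x) := by
      intro F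
      rw [sum_comm, ← Fintype.sum_prod_type' (f := fun a x => F (Fin.cons a x))]
      exact (Fintype.sum_equiv (Fin.consEquiv fun _ => I) _ _ fun x => rfl).symm
    have key := ih (fun v x => √((∑ a, g v (Fin.cons a x) ^ 2) / Fintype.card I))
      (fun v x => Real.sqrt_nonneg _) (fun k => p k.succ) (fun k => q k.succ) (fun k => hpq _) (by
        intro v x y hxy
        congr 2
        refine sum_congr rfl fun a _ => ?_
        rw [hdep v (Fin.cons a x) (Fin.cons a y)]
        intro k hk
        refine Fin.cases (fun _ => rfl) (fun k hk => ?_) k hk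
        simpa using hxy k hk)
    have h2 : ∀ v, (∑ x : Fin M → I, √((∑ a, g v (Fin.cons a x) ^ 2) / Fintype.card I) ^ 2) /
        (Fintype.card I : ℝ) ^ M = (∑ x, g v x ^ 2) / (Fintype.card I : ℝ) ^ (M + 1) := by
      intro v
      rw [hsum, sum_congr rfl fun x _ => Real.sq_sqrt (by positivity), ← sum_div, div_div, pow_succ']
    simp only [h2] at key
    refine le_trans ?_ key
    rw [hsum, pow_succ', ← div_div, sum_div]
    refine div_le_div_of_nonneg_right (sum_le_sum fun x _ => ?_) (by positivity)
    refine sum_prod_div_card_le_prod_sqrt (f := fun v a => g v (Fin.cons a x))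
      (fun v a => hg _ _) (hpq 0) fun v h3 h4 a b => hdep _ _ _ fun k hk => ?_
    refine Fin.cases (fun hk => ?_) (fun k hk => rfl) k hk
    rcases hk with hk | hk
    · exact absurd hk.symm h3
    · exact absurd hk.symm h4

end

section
variable {I : Type*} [Fintype I] [DecidableEq I] {d : ℕ}

/-- The centred kernel detecting equality of two colours. -/
noncomputable def kap (a b : I) : ℝ := Fintype.card I * ind (a = b) - 1

lemma sum_ind_eq_right (a : I) : ∑ x, ind (a = x) = 1 := by
  rw [sum_eq_single a, ind_of rfl]
  · intro b _ hb
    exact ind_of_not (Ne.symm hb)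
  · simp

lemma sum_ind_eq_left (a : I) : ∑ x, ind (x = a) = 1 := by
  rw [sum_congr rfl fun x _ => by rw [show (x = a) = (a = x) from propext eq_comm]]
  exact sum_ind_eq_right a

lemma sum_kap (a : I) : ∑ b, kap a b = 0 := by
  unfold kap
  rw [sum_sub_distrib, ← mul_sum, sum_ind_eq_right]
  simp

lemma sum_kap_mul_kap (a b : I) : ∑ x, kap a x * kap b x = Fintype.card I * kap a b := by
  have h : ∀ x, kap a x * kap b x = Fintype.card I * (Fintype.card I * ind (a = x) * ind (b = x))
      - Fintype.card I * ind (a = x) - (kap b x) := by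
    intro x
    unfold kap
    ring
  have h2 : ∑ x, Fintype.card I * ind (a = x) * ind (b = x) = Fintype.card I * ind (a = b) := by
    rw [sum_eq_single a]
    · rw [ind_of rfl, mul_one, show (b = a) = (a = b) from propext eq_comm]
    · intro x _ hx
      rw [ind_of_not (Ne.symm hx)]
      ring
    · simp
  rw [sum_congr rfl fun x _ => h x, sum_sub_distrib, sum_sub_distrib, sum_kap, ← mul_sum, h2,
    ← mul_sum, sum_ind_eq_right]
  unfold kap
  ring

/-- The correlation of two independent colour tuples over a set of positions. -/
noncomputable def corr (I : Type*) [Fintype I] [DecidableEq I] {d : ℕ} (R : Finset (Fin d)) : ℝ :=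
  (∑ ω : Fin d ↪ I, ∑ ω' : Fin d ↪ I, ∏ i ∈ R, kap (ω i) (ω' i)) / (Fintype.card (Fin d ↪ I) : ℝ) ^ 2

lemma sum_prod_comp_div [Nonempty I] {M : ℕ} {ι : Type*} {R : Finset ι} {e : ι → Fin M}
    (he : Set.InjOn e R) (h : ι → I → ℝ) :
    (∑ x : Fin M → I, ∏ i ∈ R, h i (x (e i))) / (Fintype.card I : ℝ) ^ M =
      ∏ i ∈ R, (∑ a, h i a) / Fintype.card I := by
  have hL : (Fintype.card I : ℝ) ≠ 0 := by exact_mod_cast Fintype.card_ne_zero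
  have h1 : ∀ x : Fin M → I, ∏ i ∈ R, h i (x (e i)) =
      ∏ k, ∏ i ∈ R.filter (fun i => e i = k), h i (x k) := by
    intro x
    rw [← prod_fiberwise R e]
    refine prod_congr rfl fun k _ => prod_congr rfl fun i hi => ?_
    rw [(mem_filter.1 hi).2]
  rw [sum_congr rfl fun x _ => h1 x,
    ← Fintype.prod_sum (f := fun k a => ∏ i ∈ R.filter (fun i => e i = k), h i a)]
  rw [← prod_fiberwise R e (f := fun i => (∑ a, h i a) / Fintype.card I)]
  have : (Fintype.card I : ℝ) ^ M = ∏ k : Fin M, (Fintype.card I : ℝ) := by simp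
  rw [this, ← prod_div_distrib]
  refine prod_congr rfl fun k _ => ?_
  have hcard : (R.filter fun i => e i = k).card ≤ 1 := by
    refine card_le_one.2 fun i hi j hj => ?_
    simp only [mem_filter] at hi hj
    exact he hi.1 hj.1 (hi.2.trans hj.2.symm)
  rcases Nat.le_one_iff_eq_zero_or_eq_one.1 hcard with h0 | h0
  · rw [card_eq_zero.1 h0]
    simp [hL]
  · obtain ⟨i, hi⟩ := card_eq_one.1 h0
    rw [hi]
    simp

lemma sum_sq_div_eq_corr [Nonempty I] {M : ℕ} {R : Finset (Fin d)} {e : Fin d → Fin M}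
    (he : Set.InjOn e R) :
    (∑ x : Fin M → I, |(∑ ω : Fin d ↪ I, ∏ i ∈ R, kap (ω i) (x (e i))) /
      Fintype.card (Fin d ↪ I)| ^ 2) / (Fintype.card I : ℝ) ^ M = corr I R := by
  have hL : (Fintype.card I : ℝ) ≠ 0 := by exact_mod_cast Fintype.card_ne_zero
  have h1 : ∀ x : Fin M → I, |(∑ ω : Fin d ↪ I, ∏ i ∈ R, kap (ω i) (x (e i))) /
      Fintype.card (Fin d ↪ I)| ^ 2 = (∑ ω : Fin d ↪ I, ∑ ω' : Fin d ↪ I,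
        ∏ i ∈ R, (kap (ω i) (x (e i)) * kap (ω' i) (x (e i)))) /
          (Fintype.card (Fin d ↪ I) : ℝ) ^ 2 := by
    intro x
    rw [sq_abs, div_pow, sq (∑ ω : Fin d ↪ I, _), sum_mul_sum]
    simp only [prod_mul_distrib]
  rw [sum_congr rfl fun x _ => h1 x, ← sum_div, div_right_comm, corr]
  congr 1
  rw [sum_comm, sum_div]
  refine sum_congr rfl fun ω _ => ?_
  rw [sum_comm, sum_div]
  refine sum_congr rfl fun ω' _ => ?_
  rw [sum_prod_comp_div he (fun i a => kap (ω i) a * kap (ω' i) a)]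
  refine prod_congr rfl fun i _ => ?_
  rw [sum_kap_mul_kap, mul_div_cancel_left₀ _ hL]

lemma corr_nonneg [Nonempty I] (R : Finset (Fin d)) : 0 ≤ corr I R := by
  rw [← sum_sq_div_eq_corr (I := I) (R := R) (e := id) Function.injective_id.injOn]
  positivity

lemma sum_kap_apply (i : Fin d) (b : I) : ∑ ω : Fin d ↪ I, kap (ω i) b = 0 := by
  have hinv : ∀ b', ∑ ω : Fin d ↪ I, kap (ω i) b = ∑ ω : Fin d ↪ I, kap (ω i) b' := by
    intro b'
    refine Fintype.sum_equiv (Equiv.embeddingCongr (Equiv.refl _) (Equiv.swap b b')) _ _ fun ω => ?_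
    unfold kap
    have : (Equiv.embeddingCongr (Equiv.refl (Fin d)) (Equiv.swap b b') ω) i =
      Equiv.swap b b' (ω i) := by simp [Equiv.embeddingCongr]
    rw [this]
    have h2 : (Equiv.swap b b' (ω i) = b') = (ω i = b) := by
      refine propext ⟨fun h => ?_, fun h => by rw [h, Equiv.swap_apply_left]⟩
      rw [Equiv.swap_apply_eq_iff, Equiv.swap_apply_right] at h
      exact h
    rw [h2]
  have h0 : ∑ b', ∑ ω : Fin d ↪ I, kap (ω i) b' = 0 := by
    rw [sum_comm]
    exact sum_eq_zero fun ω _ => sum_kap _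
  rw [sum_congr rfl fun b' _ => (hinv b').symm, sum_const, card_univ, nsmul_eq_mul] at h0
  have : Nonempty I := ⟨b⟩
  exact (mul_eq_zero.1 h0).resolve_left (by exact_mod_cast Fintype.card_ne_zero)

lemma corr_singleton (i : Fin d) : corr I {i} = 0 := by
  unfold corr
  simp only [prod_singleton]
  rw [sum_comm, sum_eq_zero fun ω' _ => sum_kap_apply i (ω' i), zero_div]

lemma corr_empty (h : 0 < Fintype.card (Fin d ↪ I)) : corr I (∅ : Finset (Fin d)) = 1 := by
  have : (Fintype.card (Fin d ↪ I) : ℝ) ≠ 0 := by exact_mod_cast h.ne'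
  simp only [corr, prod_empty, sum_const, card_univ, nsmul_eq_mul, mul_one]
  field_simp

lemma sum_corr (h : 0 < Fintype.card (Fin d ↪ I)) :
    ∑ R : Finset (Fin d), corr I R =
      (Fintype.card I : ℝ) ^ d / Fintype.card (Fin d ↪ I) := by
  have hK : (Fintype.card (Fin d ↪ I) : ℝ) ≠ 0 := by exact_mod_cast h.ne'
  unfold corr
  rw [← sum_div, sum_comm]
  have h1 : ∀ ω : Fin d ↪ I, ∑ R : Finset (Fin d), ∑ ω' : Fin d ↪ I, ∏ i ∈ R, kap (ω i) (ω' i) =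
      (Fintype.card I : ℝ) ^ d := by
    intro ω
    rw [sum_comm]
    have h2 : ∀ ω' : Fin d ↪ I, ∑ R : Finset (Fin d), ∏ i ∈ R, kap (ω i) (ω' i) =
        (Fintype.card I : ℝ) ^ d * ind (ω' = ω) := by
      intro ω'
      rw [← powerset_univ, ← prod_one_add]
      have h3 : ∀ i, 1 + kap (ω i) (ω' i) = Fintype.card I * ind (ω i = ω' i) := by
        intro i
        unfold kap
        ring
      rw [prod_congr rfl fun i _ => h3 i, prod_mul_distrib]
      simp only [prod_const, card_univ, Fintype.card_fin]
      rw [← ind_forall]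
      congr 2
      refine propext ⟨fun h => (DFunLike.ext _ _ h).symm, fun h i => by rw [h]⟩
    rw [sum_congr rfl fun ω' _ => h2 ω', ← mul_sum, sum_ind_eq_left, mul_one]
  rw [sum_congr rfl fun ω _ => h1 ω, sum_const, card_univ, nsmul_eq_mul]
  field_simp

end

section
variable {V I : Type*} [Fintype V] [DecidableEq V] [Fintype I] [DecidableEq I] {d M : ℕ}

/-- A colouring of half-edges is compatible with a pairing when paired half-edges share their
colour. -/
def HalfCompat (π : PM (V × Fin d)) (c : V → Fin d ↪ I) : Prop :=
  ∀ x, c (π x).1 (π x).2 = c x.1 x.2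

lemma sum_prod_kap_eq [Nonempty I] (φ : Fin M × Bool ≃ V × Fin d) (F : Finset (Fin M)) :
    ∑ c : V → Fin d ↪ I, ∏ k ∈ F, kap (c (φ (k, false)).1 (φ (k, false)).2)
        (c (φ (k, true)).1 (φ (k, true)).2) =
      (∑ x : Fin M → I, ∏ v, ∑ ω : Fin d ↪ I,
        ∏ i ∈ univ.filter (fun i => (φ.symm (v, i)).1 ∈ F), kap (ω i) (x (φ.symm (v, i)).1)) /
        (Fintype.card I : ℝ) ^ M := by
  have hL : (Fintype.card I : ℝ) ≠ 0 := by exact_mod_cast Fintype.card_ne_zero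
  have h1 : ∀ c : V → Fin d ↪ I, ∏ k ∈ F, kap (c (φ (k, false)).1 (φ (k, false)).2)
        (c (φ (k, true)).1 (φ (k, true)).2) =
      (∑ x : Fin M → I, ∏ v, ∏ i ∈ univ.filter (fun i => (φ.symm (v, i)).1 ∈ F),
        kap (c v i) (x (φ.symm (v, i)).1)) / (Fintype.card I : ℝ) ^ M := by
    intro c
    have h2 : ∀ k, kap (c (φ (k, false)).1 (φ (k, false)).2) (c (φ (k, true)).1 (φ (k, true)).2) =
        (∑ a, kap (c (φ (k, false)).1 (φ (k, false)).2) a *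
          kap (c (φ (k, true)).1 (φ (k, true)).2) a) / Fintype.card I := by
      intro k
      rw [sum_kap_mul_kap, mul_div_cancel_left₀ _ hL]
    rw [prod_congr rfl fun k _ => h2 k, ← sum_prod_comp_div (e := id) Function.injective_id.injOn
      (fun k a => kap (c (φ (k, false)).1 (φ (k, false)).2) a *
          kap (c (φ (k, true)).1 (φ (k, true)).2) a)]
    congr 1
    refine sum_congr rfl fun x _ => ?_
    simp only [prod_filter, id]
    rw [← Fintype.prod_prod_type (f := fun y : V × Fin d => if (φ.symm (y.1, y.2)).1 ∈ F then
      kap (c y.1 y.2) (x (φ.symm (y.1, y.2)).1) else 1)]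
    rw [← Equiv.prod_comp φ, Fintype.prod_prod_type]
    simp only [Prod.mk.eta, Equiv.symm_apply_apply, Fintype.prod_bool]
    rw [← prod_filter_mul_prod_filter_not univ (fun k => k ∈ F)]
    rw [prod_eq_one (s := univ.filter fun k => ¬ k ∈ F), mul_one]
    · rw [filter_mem_eq_inter, univ_inter]
      exact prod_congr rfl fun k hk => by rw [if_pos hk, if_pos hk, mul_comm]
    · intro k hk
      rw [if_neg (mem_filter.1 hk).2, if_neg (mem_filter.1 hk).2, mul_one]
  rw [sum_congr rfl fun c _ => h1 c, ← sum_div, sum_comm]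
  congr 1
  refine sum_congr rfl fun x _ => ?_
  exact (Fintype.prod_sum (f := fun v (ω : Fin d ↪ I) =>
    ∏ i ∈ univ.filter (fun i => (φ.symm (v, i)).1 ∈ F), kap (ω i) (x (φ.symm (v, i)).1))).symm

lemma abs_sum_prod_kap_le [Nonempty I] (φ : Fin M × Bool ≃ V × Fin d)
    (hφ : ∀ k, (φ (k, false)).1 ≠ (φ (k, true)).1) (F : Finset (Fin M)) :
    |∑ c : V → Fin d ↪ I, ∏ k ∈ F, kap (c (φ (k, false)).1 (φ (k, false)).2)
        (c (φ (k, true)).1 (φ (k, true)).2)| / (Fintype.card (Fin d ↪ I) : ℝ) ^ Fintype.card V ≤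
      ∏ v, √(corr I (univ.filter fun i => (φ.symm (v, i)).1 ∈ F)) := by
  have hinj : ∀ v, Set.InjOn (fun i => (φ.symm (v, i)).1)
      (univ.filter fun i => (φ.symm (v, i)).1 ∈ F : Finset (Fin d)) := by
    intro v i _ j _ hij
    dsimp only at hij
    by_cases hb : (φ.symm (v, i)).2 = (φ.symm (v, j)).2
    · exact (Prod.ext_iff.1 (φ.symm.injective (Prod.ext hij hb))).2
    · exfalso
      have h1 : (φ ((φ.symm (v, i)).1, (φ.symm (v, i)).2)).1 = v := by simp
      have h2 : (φ ((φ.symm (v, i)).1, (φ.symm (v, j)).2)).1 = v := by rw [hij]; simp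
      cases hi : (φ.symm (v, i)).2 <;> cases hj : (φ.symm (v, j)).2 <;> rw [hi] at h1 hb <;>
        rw [hj] at h2 hb
      · exact hb rfl
      · exact hφ _ (h1.trans h2.symm)
      · exact hφ _ (h2.trans h1.symm)
      · exact hb rfl
  have key := sum_prod_div_pow_le_prod_sqrt M
    (fun v (x : Fin M → I) => |(∑ ω : Fin d ↪ I,
      ∏ i ∈ univ.filter (fun i => (φ.symm (v, i)).1 ∈ F), kap (ω i) (x (φ.symm (v, i)).1)) /
        Fintype.card (Fin d ↪ I)|) (fun v x => abs_nonneg _) (fun k => (φ (k, false)).1)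
    (fun k => (φ (k, true)).1) hφ (by
      intro v x y hxy
      congr 2
      refine sum_congr rfl fun ω _ => prod_congr rfl fun i _ => ?_
      rw [hxy]
      have h1 : (φ ((φ.symm (v, i)).1, (φ.symm (v, i)).2)).1 = v := by simp
      cases hi : (φ.symm (v, i)).2 <;> rw [hi] at h1
      · exact Or.inl h1
      · exact Or.inr h1)
  have h3 : ∀ v, (∑ x : Fin M → I, |(∑ ω : Fin d ↪ I,
      ∏ i ∈ univ.filter (fun i => (φ.symm (v, i)).1 ∈ F), kap (ω i) (x (φ.symm (v, i)).1)) /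
        Fintype.card (Fin d ↪ I)| ^ 2) / (Fintype.card I : ℝ) ^ M =
      corr I (univ.filter fun i => (φ.symm (v, i)).1 ∈ F) := fun v => sum_sq_div_eq_corr (hinj v)
  simp only [h3] at key
  refine le_trans ?_ key
  rw [sum_prod_kap_eq, abs_div, abs_of_nonneg (by positivity : (0 : ℝ) ≤ (Fintype.card I : ℝ) ^ M),
    div_right_comm]
  refine div_le_div_of_nonneg_right ?_ (by positivity)
  rw [div_eq_mul_inv]
  refine (mul_le_mul_of_nonneg_right (abs_sum_le_sum_abs _ _) (by positivity)).trans ?_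
  rw [sum_mul]
  refine (sum_congr rfl fun x _ => ?_).le
  rw [abs_prod, ← div_eq_mul_inv]
  have : (Fintype.card (Fin d ↪ I) : ℝ) ^ Fintype.card V =
    ∏ v : V, (Fintype.card (Fin d ↪ I) : ℝ) := by simp
  rw [this, ← prod_div_distrib]
  refine prod_congr rfl fun v _ => ?_
  rw [abs_div, abs_of_nonneg (by positivity : (0 : ℝ) ≤ (Fintype.card (Fin d ↪ I) : ℝ))]

/-- The positions at a vertex of a set of half-edges. -/
def posAt (T : Finset (V × Fin d)) (v : V) : Finset (Fin d) := univ.filter fun i => (v, i) ∈ T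

lemma abs_card_halfCompat_sub_one_le [Nonempty I] (hK : 0 < Fintype.card (Fin d ↪ I))
    (π : PM (V × Fin d)) (hπ : ∀ x, (π x).1 ≠ x.1) (hM : Fintype.card V * d = 2 * M) :
    |(∑ c : V → Fin d ↪ I, ind (HalfCompat π c)) * (Fintype.card I : ℝ) ^ M /
        (Fintype.card (Fin d ↪ I) : ℝ) ^ Fintype.card V - 1| ≤
      ∑ T ∈ univ.filter (fun T : Finset (V × Fin d) => T.Nonempty ∧ ∀ x ∈ T, π x ∈ T),
        ∏ v, √(corr I (posAt T v)) := by
  have hL : (Fintype.card I : ℝ) ≠ 0 := by exact_mod_cast Fintype.card_ne_zero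
  have hK' : (Fintype.card (Fin d ↪ I) : ℝ) ≠ 0 := by exact_mod_cast hK.ne'
  obtain ⟨m, φ, hm, hφ⟩ := π.exists_enum
  obtain rfl : m = M := by
    rw [Fintype.card_prod, Fintype.card_fin] at hm
    omega
  have hcomp : ∀ c : V → Fin d ↪ I, HalfCompat π c ↔
      ∀ k, c (φ (k, false)).1 (φ (k, false)).2 = c (φ (k, true)).1 (φ (k, true)).2 := by
    intro c
    constructor
    · intro h k
      have := h (φ (k, true))
      rwa [hφ] at this
    · intro h x
      obtain ⟨⟨k, b⟩, rfl⟩ := φ.surjective x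
      rw [hφ]
      cases b
      · exact (h k).symm
      · exact h k
  have hN : (∑ c : V → Fin d ↪ I, ind (HalfCompat π c)) * (Fintype.card I : ℝ) ^ m =
      ∑ F : Finset (Fin m), ∑ c : V → Fin d ↪ I, ∏ k ∈ F,
        kap (c (φ (k, false)).1 (φ (k, false)).2) (c (φ (k, true)).1 (φ (k, true)).2) := by
    rw [sum_comm, sum_mul]
    refine sum_congr rfl fun c _ => ?_
    rw [← powerset_univ, ← prod_one_add, show ind (HalfCompat π c) = ind (∀ k, _) from
      congrArg ind (propext (hcomp c)), ind_forall]
    have h3 : ∀ k, 1 + kap (c (φ (k, false)).1 (φ (k, false)).2)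
        (c (φ (k, true)).1 (φ (k, true)).2) = ind (c (φ (k, false)).1 (φ (k, false)).2 =
          c (φ (k, true)).1 (φ (k, true)).2) * Fintype.card I := by
      intro k
      unfold kap
      ring
    rw [prod_congr rfl fun k _ => h3 k, prod_mul_distrib]
    simp
  have hloop : ∀ k, (φ (k, false)).1 ≠ (φ (k, true)).1 := by
    intro k
    have := hπ (φ (k, true))
    rwa [hφ] at this
  rw [hN, ← sum_erase_add univ _ (mem_univ ∅), add_div]
  have h0 : (∑ c : V → Fin d ↪ I, ∏ k ∈ (∅ : Finset (Fin m)),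
      kap (c (φ (k, false)).1 (φ (k, false)).2) (c (φ (k, true)).1 (φ (k, true)).2)) /
        (Fintype.card (Fin d ↪ I) : ℝ) ^ Fintype.card V = 1 := by
    simp only [prod_empty, sum_const, card_univ, nsmul_eq_mul, mul_one, Fintype.card_pi,
      prod_const]
    push_cast
    exact div_self (pow_ne_zero _ hK')
  rw [h0, add_sub_cancel_right, sum_div]
  refine (abs_sum_le_sum_abs _ _).trans ?_
  have h4 : ∀ F ∈ univ.erase (∅ : Finset (Fin m)),
      |(∑ c : V → Fin d ↪ I, ∏ k ∈ F, kap (c (φ (k, false)).1 (φ (k, false)).2)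
        (c (φ (k, true)).1 (φ (k, true)).2)) / (Fintype.card (Fin d ↪ I) : ℝ) ^ Fintype.card V| ≤
      ∏ v, √(corr I (posAt (univ.filter fun x => (φ.symm x).1 ∈ F) v)) := by
    intro F _
    rw [abs_div, abs_of_nonneg (by positivity :
      (0 : ℝ) ≤ (Fintype.card (Fin d ↪ I) : ℝ) ^ Fintype.card V)]
    refine (abs_sum_prod_kap_le φ hloop F).trans_eq (prod_congr rfl fun v _ => ?_)
    congr 2
    ext i
    simp [posAt]
  refine (sum_le_sum h4).trans ?_
  have hinj : Function.Injective
      fun F : Finset (Fin m) => (univ.filter fun x : V × Fin d => (φ.symm x).1 ∈ F) := by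
    intro F F' h
    ext k
    have := Finset.ext_iff.1 h (φ (k, true))
    simpa using this
  rw [← sum_image (f := fun T => ∏ v, √(corr I (posAt T v))) (s := univ.erase ∅)
    (g := fun F : Finset (Fin m) => (univ.filter fun x : V × Fin d => (φ.symm x).1 ∈ F))
    hinj.injOn]
  refine sum_le_sum_of_subset_of_nonneg ?_ fun T _ _ => prod_nonneg fun v _ => Real.sqrt_nonneg _
  intro T hT
  obtain ⟨F, hF, rfl⟩ := mem_image.1 hT
  obtain ⟨k, hk⟩ := nonempty_iff_ne_empty.2 (mem_erase.1 hF).1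
  refine mem_filter.2 ⟨mem_univ _, ⟨φ (k, true), by simpa using hk⟩, fun x hx => ?_⟩
  obtain ⟨⟨k, b⟩, rfl⟩ := φ.surjective x
  simp only [mem_filter, mem_univ, true_and, Equiv.symm_apply_apply] at hx
  rw [hφ]
  simpa using hx

end

lemma choose_le_choose_of_le {n a M t : ℕ} (h1 : a ≤ t) (htM : t ≤ M) (h2 : n - a ≤ M - t) :
    n.choose a ≤ M.choose t := by
  calc n.choose a ≤ (a + (M - t)).choose a := Nat.choose_le_choose _ (by omega)
    _ = (a + (M - t)).choose (M - t) := Nat.choose_symm_add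
    _ ≤ M.choose (M - t) := Nat.choose_le_choose _ (by omega)
    _ = M.choose t := Nat.choose_symm htM

lemma pm_mul_pm_mul_choose_le {t M : ℕ} (h : t ≤ M) :
    pm (2 * t) * pm (2 * M - 2 * t) * M.choose t ≤ pm (2 * M) := by
  have h1 := pm_mul_pm t (M - t)
  rw [Nat.add_sub_cancel' h, Nat.mul_sub] at h1
  have h2 := choose_sq_le M t
  have h3 : 0 < M.choose t := Nat.choose_pos h
  have h4 : pm (2 * t) * pm (2 * M - 2 * t) * M.choose t * M.choose t ≤
      pm (2 * M) * M.choose t := by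
    calc _ = pm (2 * t) * pm (2 * M - 2 * t) * M.choose t ^ 2 := by ring
      _ ≤ pm (2 * t) * pm (2 * M - 2 * t) * (2 * M).choose (2 * t) := Nat.mul_le_mul_left _ h2
      _ = _ := by rw [h1, mul_comm]
  exact Nat.le_of_mul_le_mul_right h4 h3

lemma card_filter_forall_mem {Q : Type*} [Fintype Q] (T : Finset Q) :
    (univ.filter fun π : PM Q => ∀ x ∈ T, π x ∈ T).card =
      pm T.card * pm (Fintype.card Q - T.card) := by
  have h1 := card_PM_preserving (α := Q) (fun x => decide (x ∈ T))
  rw [Fintype.prod_bool, card_PM, card_PM] at h1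
  have h2 : Fintype.card {x // decide (x ∈ T) = true} = T.card := by
    rw [Fintype.card_subtype]
    congr 1
    ext x
    simp
  have h3 : Fintype.card {x // decide (x ∈ T) = false} = Fintype.card Q - T.card := by
    rw [Fintype.card_subtype, ← card_compl]
    congr 1
    ext x
    simp
  rw [h2, h3, Fintype.card_subtype] at h1
  rw [← h1]
  congr 1
  ext π
  rw [mem_filter, mem_filter]
  refine and_congr_right fun _ => ⟨fun h x => ?_, fun h x hx => ?_⟩
  · by_cases hx : x ∈ T
    · simp [hx, h x hx]
    · have : π x ∉ T := fun h' => hx (by simpa using h _ h')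
      simp [hx, this]
  · have := h x
    simpa [hx] using this

section
variable {V : Type*} [Fintype V] [DecidableEq V] {d M : ℕ}

lemma card_eq_sum_card_posAt (T : Finset (V × Fin d)) : T.card = ∑ v, (posAt T v).card := by
  rw [card_eq_sum_card_fiberwise (f := Prod.fst) (t := univ) (fun _ _ => mem_coe.2 (mem_univ _))]
  refine sum_congr rfl fun v _ => ?_
  refine (card_bij (fun i _ => (v, i)) ?_ ?_ ?_).symm
  · intro i hi
    simpa [posAt] using hi
  · intro i _ j _ h
    exact (Prod.ext_iff.1 h).2
  · rintro ⟨w, i⟩ h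
    obtain ⟨h1, rfl⟩ := mem_filter.1 h
    exact ⟨i, by simpa [posAt] using h1, rfl⟩

/-- The vertices carrying a half-edge of the set. -/
def actSet (T : Finset (V × Fin d)) : Finset V := univ.filter fun v => (posAt T v).Nonempty

lemma prod_mul_pm_mul_pm_le {f : Finset (Fin d) → ℝ} {θ : ℝ} (hf0 : f ∅ = 1) (hf1 : ∀ i, f {i} = 0)
    (hfn : ∀ R, 0 ≤ f R) (hfθ : ∀ R, R.Nonempty → f R ≤ θ) (hM : Fintype.card V * d = 2 * M)
    {T : Finset (V × Fin d)} (hT : T.Nonempty) :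
    (∏ v, f (posAt T v)) * ((pm T.card * pm (2 * M - T.card) : ℕ) : ℝ) ≤
      pm (2 * M) * (θ ^ (actSet T).card / (Fintype.card V).choose (actSet T).card) := by
  have hch : (0 : ℝ) < (Fintype.card V).choose (actSet T).card := by
    exact_mod_cast Nat.choose_pos (card_le_univ _)
  have hprod : ∏ v, f (posAt T v) = ∏ v ∈ actSet T, f (posAt T v) := by
    refine (prod_subset (subset_univ _) fun v _ hv => ?_).symm
    have : posAt T v = ∅ := by
      rw [← not_nonempty_iff_eq_empty]
      simpa [actSet] using hv
    rw [this, hf0]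
  have hle : ∏ v, f (posAt T v) ≤ θ ^ (actSet T).card := by
    rw [hprod]
    refine (prod_le_prod (fun v _ => hfn _) fun v hv => hfθ _ (mem_filter.1 hv).2).trans_eq ?_
    rw [prod_const]
    rfl
  have hθ : 0 ≤ θ ^ (actSet T).card := (prod_nonneg fun v _ => hfn _).trans hle
  by_cases h0 : ∏ v, f (posAt T v) = 0
  · rw [h0, zero_mul]
    positivity
  have hne1 : ∀ v, (posAt T v).card ≠ 1 := by
    intro v hv
    obtain ⟨i, hi⟩ := card_eq_one.1 hv
    exact h0 (prod_eq_zero (mem_univ v) (by rw [hi, hf1]))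
  have hcard : T.card = ∑ v ∈ actSet T, (posAt T v).card := by
    rw [card_eq_sum_card_posAt]
    refine (sum_subset (subset_univ _) fun v _ hv => ?_).symm
    rw [card_eq_zero, ← not_nonempty_iff_eq_empty]
    simpa [actSet] using hv
  have hlow : (actSet T).card * 2 ≤ T.card := by
    rw [hcard, ← smul_eq_mul]
    refine card_nsmul_le_sum _ _ _ fun v hv => ?_
    have h1 := card_pos.2 (mem_filter.1 hv).2
    have h2 := hne1 v
    omega
  have hup : T.card ≤ (actSet T).card * d := by
    rw [hcard, ← smul_eq_mul]
    exact sum_le_card_nsmul _ _ _ fun v _ => (card_le_univ _).trans (by simp)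
  have hT0 := card_pos.2 hT
  have hle2 : T.card ≤ 2 * M := by
    refine (card_le_univ T).trans ?_
    simp [hM]
  by_cases hodd : Even T.card
  swap
  · rw [pm_eq_zero hodd, zero_mul, Nat.cast_zero, mul_zero]
    positivity
  obtain ⟨t, ht⟩ := hodd
  rw [← two_mul] at ht
  rw [ht] at hlow hup hle2 hT0 ⊢
  set a := (actSet T).card
  have hd : 2 ≤ d := by
    by_contra hd
    have : a * d ≤ a * 1 := Nat.mul_le_mul_left _ (by omega)
    omega
  have haV : a ≤ Fintype.card V := card_le_univ _
  obtain ⟨b, hb⟩ := Nat.exists_eq_add_of_le haV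
  have h3 : Fintype.card V - a ≤ M - t := by
    have : b * 2 ≤ b * d := Nat.mul_le_mul_left _ hd
    rw [hb, add_mul] at hM
    omega
  have h4 := choose_le_choose_of_le (by omega : a ≤ t) (by omega) h3
  have h5 : pm (2 * t) * pm (2 * M - 2 * t) * (Fintype.card V).choose a ≤ pm (2 * M) :=
    (Nat.mul_le_mul_left _ h4).trans (pm_mul_pm_mul_choose_le (by omega))
  have h6 : ((pm (2 * t) * pm (2 * M - 2 * t) : ℕ) : ℝ) ≤ pm (2 * M) / (Fintype.card V).choose a := by
    rw [le_div_iff₀ hch]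
    exact_mod_cast h5
  calc _ ≤ θ ^ a * (pm (2 * M) / (Fintype.card V).choose a) :=
        mul_le_mul hle h6 (by positivity) hθ
    _ = _ := by ring

lemma sum_pow_card_actSet_le {θ : ℝ} (hθ : 0 ≤ θ) (hx : 2 ^ d * θ ≤ 1 / 2) :
    ∑ T ∈ univ.filter (fun T : Finset (V × Fin d) => T.Nonempty),
      θ ^ (actSet T).card / (Fintype.card V).choose (actSet T).card ≤ 2 * (2 ^ d * θ) := by
  set x := 2 ^ d * θ with hxd
  have hx0 : 0 ≤ x := by positivity
  rw [← sum_fiberwise_of_maps_to (g := actSet) (t := univ.erase ∅)]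
  swap
  · intro T hT
    obtain ⟨⟨v, i⟩, hvi⟩ := (mem_filter.1 hT).2
    refine mem_erase.2 ⟨?_, mem_univ _⟩
    exact nonempty_iff_ne_empty.1 ⟨v, mem_filter.2 ⟨mem_univ _, ⟨i, by simpa [posAt] using hvi⟩⟩⟩
  have h1 : ∀ U ∈ univ.erase (∅ : Finset V),
      ∑ T ∈ (univ.filter fun T : Finset (V × Fin d) => T.Nonempty).filter (fun T => actSet T = U),
        θ ^ (actSet T).card / ((Fintype.card V).choose (actSet T).card : ℝ) ≤
      x ^ U.card / (Fintype.card V).choose U.card := by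
    intro U _
    rw [sum_congr rfl fun T hT => by rw [(mem_filter.1 hT).2], sum_const, nsmul_eq_mul, hxd, mul_pow,
      mul_div_assoc]
    refine mul_le_mul_of_nonneg_right ?_ (by positivity)
    have h2 : ((univ.filter fun T : Finset (V × Fin d) => T.Nonempty).filter
        (fun T => actSet T = U)).card ≤ (U ×ˢ (univ : Finset (Fin d))).powerset.card := by
      refine card_le_card fun T hT => ?_
      obtain ⟨-, rfl⟩ := mem_filter.1 hT
      refine mem_powerset.2 fun ⟨v, i⟩ hvi => ?_
      refine mem_product.2 ⟨mem_filter.2 ⟨mem_univ _, ⟨i, by simpa [posAt] using hvi⟩⟩, mem_univ _⟩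
    rw [card_powerset, card_product, card_univ, Fintype.card_fin, mul_comm, pow_mul] at h2
    exact_mod_cast h2
  refine (sum_le_sum h1).trans ?_
  have h2 := sum_erase_add (univ : Finset (Finset V))
    (fun U => x ^ U.card / ((Fintype.card V).choose U.card : ℝ)) (mem_univ ∅)
  have h3 := sum_powerset_apply_card
    (fun k => x ^ k / ((Fintype.card V).choose k : ℝ)) (x := (univ : Finset V))
  rw [powerset_univ, card_univ] at h3
  rw [h3, sum_range_succ'] at h2
  simp only [card_empty, Nat.choose_zero_right, pow_zero, Nat.cast_one, nsmul_eq_mul, div_one,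
    one_mul] at h2
  rw [add_right_cancel h2]
  have h4 : ∀ k ∈ range (Fintype.card V), ((Fintype.card V).choose (k + 1) : ℝ) *
      (x ^ (k + 1) / ((Fintype.card V).choose (k + 1) : ℝ)) = x * x ^ k := by
    intro k hk
    have : ((Fintype.card V).choose (k + 1) : ℝ) ≠ 0 := by
      exact_mod_cast (Nat.choose_pos (Nat.succ_le_of_lt (mem_range.1 hk))).ne'
    rw [mul_div_cancel₀ _ this, pow_succ']
  rw [sum_congr rfl h4, ← mul_sum, mul_comm]
  refine mul_le_mul_of_nonneg_right ?_ hx0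
  have h5 := mul_neg_geom_sum x (Fintype.card V)
  have h6 : 0 ≤ x ^ Fintype.card V := by positivity
  have h7 : 0 ≤ ∑ k ∈ range (Fintype.card V), x ^ k := sum_nonneg fun k _ => by positivity
  nlinarith

theorem sum_sum_prod_le {f : Finset (Fin d) → ℝ} {θ : ℝ} (hf0 : f ∅ = 1) (hf1 : ∀ i, f {i} = 0)
    (hfn : ∀ R, 0 ≤ f R) (hfθ : ∀ R, R.Nonempty → f R ≤ θ) (hM : Fintype.card V * d = 2 * M)
    (hθ : 0 ≤ θ) (hx : 2 ^ d * θ ≤ 1 / 2) :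
    ∑ π : PM (V × Fin d),
      ∑ T ∈ univ.filter (fun T : Finset (V × Fin d) => T.Nonempty ∧ ∀ x ∈ T, π x ∈ T),
        ∏ v, f (posAt T v) ≤ pm (2 * M) * (2 * (2 ^ d * θ)) := by
  have h1 : ∑ π : PM (V × Fin d),
      ∑ T ∈ univ.filter (fun T : Finset (V × Fin d) => T.Nonempty ∧ ∀ x ∈ T, π x ∈ T),
        ∏ v, f (posAt T v) = ∑ T ∈ univ.filter (fun T : Finset (V × Fin d) => T.Nonempty),
          (∏ v, f (posAt T v)) * ((pm T.card * pm (2 * M - T.card) : ℕ) : ℝ) := by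
    simp only [← filter_filter, sum_filter (p := fun T : Finset (V × Fin d) => ∀ x ∈ T, _)]
    rw [sum_comm]
    refine sum_congr rfl fun T _ => ?_
    have h2 := card_filter_forall_mem T
    rw [Fintype.card_prod, Fintype.card_fin, hM] at h2
    rw [← h2, ← sum_filter, sum_const, nsmul_eq_mul, mul_comm]
    congr!
  rw [h1]
  refine (sum_le_sum fun T hT =>
    prod_mul_pm_mul_pm_le hf0 hf1 hfn hfθ hM (mem_filter.1 hT).2).trans ?_
  rw [← mul_sum]
  exact mul_le_mul_of_nonneg_left (sum_pow_card_actSet_le hθ hx) (Nat.cast_nonneg _)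

end

section
variable {V I : Type*} [Fintype V] [DecidableEq V] [Fintype I] [DecidableEq I] {d M : ℕ}

theorem sum_abs_card_halfCompat_sub_one_le [Nonempty I] (hK : 0 < Fintype.card (Fin d ↪ I)) {θ : ℝ}
    (hθ : 0 ≤ θ) (hIθ : (Fintype.card I : ℝ) ^ d / Fintype.card (Fin d ↪ I) - 1 ≤ θ ^ 2)
    (hx : 2 ^ d * θ ≤ 1 / 2) (hM : Fintype.card V * d = 2 * M) (S : Finset (PM (V × Fin d)))
    (hS : ∀ π ∈ S, ∀ x, (π x).1 ≠ x.1) :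
    ∑ π ∈ S, |(∑ c : V → Fin d ↪ I, ind (HalfCompat π c)) * (Fintype.card I : ℝ) ^ M /
        (Fintype.card (Fin d ↪ I) : ℝ) ^ Fintype.card V - 1| ≤ pm (2 * M) * (2 * (2 ^ d * θ)) := by
  have hsum := sum_corr (I := I) (d := d) hK
  rw [← sum_erase_add univ _ (mem_univ ∅), corr_empty hK] at hsum
  refine (sum_le_sum fun π hπ => abs_card_halfCompat_sub_one_le hK π (hS π hπ) hM).trans ?_
  refine (sum_le_sum_of_subset_of_nonneg (subset_univ S) fun π _ _ => sum_nonneg fun T _ =>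
    prod_nonneg fun v _ => Real.sqrt_nonneg _).trans ?_
  refine sum_sum_prod_le (f := fun R => √(corr I R)) (by rw [corr_empty hK, Real.sqrt_one])
    (fun i => by rw [corr_singleton, Real.sqrt_zero]) (fun R => Real.sqrt_nonneg _) ?_ hM hθ hx
  intro R hR
  rw [Real.sqrt_le_left hθ]
  have h1 : corr I R ≤ ∑ R ∈ univ.erase ∅, corr I R :=
    single_le_sum (f := fun R : Finset (Fin d) => corr I R) (fun R _ => corr_nonneg R)
      (mem_erase.2 ⟨hR.ne_empty, mem_univ _⟩)
  linarith

/-- No colour is used on more than `m` half-edges. -/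
def Balanced (m : ℕ) (c : V → Fin d ↪ I) : Prop :=
  ∀ j, (univ.filter fun x : V × Fin d => c x.1 x.2 = j).card ≤ m

lemma sum_pow_card_filter (M : ℕ) (j : I) (y : ℝ) :
    ∑ F : Fin M → I, y ^ (univ.filter fun k => F k = j).card =
      (Fintype.card I - 1 + y) ^ M := by
  have h1 : ∀ F : Fin M → I, y ^ (univ.filter fun k => F k = j).card =
      ∏ k, (if F k = j then y else 1) := by
    intro F
    rw [prod_ite, prod_const, prod_const_one, mul_one]
  rw [sum_congr rfl fun F _ => h1 F,
    ← Fintype.prod_sum (f := fun (_ : Fin M) (a : I) => if a = j then y else 1), prod_const,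
    card_univ, Fintype.card_fin]
  congr 1
  have h2 : ∀ a, (if a = j then y else 1) = 1 + (y - 1) * ind (a = j) := by
    intro a
    unfold ind
    split_ifs <;> ring
  rw [sum_congr rfl fun a _ => h2 a, sum_add_distrib, ← mul_sum, sum_ind_eq_left]
  simp
  ring

lemma card_unbalanced_mul_pow_le {m B : ℕ} (hB : B ^ 2 ≤ Fintype.card I) (hB1 : 1 ≤ B)
    (π : PM (V × Fin d)) (hM : Fintype.card V * d = 2 * M) :
    (∑ c : V → Fin d ↪ I, ind (HalfCompat π c ∧ ¬ Balanced m c)) * (B : ℝ) ^ m ≤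
      Fintype.card I * (2 * Fintype.card I) ^ M := by
  obtain ⟨M', φ, hm, hφ⟩ := π.exists_enum
  obtain rfl : M' = M := by
    rw [Fintype.card_prod, Fintype.card_fin] at hm
    omega
  have hB1' : (1 : ℝ) ≤ B := by exact_mod_cast hB1
  have hB' : (B : ℝ) ^ 2 ≤ Fintype.card I := by exact_mod_cast hB
  let res : (V → Fin d ↪ I) → Fin M' → I := fun c k => c (φ (k, true)).1 (φ (k, true)).2
  have hcol : ∀ c : V → Fin d ↪ I, HalfCompat π c → ∀ k b,
      c (φ (k, b)).1 (φ (k, b)).2 = res c k := by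
    intro c hc k b
    cases b
    · have := hc (φ (k, true))
      rwa [hφ] at this
    · rfl
  have hinj : Set.InjOn res (univ.filter fun c : V → Fin d ↪ I => HalfCompat π c) := by
    intro c hc c' hc' h
    simp only [coe_filter, mem_univ, true_and, Set.mem_ofPred_eq] at hc hc'
    funext v
    ext i
    obtain ⟨⟨k, b⟩, hk⟩ := φ.surjective (v, i)
    have h1 := hcol c hc k b
    have h2 := hcol c' hc' k b
    rw [hk] at h1 h2
    rw [h1, h2, h]
  have hcnt : ∀ c : V → Fin d ↪ I, HalfCompat π c → ∀ j,
      (univ.filter fun x : V × Fin d => c x.1 x.2 = j).card =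
        2 * (univ.filter fun k => res c k = j).card := by
    intro c hc j
    have h1 : (univ.filter fun x : V × Fin d => c x.1 x.2 = j).card =
        ((univ.filter fun k => res c k = j) ×ˢ (univ : Finset Bool)).card := by
      refine (card_bij (fun p _ => φ p) ?_ (fun _ _ _ _ h => φ.injective h) ?_).symm
      · rintro ⟨k, b⟩ hp
        rw [mem_product, mem_filter] at hp
        rw [mem_filter, hcol c hc]
        exact ⟨mem_univ _, hp.1.2⟩
      · intro x hx
        obtain ⟨⟨k, b⟩, rfl⟩ := φ.surjective x
        rw [mem_filter, hcol c hc] at hx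
        exact ⟨(k, b), by rw [mem_product, mem_filter]; exact ⟨⟨mem_univ _, hx.2⟩, mem_univ _⟩, rfl⟩
    rw [h1, card_product, card_univ, Fintype.card_bool, mul_comm]
  have key : ∀ c : V → Fin d ↪ I, ind (HalfCompat π c ∧ ¬ Balanced m c) * (B : ℝ) ^ m ≤
      ind (HalfCompat π c) * ∑ j, ((B : ℝ) ^ 2) ^ (univ.filter fun k => res c k = j).card := by
    intro c
    by_cases hc : HalfCompat π c
    swap
    · rw [ind_of_not (fun h => hc h.1), ind_of_not hc]
      simp
    rw [ind_of hc, one_mul]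
    by_cases hb : Balanced m c
    · rw [ind_of_not (fun h => h.2 hb), zero_mul]
      positivity
    rw [ind_of ⟨hc, hb⟩, one_mul]
    unfold Balanced at hb
    push Not at hb
    obtain ⟨j, hj⟩ := hb
    rw [hcnt c hc] at hj
    refine le_trans ?_ (single_le_sum (f := fun j =>
      ((B : ℝ) ^ 2) ^ (univ.filter fun k => res c k = j).card) (fun _ _ => by positivity)
        (mem_univ j))
    rw [← pow_mul]
    exact pow_le_pow_right₀ hB1' hj.le
  rw [sum_mul]
  refine (sum_le_sum fun c _ => key c).trans ?_
  have h5 : ∑ c : V → Fin d ↪ I, ind (HalfCompat π c) *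
      ∑ j, ((B : ℝ) ^ 2) ^ (univ.filter fun k => res c k = j).card =
      ∑ F ∈ (univ.filter fun c : V → Fin d ↪ I => HalfCompat π c).image res,
        ∑ j, ((B : ℝ) ^ 2) ^ (univ.filter fun k => F k = j).card := by
    rw [sum_image hinj, sum_filter]
    refine sum_congr rfl fun c _ => ?_
    unfold ind
    split_ifs <;> simp
  rw [h5]
  refine (sum_le_sum_of_subset_of_nonneg (subset_univ _) fun F _ _ => by positivity).trans ?_
  rw [sum_comm, sum_congr rfl fun j _ => sum_pow_card_filter M' j _, sum_const, card_univ,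
    nsmul_eq_mul]
  refine mul_le_mul_of_nonneg_left (pow_le_pow_left₀ ?_ ?_ _) (Nat.cast_nonneg _)
  · nlinarith
  · linarith

end

section
variable {n d : ℕ}

/-- The pairings of half-edges that produce a simple graph. -/
abbrev IsSimpleHalf (π : PM (Fin n × Fin d)) : Prop :=
  IsSimplePairing Prod.fst (fun _ _ => False) π

/-- The graph produced by a pairing of half-edges. -/
def pairingGraph (π : PM (Fin n × Fin d)) : SimpleGraph (Fin n) :=
  SimpleGraph.fromRel fun u v => ∃ i, (π (u, i)).1 = v

lemma exists_pairing_comm (π : PM (Fin n × Fin d)) {u v : Fin n} (h : ∃ i, (π (u, i)).1 = v) :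
    ∃ i, (π (v, i)).1 = u := by
  obtain ⟨i, rfl⟩ := h
  exact ⟨(π (u, i)).2, by simp⟩

lemma IsSimpleHalf.fst_ne {π : PM (Fin n × Fin d)} (h : IsSimpleHalf π) (x : Fin n × Fin d) :
    (π x).1 ≠ x.1 := fun h' => h.1 x (Or.inl h'.symm)

lemma IsSimpleHalf.fst_injective {π : PM (Fin n × Fin d)} (h : IsSimpleHalf π) (v : Fin n) :
    Function.Injective fun i => (π (v, i)).1 := by
  intro i j hij
  by_contra hne
  exact h.2 (v, i) ⟨(v, j), fun h => hne (Prod.ext_iff.1 h).2.symm, rfl, hij.symm⟩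

lemma pairingGraph_adj {π : PM (Fin n × Fin d)} (h : IsSimpleHalf π) {u v : Fin n} :
    (pairingGraph π).Adj u v ↔ ∃ i, (π (u, i)).1 = v := by
  rw [pairingGraph, SimpleGraph.fromRel_adj]
  constructor
  · rintro ⟨-, h | h⟩
    · exact h
    · exact exists_pairing_comm π h
  · rintro ⟨i, rfl⟩
    exact ⟨(h.fst_ne (u, i)).symm, Or.inl ⟨i, rfl⟩⟩

lemma pairing_unique {f : Fin n → Fin d → Fin n} (hf : ∀ v, Function.Injective (f v))
    {x y z : Fin n × Fin d} (h1 : f x.1 x.2 = y.1 ∧ f y.1 y.2 = x.1)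
    (h2 : f x.1 x.2 = z.1 ∧ f z.1 z.2 = x.1) : y = z := by
  have h3 : y.1 = z.1 := h1.1.symm.trans h2.1
  refine Prod.ext h3 (hf y.1 ?_)
  rw [h1.2, h3, h2.2]

lemma exists_pairing {f : Fin n → Fin d → Fin n} (hf : ∀ v, Function.Injective (f v))
    (hne : ∀ v i, f v i ≠ v) (hs : ∀ v i, ∃ j, f (f v i) j = v) :
    ∃ π : PM (Fin n × Fin d), ∀ x, f x.1 x.2 = (π x).1 ∧ f (π x).1 (π x).2 = x.1 := by
  have h : ∀ x : Fin n × Fin d, ∃ y : Fin n × Fin d, f x.1 x.2 = y.1 ∧ f y.1 y.2 = x.1 := by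
    intro x
    obtain ⟨j, hj⟩ := hs x.1 x.2
    exact ⟨(f x.1 x.2, j), rfl, hj⟩
  choose P hP using h
  refine ⟨PM.mk P (fun x => pairing_unique hf (hP _) ⟨(hP x).2, (hP x).1⟩) (fun x hx => ?_), hP⟩
  have := (hP x).1
  rw [hx] at this
  exact hne _ _ this

lemma pairing_spec (π : PM (Fin n × Fin d)) (x : Fin n × Fin d) :
    (π (x.1, x.2)).1 = (π x).1 ∧ (π ((π x).1, (π x).2)).1 = x.1 := by
  simp

lemma isRegularGraph_pairingGraph {π : PM (Fin n × Fin d)} (h : IsSimpleHalf π) :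
    IsRegularGraph (pairingGraph π) d := by
  intro v
  rw [gDeg, ← Nat.card_congr (Equiv.ofBijective
    (fun i : Fin d => (⟨(π (v, i)).1, (pairingGraph_adj h).2 ⟨i, rfl⟩⟩ :
      {w // (pairingGraph π).Adj v w})) ⟨?_, ?_⟩)]
  · simp
  · intro i j hij
    exact h.fst_injective v (Subtype.ext_iff.1 hij)
  · rintro ⟨w, hw⟩
    obtain ⟨i, hi⟩ := (pairingGraph_adj h).1 hw
    exact ⟨i, Subtype.ext hi⟩

/-- Every regular graph comes from the same number of pairings. -/
lemma card_pairingGraph_eq {G : SimpleGraph (Fin n)} (hG : IsRegularGraph G d) :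
    (univ.filter fun π : PM (Fin n × Fin d) => IsSimpleHalf π ∧ pairingGraph π = G).card =
      d.factorial ^ n := by
  have h1 : Fintype.card (∀ v, Fin d ≃ {w // G.Adj v w}) = d.factorial ^ n := by
    rw [Fintype.card_pi]
    have : ∀ v, Fintype.card (Fin d ≃ {w // G.Adj v w}) = d.factorial := by
      intro v
      have h2 : Fintype.card {w // G.Adj v w} = d := by
        rw [← Nat.card_eq_fintype_card]
        exact hG v
      rw [Fintype.card_equiv (Fintype.equivOfCardEq (by rw [h2, Fintype.card_fin])),
        Fintype.card_fin]
    rw [prod_congr rfl fun v _ => this v, prod_const, card_univ, Fintype.card_fin]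
  rw [← h1, ← Fintype.card_subtype]
  have hadj : ∀ π : {π : PM (Fin n × Fin d) // IsSimpleHalf π ∧ pairingGraph π = G}, ∀ v w,
      G.Adj v w ↔ ∃ i, (π.1 (v, i)).1 = w := by
    rintro ⟨π, hπ, rfl⟩ v w
    exact pairingGraph_adj hπ
  refine Fintype.card_congr (Equiv.ofBijective (fun π v => Equiv.ofBijective
    (fun i => (⟨(π.1 (v, i)).1, (hadj π v _).2 ⟨i, rfl⟩⟩ : {w // G.Adj v w})) ⟨?_, ?_⟩) ⟨?_, ?_⟩)
  · intro i j hij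
    exact IsSimpleHalf.fst_injective π.2.1 v (Subtype.ext_iff.1 hij)
  · rintro ⟨w, hw⟩
    obtain ⟨i, hi⟩ := (hadj π v w).1 hw
    exact ⟨i, Subtype.ext hi⟩
  · intro π π' h
    have h3 : ∀ v i, (π.1 (v, i)).1 = (π'.1 (v, i)).1 := by
      intro v i
      have := congrArg (fun e => e i) (congrFun h v)
      exact Subtype.ext_iff.1 this
    refine Subtype.ext (PM.ext fun x => ?_)
    refine pairing_unique (f := fun v i => (π.1 (v, i)).1)
      (fun v => IsSimpleHalf.fst_injective π.2.1 v) (pairing_spec π.1 x) ?_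
    rw [h3, h3]
    exact pairing_spec π'.1 x
  · intro σ
    obtain ⟨π, hπ⟩ := exists_pairing (f := fun v i => ((σ v i : {w // G.Adj v w}) : Fin n))
      (fun v i j hij => (σ v).injective (Subtype.ext hij)) (fun v i => ((σ v i).2.ne).symm)
      (fun v i => ⟨(σ (σ v i)).symm ⟨v, (σ v i).2.symm⟩, by simp⟩)
    have hsimple : IsSimpleHalf π := by
      refine ⟨fun x hx => ?_, fun x hx => ?_⟩
      · rcases hx with hx | hx
        · exact (σ x.1 x.2).2.ne (hx.trans (hπ x).1.symm)
        · exact hx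
      · obtain ⟨y, h4, h5, h6⟩ := hx
        obtain ⟨v, i⟩ := x
        obtain ⟨w, j⟩ := y
        dsimp only at h5
        subst h5
        rw [← (hπ _).1, ← (hπ _).1] at h6
        exact h4 (Prod.ext rfl ((σ w).injective (Subtype.ext h6)))
    have hgraph : pairingGraph π = G := by
      ext u v
      rw [pairingGraph_adj hsimple]
      constructor
      · rintro ⟨i, rfl⟩
        rw [← (hπ _).1]
        exact (σ u i).2
      · intro huv
        refine ⟨(σ u).symm ⟨v, huv⟩, ?_⟩
        rw [← (hπ _).1]
        simp
    refine ⟨⟨π, hsimple, hgraph⟩, ?_⟩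
    funext v
    ext i
    have := (hπ (v, i)).1
    exact congrArg Fin.val this.symm

lemma card_pairingGraph_mem (A : Finset (SimpleGraph (Fin n))) :
    ((univ.filter fun π : PM (Fin n × Fin d) => IsSimpleHalf π ∧ pairingGraph π ∈ A).card : ℝ) =
      (d.factorial : ℝ) ^ n * (A.filter fun G => IsRegularGraph G d).card := by
  rw [card_eq_sum_card_fiberwise (f := pairingGraph) (t := A.filter fun G => IsRegularGraph G d)]
  · rw [sum_congr rfl (g := fun _ => d.factorial ^ n), sum_const, smul_eq_mul]
    · push_cast
      ring
    · intro G hG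
      rw [← card_pairingGraph_eq (mem_filter.1 hG).2]
      congr 1
      ext π
      rw [mem_filter, mem_filter, mem_filter]
      constructor
      · rintro ⟨⟨h1, h2, h3⟩, h4⟩
        exact ⟨h1, h2, h4⟩
      · rintro ⟨h1, h2, h4⟩
        exact ⟨⟨h1, h2, h4 ▸ (mem_filter.1 hG).1⟩, h4⟩
  · intro π hπ
    have h1 := (mem_filter.1 (mem_coe.1 hπ)).2
    exact mem_coe.2 (mem_filter.2 ⟨h1.2, isRegularGraph_pairingGraph h1.1⟩)

lemma sum_mu (A : Finset (SimpleGraph (Fin n))) : ∑ G ∈ A, mu n d G =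
    (A.filter fun G => IsRegularGraph G d).card /
      ((univ.filter fun G : SimpleGraph (Fin n) => IsRegularGraph G d).card : ℝ) := by
  have h : (Nat.card {H : SimpleGraph (Fin n) // IsRegularGraph H d} : ℝ) =
      (univ.filter fun G : SimpleGraph (Fin n) => IsRegularGraph G d).card := by
    rw [Nat.card_eq_fintype_card, Fintype.card_subtype]
  unfold mu
  rw [h, ← sum_filter, sum_const, nsmul_eq_mul, div_eq_mul_inv]

lemma card_filter_fst_le (v : Fin n) {P : Fin n × Fin d → Prop} [DecidablePred P]
    (hP : ∀ q, P q → q.1 = v) : (univ.filter P).card ≤ d := by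
  refine (card_le_card (t := univ.image fun i : Fin d => (v, i)) fun x hx => ?_).trans
    (card_image_le.trans (by simp))
  rw [mem_filter] at hx
  exact mem_image.2 ⟨x.2, mem_univ _, Prod.ext (hP _ hx.2).symm rfl⟩

lemma card_simple_pairings_aux {J : Type*} [Fintype J] (col : Fin n × Fin d → J)
    (hcol : ∀ x y, col x = col y) {C : ℕ} (hd : 1 ≤ d) (hC : C = 2 * (d + d * d))
    (hn : 2 * (3 + 3 * d + 4 * (d * d)) ≤ n) :
    (univ : Finset (PM (Fin n × Fin d))).card ≤ (2 * (1 + C) ^ (2 * C)) ^ 2 *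
      (univ.filter fun π : PM (Fin n × Fin d) => IsSimpleHalf π).card := by
  have hnd : n ≤ n * d := Nat.le_mul_of_pos_right _ hd
  have h := card_le_card_isSimplePairing (Q := Fin n × Fin d) (vert := Prod.fst)
    (col := col) (U := fun _ _ => False) (D := d)
    (a := n * d - (2 + 3 * d + 4 * (d * d))) (C := C) (fun _ _ => id) (by omega) ?_ ?_ ?_ ?_
  · refine le_trans (card_le_card fun π _ => ?_)
      (h.trans (Nat.mul_le_mul_left _ (card_le_card fun π hπ => ?_)))
    · rw [mem_filter]
      exact ⟨mem_univ _, fun _ => hcol _ _⟩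
    · rw [mem_filter] at hπ ⊢
      exact ⟨mem_univ _, hπ.2.2⟩
  · intro v
    exact @card_filter_fst_le n d v _ (_) fun q hq => hq
  · simp
  · intro p
    rw [filter_true_of_mem fun q _ => hcol q p, card_univ, Fintype.card_prod, Fintype.card_fin,
      Fintype.card_fin]
    omega
  · rw [Fintype.card_prod, Fintype.card_fin, Fintype.card_fin, hC]
    have : n * d ≤ 2 * (n * d - (2 + 3 * d + 4 * (d * d))) := by omega
    calc n * d * (d + d * d) ≤ 2 * (n * d - (2 + 3 * d + 4 * (d * d))) * (d + d * d) :=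
          Nat.mul_le_mul_right _ this
      _ = _ := by ring

theorem card_simple_pairings {C : ℕ} (hd : 1 ≤ d) (hC : C = 2 * (d + d * d))
    (hn : 2 * (3 + 3 * d + 4 * (d * d)) ≤ n) :
    (univ : Finset (PM (Fin n × Fin d))).card ≤ (2 * (1 + C) ^ (2 * C)) ^ 2 *
      (univ.filter fun π : PM (Fin n × Fin d) => IsSimpleHalf π).card :=
  card_simple_pairings_aux (fun _ => ()) (fun _ _ => rfl) hd hC hn

end

lemma PM.exists_of_rel {α : Type*} {R : α → α → Prop} (hs : ∀ x y, R x y → R y x)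
    (hi : ∀ x, ¬ R x x) (he : ∀ x, ∃ y, R x y) (hu : ∀ x y z, R x y → R x z → y = z) :
    ∃ M : PM α, ∀ x, R x (M x) := by
  choose P hP using he
  refine ⟨PM.mk P (fun x => hu _ _ _ (hP _) (hs _ _ (hP x))) fun x hx => ?_, hP⟩
  have := hP x
  rw [hx] at this
  exact hi x this

section
variable {I : Type*} [Fintype I] [DecidableEq I] {n d m : ℕ}

/-- The pairs of a colour and a vertex at which the colour is not used. -/
abbrev Unused (c : Fin n → Fin d ↪ I) := {p : I × Fin n // ∀ i, c p.2 i ≠ p.1}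

/-- The number of half-edges of a colour. -/
noncomputable def colCount (c : Fin n → Fin d ↪ I) (j : I) : ℕ :=
  (univ.filter fun x : Fin n × Fin d => c x.1 x.2 = j).card

/-- The matchings extend the coloured pairing. -/
def Extends (M : I → PM (Fin n)) (c : Fin n → Fin d ↪ I) (π : PM (Fin n × Fin d)) : Prop :=
  ∀ v i, M (c v i) v = (π (v, i)).1

variable {π : PM (Fin n × Fin d)} {c : Fin n → Fin d ↪ I}

/-- The relation defining the extension of a coloured pairing by matchings of the unused pairs. -/
def extRel (π : PM (Fin n × Fin d)) (c : Fin n → Fin d ↪ I) (N : PM (Unused c)) (j : I)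
    (v w : Fin n) : Prop :=
  (∃ i, c v i = j ∧ (π (v, i)).1 = w) ∨ ∃ q : Unused c, q.1 = (j, v) ∧ (N q).1 = (j, w)

lemma exists_extension (hπ : IsSimpleHalf π) (hc : HalfCompat π c) {N : PM (Unused c)}
    (hN : ∀ q, (N q).1.1 = q.1.1) : ∃ M : I → PM (Fin n), ∀ j v, extRel π c N j v (M j v) := by
  have : ∀ j, ∃ M : PM (Fin n), ∀ v, extRel π c N j v (M v) := by
    intro j
    refine PM.exists_of_rel ?_ ?_ ?_ ?_
    · rintro v w (⟨i, h1, rfl⟩ | ⟨q, h1, h2⟩)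
      · refine Or.inl ⟨(π (v, i)).2, ?_, by simp⟩
        rw [← h1]
        exact hc (v, i)
      · exact Or.inr ⟨N q, h2, by rw [PM.apply_apply]; exact h1⟩
    · rintro v (⟨i, h1, h2⟩ | ⟨q, h1, h2⟩)
      · exact hπ.fst_ne (v, i) h2
      · exact N.apply_ne q (Subtype.ext (h2.trans h1.symm))
    · intro v
      by_cases h : ∃ i, c v i = j
      · obtain ⟨i, hi⟩ := h
        exact ⟨_, Or.inl ⟨i, hi, rfl⟩⟩
      · push Not at h
        let q : Unused c := ⟨(j, v), h⟩
        exact ⟨(N q).1.2, Or.inr ⟨q, rfl, Prod.ext (hN q) rfl⟩⟩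
    · rintro v w w' (⟨i, h1, h2⟩ | ⟨q, h1, h2⟩) (⟨i', h1', h2'⟩ | ⟨q', h1', h2'⟩)
      · obtain rfl : i = i' := (c v).injective (h1.trans h1'.symm)
        exact h2.symm.trans h2'
      · have := q'.2 i
        rw [h1'] at this
        exact absurd h1 this
      · have := q.2 i'
        rw [h1] at this
        exact absurd h1' this
      · obtain rfl : q = q' := Subtype.ext (h1.trans h1'.symm)
        exact (Prod.ext_iff.1 (h2.symm.trans h2')).2
  choose M hM using this
  exact ⟨M, hM⟩

lemma extends_of_extRel {N : PM (Unused c)} {M : I → PM (Fin n)}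
    (h : ∀ j v, extRel π c N j v (M j v)) : Extends M c π := by
  intro v i
  rcases h (c v i) v with ⟨i', h1, h2⟩ | ⟨q, h1, h2⟩
  · rw [← h2, (c v).injective h1]
  · have := q.2 i
    rw [h1] at this
    exact absurd rfl this

lemma disj_of_extRel (hπ : IsSimpleHalf π) {N : PM (Unused c)}
    (hN : IsSimplePairing (fun q : Unused c => q.1.2) (pairingGraph π).Adj N)
    {M : I → PM (Fin n)} (h : ∀ j v, extRel π c N j v (M j v)) : Disj M := by
  intro j k hjk v hv
  have hj := h j v
  have hk := h k v
  rw [← hv] at hk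
  have mixed : ∀ (w : Fin n) (i : Fin d) (q : Unused c) (k : I), (π (v, i)).1 = w → q.1 = (k, v) →
      (N q).1 = (k, w) → False := by
    intro w i q k h1 h2 h3
    refine hN.1 q (Or.inr ?_)
    dsimp only
    rw [h2, h3]
    exact (pairingGraph_adj hπ).2 ⟨i, h1⟩
  rcases hj with ⟨i, h1, h2⟩ | ⟨q, h1, h2⟩ <;> rcases hk with ⟨i', h1', h2'⟩ | ⟨q', h1', h2'⟩
  · obtain rfl : i = i' := hπ.fst_injective v (h2.trans h2'.symm)
    exact hjk (h1.symm.trans h1')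
  · exact mixed _ i q' k h2 h1' h2'
  · exact mixed _ i' q j h2' h1 h2
  · refine hN.2 q ⟨q', ?_, ?_, ?_⟩
    · rintro rfl
      exact hjk (Prod.ext_iff.1 (h1.symm.trans h1')).1
    · dsimp only
      rw [h1, h1']
    · dsimp only
      rw [h2, h2']

lemma card_simple_unused_le (hπ : IsSimpleHalf π) (hc : HalfCompat π c) :
    (univ.filter fun N : PM (Unused c) => (∀ q, (N q).1.1 = q.1.1) ∧
      IsSimplePairing (fun q : Unused c => q.1.2) (pairingGraph π).Adj N).card ≤
    (univ.filter fun M : I → PM (Fin n) => Disj M ∧ Extends M c π).card := by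
  refine card_le_card_of_forall_subsingleton
    (fun N M => ∀ j v, extRel π c N j v (M j v)) ?_ ?_
  · intro N hN
    rw [mem_filter] at hN
    obtain ⟨M, hM⟩ := exists_extension hπ hc hN.2.1
    refine ⟨M, ?_, hM⟩
    rw [mem_filter]
    exact ⟨mem_univ _, disj_of_extRel hπ hN.2.2 hM, extends_of_extRel hM⟩
  · rintro M - N ⟨-, h1⟩ N' ⟨-, h2⟩
    refine PM.ext fun q => ?_
    have aux : ∀ (N : PM (Unused c)) (w : Fin n), extRel π c N q.1.1 q.1.2 w →
        (N q).1 = (q.1.1, w) := by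
      rintro N w (⟨i, h3, -⟩ | ⟨q', h3, h4⟩)
      · exact absurd h3 (q.2 i)
      · obtain rfl : q' = q := Subtype.ext h3
        exact h4
    exact Subtype.ext ((aux N _ (h1 _ _)).trans (aux N' _ (h2 _ _)).symm)

lemma card_unused (j : I) :
    Fintype.card {q : Unused c // q.1.1 = j} = n - colCount c j := by
  have h1 : Fintype.card {q : Unused c // q.1.1 = j} =
      (univ.filter fun v : Fin n => ∀ i, c v i ≠ j).card := by
    rw [← Fintype.card_subtype]
    refine Fintype.card_congr ⟨fun q => ⟨q.1.1.2, ?_⟩, fun v => ⟨⟨(j, v.1), v.2⟩, rfl⟩, ?_, ?_⟩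
    · exact fun i h => q.1.2 i (h.trans q.2.symm)
    · rintro ⟨⟨⟨j', v⟩, h⟩, rfl⟩
      rfl
    · rintro ⟨v, h⟩
      rfl
  have h2 : colCount c j = (univ.filter fun v : Fin n => ¬ ∀ i, c v i ≠ j).card := by
    refine card_bij (fun x _ => x.1) ?_ ?_ ?_
    · intro x hx
      rw [mem_filter] at hx ⊢
      exact ⟨mem_univ _, fun h => h _ hx.2⟩
    · rintro ⟨v, i⟩ hx ⟨w, i'⟩ hy h
      rw [mem_filter] at hx hy
      dsimp only at h
      subst h
      exact Prod.ext rfl ((c v).injective (hx.2.trans hy.2.symm))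
    · intro v hv
      rw [mem_filter] at hv
      have := hv.2
      push Not at this
      obtain ⟨i, hi⟩ := this
      refine ⟨(v, i), ?_, rfl⟩
      rw [mem_filter]
      exact ⟨mem_univ _, hi⟩
  have h3 := card_filter_add_card_filter_not (s := (univ : Finset (Fin n)))
    (fun v : Fin n => ∀ i, c v i ≠ j)
  rw [h1, h2]
  simp only [card_univ, Fintype.card_fin] at h3
  omega

lemma sum_colCount (c : Fin n → Fin d ↪ I) : ∑ j, colCount c j = n * d := by
  have := card_eq_sum_card_fiberwise (f := fun x : Fin n × Fin d => c x.1 x.2)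
    (s := univ) (t := (univ : Finset I)) fun _ _ => mem_coe.2 (mem_univ _)
  simp only [card_univ, Fintype.card_prod, Fintype.card_fin] at this
  exact this.symm

lemma even_colCount (hc : HalfCompat π c) (j : I) : Even (colCount c j) := by
  have := PM.even_card (PM.piEquiv (fun x : Fin n × Fin d => c x.1 x.2) ⟨π, hc⟩ j)
  rwa [Fintype.card_subtype] at this

/-- Almost all colour-preserving completions of a coloured pairing are simple, up to a constant. -/
lemma prod_pm_le_card_extends {L a : ℕ} (hL : Fintype.card I = L) (hdL : d ≤ L)
    (ha : a + (2 + 3 * L + 4 * (L * L)) = m) (ha2 : m ≤ 2 * a) (hn : n = 2 * m)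
    (hπ : IsSimpleHalf π) (hc : HalfCompat π c) (hb : Balanced m c) :
    ∏ j, pm (n - colCount c j) ≤
      (2 * (1 + 4 * L * (L + L * L)) ^ (2 * (4 * L * (L + L * L)))) ^ 2 *
        (univ.filter fun M : I → PM (Fin n) => Disj M ∧ Extends M c π).card := by
  have h1 := card_le_card_isSimplePairing (Q := Unused c) (V := Fin n) (J := I) (D := L) (a := a)
    (C := 4 * L * (L + L * L)) (vert := fun q => q.1.2) (col := fun q => q.1.1)
    (U := (pairingGraph π).Adj) (fun _ _ h => h.symm) (by omega) ?_ ?_ ?_ ?_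
  · have h2 := card_PM_preserving (fun q : Unused c => q.1.1)
    have h3 : ∏ j, pm (n - colCount c j) =
        ∏ t : I, Fintype.card (PM {x : Unused c // x.1.1 = t}) :=
      prod_congr rfl fun j _ => by rw [card_PM, card_unused]
    refine (h3.trans h2.symm).le.trans (le_trans (le_of_eq ?_)
      (h1.trans (Nat.mul_le_mul_left _ (le_trans (le_of_eq ?_) (card_simple_unused_le hπ hc)))))
    · rw [Fintype.card_subtype]
      congr!
    · congr!
  · intro v
    rw [← hL, ← card_univ]
    refine card_le_card_of_injOn (fun q => q.1.1) (fun _ _ => mem_coe.2 (mem_univ _)) ?_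
    intro q hq q' hq' h
    have h1 := (@mem_filter _ _ (_) _ _).1 (mem_coe.1 hq)
    have h2 := (@mem_filter _ _ (_) _ _).1 (mem_coe.1 hq')
    exact Subtype.ext (Prod.ext h (h1.2.trans h2.2.symm))
  · intro v
    refine le_trans ?_ hdL
    have : (univ.filter fun u => (pairingGraph π).Adj v u) ⊆
        univ.image fun i : Fin d => (π (v, i)).1 := by
      intro u hu
      rw [mem_filter] at hu
      obtain ⟨i, hi⟩ := (pairingGraph_adj hπ).1 hu.2
      exact mem_image.2 ⟨i, mem_univ _, hi⟩
    have h2 := (card_le_card this).trans card_image_le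
    rw [card_univ, Fintype.card_fin] at h2
    convert h2
  · intro p
    rw [ha, ← Fintype.card_subtype, card_unused]
    have := hb p.1.1
    change colCount c p.1.1 ≤ m at this
    omega
  · have h2 : Fintype.card (Unused c) ≤ L * n := by
      refine (Fintype.card_subtype_le _).trans ?_
      rw [Fintype.card_prod, Fintype.card_fin, hL]
    calc Fintype.card (Unused c) * (L + L * L) ≤ (L * n) * (L + L * L) :=
          Nat.mul_le_mul_right _ h2
      _ ≤ (L * (4 * a)) * (L + L * L) :=
          Nat.mul_le_mul_right _ (Nat.mul_le_mul_left _ (by omega))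
      _ = _ := by ring

end

lemma sum_ind_le_ind {α : Type*} {S : Finset α} {P : α → Prop} {Q : Prop}
    (h : ∀ x ∈ S, P x → Q) (hu : ∀ x ∈ S, ∀ y ∈ S, P x → P y → x = y) :
    ∑ x ∈ S, ind (P x) ≤ ind Q := by
  by_cases hQ : ∃ x ∈ S, P x
  · obtain ⟨x, hx, hP⟩ := hQ
    rw [sum_eq_single_of_mem x hx fun y hy hne => ind_of_not fun h => hne (hu y hy x hx h hP),
      ind_of hP, ind_of (h x hx hP)]
  · push Not at hQ
    rw [sum_eq_zero fun x hx => ind_of_not (hQ x hx)]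
    exact ind_nonneg _

section
variable {I : Type*} [Fintype I] [DecidableEq I] {n d : ℕ} {π : PM (Fin n × Fin d)}
  {c : Fin n → Fin d ↪ I} {M : I → PM (Fin n)}

lemma Extends.compat (h : Extends M c π) (hc : HalfCompat π c) : Compat M c := by
  have key : ∀ i v, cov (c v) i = true → cov (c (M i v)) i = true := by
    intro i v hv
    rw [cov_eq_true] at hv ⊢
    obtain ⟨k, rfl⟩ := hv
    exact ⟨(π (v, k)).2, by rw [h]; exact hc (v, k)⟩
  intro i v
  rw [Bool.eq_iff_iff]
  refine ⟨fun h' => ?_, key i v⟩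
  have := key i _ h'
  rwa [PM.apply_apply] at this

lemma Extends.colGraph_eq (h : Extends M c π) : colGraph M c = pairingGraph π := by
  unfold colGraph pairingGraph
  congr! 5 with u v a
  rw [h u a]

lemma Extends.unique {π' : PM (Fin n × Fin d)} (h : Extends M c π) (hc : HalfCompat π c)
    (h' : Extends M c π') (hc' : HalfCompat π' c) : π = π' := by
  refine PM.ext fun x => ?_
  have h1 : (π x).1 = (π' x).1 := (h x.1 x.2).symm.trans (h' x.1 x.2)
  refine Prod.ext h1 ((c (π x).1).injective ?_)
  rw [hc x, h1, hc' x]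

lemma sum_card_extends_le (A : Finset (SimpleGraph (Fin n))) :
    ∑ π ∈ univ.filter (fun π : PM (Fin n × Fin d) => IsSimpleHalf π ∧ pairingGraph π ∈ A),
      ∑ c : Fin n → Fin d ↪ I, ind (HalfCompat π c) *
        ((univ.filter fun M : I → PM (Fin n) => Disj M ∧ Extends M c π).card : ℝ) ≤
    ∑ M : I → PM (Fin n), ind (Disj M) * ∑ G ∈ A, numGraph d M G := by
  calc _ = ∑ M : I → PM (Fin n), ∑ c : Fin n → Fin d ↪ I, ind (Disj M) * ∑ π ∈ univ.filter
        (fun π : PM (Fin n × Fin d) => IsSimpleHalf π ∧ pairingGraph π ∈ A),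
          ind (HalfCompat π c ∧ Extends M c π) := by
        rw [sum_comm, sum_comm (s := (univ : Finset (I → PM (Fin n))))]
        refine sum_congr rfl fun c _ => ?_
        simp_rw [mul_sum]
        rw [sum_comm (s := (univ : Finset (I → PM (Fin n))))]
        refine sum_congr rfl fun π _ => ?_
        rw [← sum_ind, mul_sum]
        refine sum_congr rfl fun M _ => ?_
        rw [ind_and, ind_and]
        ring
    _ ≤ ∑ M : I → PM (Fin n), ∑ c : Fin n → Fin d ↪ I, ind (Disj M) *
        ∑ G ∈ A, ind (Compat M c ∧ colGraph M c = G) := by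
        refine sum_le_sum fun M _ => sum_le_sum fun c _ =>
          mul_le_mul_of_nonneg_left ?_ (ind_nonneg _)
        have h1 : ∑ G ∈ A, ind (Compat M c ∧ colGraph M c = G) =
            ind (Compat M c ∧ colGraph M c ∈ A) := by
          by_cases h : colGraph M c ∈ A
          · rw [sum_eq_single_of_mem _ h fun G _ hne => ind_of_not fun h => hne h.2.symm]
            simp [h]
          · rw [ind_of_not fun h' => h h'.2]
            exact sum_eq_zero fun G hG => ind_of_not fun h' => h (h'.2 ▸ hG)
        rw [h1]
        refine sum_ind_le_ind ?_ ?_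
        · rintro π hπ ⟨h2, h3⟩
          rw [mem_filter] at hπ
          exact ⟨h3.compat h2, h3.colGraph_eq ▸ hπ.2.2⟩
        · rintro π - π' - ⟨h2, h3⟩ ⟨h4, h5⟩
          exact h3.unique h2 h5 h4
    _ = _ := by
        refine sum_congr rfl fun M _ => ?_
        rw [← mul_sum, sum_comm]
        rfl

end

lemma exp_le_phi {a : ℝ} (ha : 0 < a) (n : ℕ) :
    Real.exp (n / 2 * (Real.log a - 1) + (n - a) / 2) ≤ phi n := by
  unfold phi
  refine Real.exp_le_exp.2 ?_
  rcases Nat.eq_zero_or_pos n with rfl | hn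
  · simp only [CharP.cast_eq_zero, zero_div, zero_mul, zero_sub, zero_add]
    linarith
  · have hn' : (0 : ℝ) < n := by exact_mod_cast hn
    have h := Real.one_sub_inv_le_log_of_pos (div_pos hn' ha)
    rw [Real.log_div hn'.ne' ha.ne', inv_div] at h
    have h2 := mul_le_mul_of_nonneg_left h hn'.le
    rw [mul_sub, mul_one, mul_div_cancel₀ _ hn'.ne'] at h2
    nlinarith

lemma exp_le_prod_phi {I : Type*} [Fintype I] {a : ℝ} (ha : 0 < a) (N : I → ℕ)
    (hN : ∑ j, (N j : ℝ) = Fintype.card I * a) :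
    Real.exp (Fintype.card I * a / 2 * (Real.log a - 1)) ≤ ∏ j, phi (N j) := by
  refine le_trans (le_of_eq ?_) (prod_le_prod (fun _ _ => (Real.exp_pos _).le)
    fun j _ => exp_le_phi ha (N j))
  rw [← Real.exp_sum, sum_add_distrib, ← sum_mul, ← sum_div, ← sum_div, sum_sub_distrib, hN,
    sum_const, card_univ, nsmul_eq_mul]
  ring_nf

/-- The number of completions of a coloured pairing is at least the typical one. -/
lemma bethe_mul_pm_pow_le {I : Type*} [Fintype I] {d m : ℕ} {K : ℝ} (hK : 0 ≤ K) (hd : 1 ≤ d)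
    (hm : 0 < m) (hL : d < Fintype.card I) {s : I → ℕ} (hs : ∀ j, s j ≤ 2 * m)
    (he : ∀ j, Even (s j)) (hsum : ∑ j, s j = 2 * m * d) :
    bethe (d / Fintype.card I) (Fintype.card I) d (2 * m) K * (pm (2 * m) : ℝ) ^ Fintype.card I ≤
      2 ^ Fintype.card I * (pm (2 * (m * d)) * (K ^ (2 * m) / (Fintype.card I : ℝ) ^ (m * d)) *
        ∏ j, (pm (2 * m - s j) : ℝ)) := by
  set L := Fintype.card I with hLdef
  have hL0 : (0 : ℝ) < L := by exact_mod_cast (Nat.zero_le d).trans_lt hL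
  have hd0 : (0 : ℝ) < d := by exact_mod_cast hd
  have hm0 : (0 : ℝ) < m := by exact_mod_cast hm
  have hdL : (d : ℝ) < L := by exact_mod_cast hL
  set r : ℝ := d / L with hr
  have hr0 : 0 < r := div_pos hd0 hL0
  have hr1 : 0 < 1 - r := sub_pos.2 ((div_lt_one hL0).2 hdL)
  have hrL : r * L = d := div_mul_cancel₀ _ hL0.ne'
  have hsub : ((L - d : ℕ) : ℝ) = L - d := Nat.cast_sub hL.le
  have h1 : (pm (2 * m) : ℝ) ^ L ≤ 2 ^ L * phi (2 * m) ^ L := by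
    rw [← mul_pow]
    exact pow_le_pow_left₀ (Nat.cast_nonneg _) (pm_le_two_mul_phi m) _
  have h2 : ∏ j, phi (2 * m - s j) ≤ ∏ j, (pm (2 * m - s j) : ℝ) := by
    refine prod_le_prod (fun _ _ => (phi_pos _).le) fun j _ => ?_
    obtain ⟨t, ht⟩ := (Nat.even_sub (hs j)).2 (iff_of_true (even_two_mul m) (he j))
    rw [ht, ← two_mul]
    exact phi_le_pm t
  have h3 : Real.exp (L * ((1 - r) * (2 * m)) / 2 * (Real.log ((1 - r) * (2 * m)) - 1)) ≤
      ∏ j, phi (2 * m - s j) := by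
    refine exp_le_prod_phi (by positivity) _ ?_
    have h4 : ∀ j, ((2 * m - s j : ℕ) : ℝ) = 2 * m - s j := fun j => by
      rw [Nat.cast_sub (hs j)]
      push_cast
      rfl
    simp_rw [h4]
    rw [sum_sub_distrib, sum_const, card_univ, nsmul_eq_mul, ← hLdef, ← Nat.cast_sum, hsum]
    push_cast
    rw [← hrL]
    ring
  have h5 : √((r ^ d * (1 - r) ^ (L - d)) ^ (2 * m)) =
      Real.exp (m * (d * Real.log r + (L - d) * Real.log (1 - r))) := by
    have p1 : r ^ d = Real.exp (d * Real.log r) := by rw [Real.exp_nat_mul, Real.exp_log hr0]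
    have p2 : (1 - r) ^ (L - d) = Real.exp ((L - d : ℕ) * Real.log (1 - r)) := by
      rw [Real.exp_nat_mul, Real.exp_log hr1]
    rw [p1, p2, ← Real.exp_add, ← Real.exp_nat_mul, hsub,
      Real.sqrt_eq_iff_mul_self_eq (Real.exp_pos _).le (Real.exp_pos _).le, ← Real.exp_add]
    push_cast
    ring_nf
  have h6 : (L : ℝ) ^ (m * d) = Real.exp (m * d * Real.log L) := by
    rw [← Nat.cast_mul, Real.exp_nat_mul, Real.exp_log hL0]
  have h7 : √((r ^ d * (1 - r) ^ (L - d)) ^ (2 * m)) * phi (2 * m) ^ L * (L : ℝ) ^ (m * d) =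
      phi (2 * (m * d)) *
        Real.exp (L * ((1 - r) * (2 * m)) / 2 * (Real.log ((1 - r) * (2 * m)) - 1)) := by
    rw [h5, h6, phi, phi, ← Real.exp_nat_mul, ← Real.exp_add, ← Real.exp_add, ← Real.exp_add]
    congr 1
    have e1 : Real.log ((1 - r) * (2 * m)) = Real.log (1 - r) + Real.log (2 * m) :=
      Real.log_mul hr1.ne' (by positivity)
    have e2 : Real.log (2 * (m * d)) = Real.log r + Real.log L + Real.log (2 * m) := by
      rw [← Real.log_mul hr0.ne' hL0.ne', hrL, ← Real.log_mul hd0.ne' (by positivity)]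
      ring_nf
    push_cast
    rw [e1, e2, ← hrL]
    ring
  have h8 : √((r ^ d * (1 - r) ^ (L - d)) ^ (2 * m)) * phi (2 * m) ^ L ≤
      pm (2 * (m * d)) / (L : ℝ) ^ (m * d) * ∏ j, (pm (2 * m - s j) : ℝ) := by
    rw [div_mul_eq_mul_div, le_div_iff₀ (by positivity), h7]
    exact mul_le_mul (phi_le_pm _) (h3.trans h2) (Real.exp_pos _).le (Nat.cast_nonneg _)
  unfold bethe
  calc K ^ (2 * m) * √((r ^ d * (1 - r) ^ (L - d)) ^ (2 * m)) * (pm (2 * m) : ℝ) ^ L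
      ≤ K ^ (2 * m) * √((r ^ d * (1 - r) ^ (L - d)) ^ (2 * m)) * (2 ^ L * phi (2 * m) ^ L) :=
        mul_le_mul_of_nonneg_left h1 (by positivity)
    _ = 2 ^ L * K ^ (2 * m) * (√((r ^ d * (1 - r) ^ (L - d)) ^ (2 * m)) * phi (2 * m) ^ L) := by
        ring
    _ ≤ 2 ^ L * K ^ (2 * m) * (pm (2 * (m * d)) / (L : ℝ) ^ (m * d) *
        ∏ j, (pm (2 * m - s j) : ℝ)) := mul_le_mul_of_nonneg_left h8 (by positivity)
    _ = _ := by ring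

section
variable {I : Type*} [Fintype I] [DecidableEq I] {d m : ℕ}

lemma sum_unbalanced_le [Nonempty I] {K : ℝ} (hK2 : (Fintype.card I : ℝ) ^ d ≤ 2 * K)
    (hL : (2 ^ (d + 3)) ^ 2 ≤ Fintype.card I) (π : PM (Fin (2 * m) × Fin d)) :
    ∑ c : Fin (2 * m) → Fin d ↪ I, ind (HalfCompat π c ∧ ¬ Balanced m c) ≤
      K ^ (2 * m) / (Fintype.card I : ℝ) ^ (m * d) * (Fintype.card I / 2 ^ m) := by
  have h := card_unbalanced_mul_pow_le (m := m) hL Nat.one_le_two_pow π (M := m * d)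
    (by rw [Fintype.card_fin]; ring)
  have hL0 : (0 : ℝ) < Fintype.card I := by exact_mod_cast Fintype.card_pos
  set L : ℝ := (Fintype.card I : ℝ)
  have hK3 : (L ^ d) ^ (2 * m) ≤ (2 * K) ^ (2 * m) := pow_le_pow_left₀ (by positivity) hK2 _
  rw [div_mul_div_comm, le_div_iff₀ (by positivity)]
  refine le_of_mul_le_mul_right ?_ (show (0 : ℝ) < (2 ^ (d + 2)) ^ m by positivity)
  push_cast at h
  calc _ = (∑ c : Fin (2 * m) → Fin d ↪ I, ind (HalfCompat π c ∧ ¬ Balanced m c)) *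
        ((2 : ℝ) ^ (d + 3)) ^ m * L ^ (m * d) := by
        rw [pow_succ (2 : ℝ) (d + 2), mul_pow]
        ring
    _ ≤ L * (2 * L) ^ (m * d) * L ^ (m * d) := mul_le_mul_of_nonneg_right h (by positivity)
    _ = (L ^ d) ^ (2 * m) * (L * 2 ^ (m * d)) := by ring
    _ ≤ (2 * K) ^ (2 * m) * (L * 2 ^ (m * d)) := mul_le_mul_of_nonneg_right hK3 (by positivity)
    _ = _ := by
      rw [mul_pow, pow_mul (2 : ℝ) 2 m, pow_add, mul_pow, pow_mul' (2 : ℝ) m d]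
      ring

lemma sum_balanced_ge [Nonempty I] {K B₀ θ δ : ℝ} (hK : K = Fintype.card (Fin d ↪ I))
    (hK0 : 0 < K) (hB₀ : B₀ = K ^ (2 * m) / (Fintype.card I : ℝ) ^ (m * d))
    (hθ : 0 ≤ θ) (hθ2 : (Fintype.card I : ℝ) ^ d / K - 1 ≤ θ ^ 2) (hθ3 : 2 ^ d * θ ≤ 1 / 2)
    (hθ4 : 2 * (2 ^ d * θ) ≤ δ / 4) (hL : (2 ^ (d + 3)) ^ 2 ≤ Fintype.card I)
    (hm : (Fintype.card I : ℝ) / 2 ^ m ≤ δ / 4) {S : Finset (PM (Fin (2 * m) × Fin d))}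
    (hS : ∀ π ∈ S, ∀ x, (π x).1 ≠ x.1) (hSc : δ * pm (2 * (m * d)) ≤ S.card) :
    δ / 2 * (pm (2 * (m * d)) * B₀) ≤
      ∑ π ∈ S, ∑ c : Fin (2 * m) → Fin d ↪ I, ind (HalfCompat π c ∧ Balanced m c) := by
  have hL0 : (0 : ℝ) < Fintype.card I := by exact_mod_cast Fintype.card_pos
  have hB0 : 0 < B₀ := by rw [hB₀]; positivity
  have hK1 : 0 < Fintype.card (Fin d ↪ I) := by
    rw [hK] at hK0
    exact_mod_cast hK0
  have hδ : 0 ≤ δ := by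
    have : 0 ≤ 2 * (2 ^ d * θ) := by positivity
    linarith
  have hK2 : (Fintype.card I : ℝ) ^ d ≤ 2 * K := by
    rw [← div_le_iff₀ hK0]
    have h1 : θ ≤ 1 := by
      have : (1 : ℝ) ≤ 2 ^ d := one_le_pow₀ one_le_two
      nlinarith
    have : θ ^ 2 ≤ 1 := pow_le_one₀ hθ h1
    linarith
  have h1 := sum_abs_card_halfCompat_sub_one_le (I := I) (M := m * d) hK1 hθ (by rwa [← hK]) hθ3
    (by rw [Fintype.card_fin]; ring) S hS
  have hpm : (S.card : ℝ) ≤ pm (2 * (m * d)) := by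
    have : S.card ≤ pm (2 * (m * d)) := by
      refine (card_le_univ S).trans (le_of_eq ?_)
      rw [card_PM, Fintype.card_prod, Fintype.card_fin, Fintype.card_fin]
      ring_nf
    exact_mod_cast this
  have h2 : ∀ π : PM (Fin (2 * m) × Fin d), ∑ c : Fin (2 * m) → Fin d ↪ I, ind (HalfCompat π c) ≤
      ∑ c : Fin (2 * m) → Fin d ↪ I, ind (HalfCompat π c ∧ Balanced m c) + B₀ * (δ / 4) := by
    intro π
    have h3 := (sum_unbalanced_le hK2 hL π).trans
      (mul_le_mul_of_nonneg_left hm (by rw [← hB₀]; exact hB0.le))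
    rw [← hB₀] at h3
    refine le_trans ?_ (add_le_add_right h3 _)
    rw [← sum_add_distrib]
    refine sum_le_sum fun c _ => ?_
    refine le_trans (ind_mono fun h => ?_) (ind_or_le _ _)
    by_cases hb : Balanced m c
    · exact Or.inl ⟨h, hb⟩
    · exact Or.inr ⟨h, hb⟩
  have h4 : ∀ π ∈ S, B₀ * (1 - |(∑ c : Fin (2 * m) → Fin d ↪ I, ind (HalfCompat π c)) *
      (Fintype.card I : ℝ) ^ (m * d) / (Fintype.card (Fin d ↪ I) : ℝ) ^ Fintype.card (Fin (2 * m))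
        - 1|) ≤ ∑ c : Fin (2 * m) → Fin d ↪ I, ind (HalfCompat π c ∧ Balanced m c) +
          B₀ * (δ / 4) := by
    intro π _
    refine le_trans ?_ (h2 π)
    rw [Fintype.card_fin, ← hK]
    set N := ∑ c : Fin (2 * m) → Fin d ↪ I, ind (HalfCompat π c)
    have h5 : N = B₀ * (N * (Fintype.card I : ℝ) ^ (m * d) / K ^ (2 * m)) := by
      rw [hB₀]
      field_simp
    rw [h5]
    refine mul_le_mul_of_nonneg_left ?_ hB0.le
    rw [← h5]
    have := neg_abs_le (N * (Fintype.card I : ℝ) ^ (m * d) / K ^ (2 * m) - 1)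
    linarith
  have h6 := sum_le_sum h4
  rw [← mul_sum, sum_sub_distrib, sum_const, nsmul_one, sum_add_distrib, sum_const,
    nsmul_eq_mul] at h6
  have h7 : (pm (2 * (m * d)) : ℝ) * (2 * (2 ^ d * θ)) ≤ pm (2 * (m * d)) * (δ / 4) :=
    mul_le_mul_of_nonneg_left hθ4 (Nat.cast_nonneg _)
  have h8 : (S.card : ℝ) * (B₀ * (δ / 4)) ≤ pm (2 * (m * d)) * (B₀ * (δ / 4)) :=
    mul_le_mul_of_nonneg_right hpm (by positivity)
  have h9 := mul_le_mul_of_nonneg_left (sub_le_sub hSc (h1.trans h7)) hB0.le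
  linarith [h9.trans h6]

/-- Lower bound for the weight of the pairs of matchings and selected graphs in `A`. -/
lemma le_sum_numGraph {L a : ℕ} (hL : Fintype.card I = L) (hd : 1 ≤ d) (hdL : d < L)
    (ha : a + (2 + 3 * L + 4 * (L * L)) = m) (ha2 : m ≤ 2 * a) {K θ δ : ℝ}
    (hK : K = Fintype.card (Fin d ↪ I)) (hK0 : 0 < K)
    (hθ : 0 ≤ θ) (hθ2 : (L : ℝ) ^ d / K - 1 ≤ θ ^ 2) (hθ3 : 2 ^ d * θ ≤ 1 / 2)
    (hθ4 : 2 * (2 ^ d * θ) ≤ δ / 4) (hL2 : (2 ^ (d + 3)) ^ 2 ≤ L)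
    (hm : (L : ℝ) / 2 ^ m ≤ δ / 4) {A : Finset (SimpleGraph (Fin (2 * m)))}
    (hA : δ * pm (2 * (m * d)) ≤ (univ.filter fun π : PM (Fin (2 * m) × Fin d) =>
      IsSimpleHalf π ∧ pairingGraph π ∈ A).card) {C : ℕ}
    (hC : C = (2 * (1 + 4 * L * (L + L * L)) ^ (2 * (4 * L * (L + L * L)))) ^ 2) :
    δ / 2 / (2 ^ L * C) * bethe (d / L) L d (2 * m) K * (pm (2 * m) : ℝ) ^ L ≤
      ∑ h : I → PM (Fin (2 * m)), ind (Disj h) * ∑ G ∈ A, numGraph d h G := by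
  have : Nonempty I := Fintype.card_pos_iff.1 (by omega)
  set S := univ.filter fun π : PM (Fin (2 * m) × Fin d) => IsSimpleHalf π ∧ pairingGraph π ∈ A
  have hS : ∀ π ∈ S, IsSimpleHalf π := fun π h => by
    rw [mem_filter] at h
    exact h.2.1
  set B₀ := K ^ (2 * m) / (L : ℝ) ^ (m * d) with hB₀
  have hL0 : (0 : ℝ) < L := by exact_mod_cast (Nat.zero_le d).trans_lt hdL
  have hB0 : 0 < B₀ := by rw [hB₀]; positivity
  have hC0 : (0 : ℝ) < C := by
    rw [hC]
    positivity
  have hpm : (0 : ℝ) < pm (2 * (m * d)) := by exact_mod_cast pm_pos _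
  have h1 := sum_balanced_ge (I := I) (B₀ := B₀) (S := S) hK hK0 (by rw [hL]) hθ (by rwa [hL])
    hθ3 hθ4 (by rwa [hL]) (by rwa [hL]) (fun π h => (hS π h).fst_ne) hA
  set R := bethe (d / L) L d (2 * m) K * (pm (2 * m) : ℝ) ^ L with hR
  have hR0 : 0 ≤ R := by
    rw [hR]
    unfold bethe
    positivity
  have h2 : ∀ π ∈ S, ∀ c : Fin (2 * m) → Fin d ↪ I,
      R * ind (HalfCompat π c ∧ Balanced m c) ≤ 2 ^ L * C * (pm (2 * (m * d)) * B₀) *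
        (ind (HalfCompat π c) *
          ((univ.filter fun M : I → PM (Fin (2 * m)) => Disj M ∧ Extends M c π).card : ℝ)) := by
    intro π hπ c
    by_cases hc : HalfCompat π c ∧ Balanced m c
    · rw [ind_of hc, ind_of hc.1, mul_one, one_mul]
      have h3 := bethe_mul_pm_pow_le (I := I) (K := K) (d := d) (m := m) (s := colCount c) hK0.le hd
        (by omega) (by rwa [hL]) (fun j => (hc.2 j).trans (by omega)) (even_colCount hc.1)
        (sum_colCount c)
      rw [hL, ← hB₀, ← hR] at h3
      refine h3.trans ?_
      have h4 := prod_pm_le_card_extends hL hdL.le ha ha2 rfl (hS π hπ) hc.1 hc.2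
      rw [← hC] at h4
      have h5 : (∏ j, (pm (2 * m - colCount c j) : ℝ)) ≤ C *
          ((univ.filter fun M : I → PM (Fin (2 * m)) => Disj M ∧ Extends M c π).card : ℝ) := by
        exact_mod_cast h4
      calc _ ≤ (2 : ℝ) ^ L * (pm (2 * (m * d)) * B₀ * (C *
            ((univ.filter fun M : I → PM (Fin (2 * m)) => Disj M ∧ Extends M c π).card : ℝ))) := by
            gcongr
        _ = _ := by ring
    · rw [ind_of_not hc, mul_zero]
      have := ind_nonneg (HalfCompat π c)
      positivity
  have h3 : R * ∑ π ∈ S, ∑ c : Fin (2 * m) → Fin d ↪ I, ind (HalfCompat π c ∧ Balanced m c) ≤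
      2 ^ L * C * (pm (2 * (m * d)) * B₀) *
        ∑ h : I → PM (Fin (2 * m)), ind (Disj h) * ∑ G ∈ A, numGraph d h G := by
    refine le_trans ?_ (mul_le_mul_of_nonneg_left (sum_card_extends_le A) (by positivity))
    rw [mul_sum, mul_sum]
    refine sum_le_sum fun π hπ => ?_
    rw [mul_sum, mul_sum]
    exact sum_le_sum fun c _ => h2 π hπ c
  have h4 := (mul_le_mul_of_nonneg_left h1 hR0).trans h3
  rw [mul_assoc, ← hR, div_mul_eq_mul_div, div_le_iff₀ (by positivity)]
  refine le_of_mul_le_mul_right ?_ (show 0 < pm (2 * (m * d)) * B₀ by positivity)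
  linarith

end

lemma pow_div_descFactorial_le {d l : ℕ} (hd : 1 ≤ d) (hl : 2 * d ≤ l) :
    ((l * d : ℕ) : ℝ) ^ d / ((l * d).descFactorial d : ℕ) - 1 ≤ 2 * d / l := by
  have hd0 : (0 : ℝ) < d := by exact_mod_cast hd
  have hl0 : (0 : ℝ) < l := by exact_mod_cast (show 0 < l by omega)
  have hl' : (2 * d : ℝ) ≤ l := by exact_mod_cast hl
  have hle : d ≤ l * d := Nat.le_mul_of_pos_left _ (by omega)
  have h1 : ((l * d : ℕ) : ℝ) ^ d * (1 - d / l) ≤ ((l * d).descFactorial d : ℕ) := by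
    have h2 : ((l * d + 1 - d : ℕ) : ℝ) ^ d ≤ ((l * d).descFactorial d : ℕ) := by
      exact_mod_cast Nat.pow_sub_le_descFactorial (l * d) d
    have h3 : (d * l * (1 - 1 / l) : ℝ) ≤ ((l * d + 1 - d : ℕ) : ℝ) := by
      rw [Nat.cast_sub (by omega)]
      push_cast
      have : (d * l * (1 - 1 / l) : ℝ) = d * l - d := by field_simp
      rw [this]
      linarith
    have h0 : (0 : ℝ) ≤ 1 - 1 / l := by
      rw [sub_nonneg, div_le_one hl0]
      exact_mod_cast (show 1 ≤ l by omega)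
    have h4 : (1 : ℝ) - d / l ≤ (1 - 1 / l) ^ d := by
      have := one_add_mul_le_pow (a := (-(1 / l) : ℝ)) (by linarith) d
      calc (1 : ℝ) - d / l = 1 + d * (-(1 / l)) := by ring
        _ ≤ _ := this
        _ = _ := by ring
    calc ((l * d : ℕ) : ℝ) ^ d * (1 - d / l) ≤ ((l * d : ℕ) : ℝ) ^ d * (1 - 1 / l) ^ d :=
          mul_le_mul_of_nonneg_left h4 (by positivity)
      _ = (d * l * (1 - 1 / l)) ^ d := by
          rw [← mul_pow]
          push_cast
          ring
      _ ≤ _ := (pow_le_pow_left₀ (by positivity) h3 _).trans h2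
  have h5 : (0 : ℝ) < ((l * d).descFactorial d : ℕ) := by
    exact_mod_cast Nat.descFactorial_pos.2 hle
  rw [sub_le_iff_le_add, div_le_iff₀ h5]
  have h6 : (1 : ℝ) ≤ (2 * d / l + 1) * (1 - d / l) := by
    have h7 : (d / l : ℝ) ≤ 1 / 2 := by
      rw [div_le_iff₀ hl0]
      linarith
    have h8 : (0 : ℝ) ≤ d / l := by positivity
    have : (2 * d / l : ℝ) = 2 * (d / l) := by ring
    rw [this]
    nlinarith
  calc ((l * d : ℕ) : ℝ) ^ d ≤ ((l * d : ℕ) : ℝ) ^ d * ((2 * d / l + 1) * (1 - d / l)) :=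
        le_mul_of_one_le_right (by positivity) h6
    _ = (2 * d / l + 1) * (((l * d : ℕ) : ℝ) ^ d * (1 - d / l)) := by ring
    _ ≤ _ := mul_le_mul_of_nonneg_left h1 (by positivity)

lemma le_card_pairingGraph_mem {n d C : ℕ} (hd : 1 ≤ d) (hC : C = 2 * (d + d * d))
    (hn : 2 * (3 + 3 * d + 4 * (d * d)) ≤ n) (he : Even n) :
    ∑ G, mu n d G = 1 ∧ ∀ (ε : ℝ), 0 < ε → ∀ A : Finset (SimpleGraph (Fin n)),
      ε ≤ ∑ G ∈ A, mu n d G →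
      ε / ((2 * (1 + C) ^ (2 * C)) ^ 2 : ℕ) * pm (n * d) ≤
        (univ.filter fun π : PM (Fin n × Fin d) => IsSimpleHalf π ∧ pairingGraph π ∈ A).card := by
  have h1 := card_simple_pairings hd hC hn
  rw [card_univ, card_PM, Fintype.card_prod, Fintype.card_fin, Fintype.card_fin] at h1
  have hpm : 0 < pm (n * d) := by
    obtain ⟨t, rfl⟩ := he
    rw [← two_mul, mul_assoc]
    exact pm_pos _
  set P := (2 * (1 + C) ^ (2 * C)) ^ 2 with hP
  have hP0 : (0 : ℝ) < P := by
    rw [hP]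
    positivity
  have h2 := card_pairingGraph_mem (d := d) (univ : Finset (SimpleGraph (Fin n)))
  have h3 : (univ.filter fun π : PM (Fin n × Fin d) => IsSimpleHalf π) =
      univ.filter fun π : PM (Fin n × Fin d) => IsSimpleHalf π ∧ pairingGraph π ∈
        (univ : Finset (SimpleGraph (Fin n))) := by
    refine filter_congr fun π _ => ?_
    exact ⟨fun h => ⟨h, mem_univ _⟩, fun h => h.1⟩
  have h4 : (pm (n * d) : ℝ) ≤ P * ((d.factorial : ℝ) ^ n *
      (univ.filter fun G : SimpleGraph (Fin n) => IsRegularGraph G d).card) := by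
    rw [← h2, ← h3]
    exact_mod_cast h1
  set g : ℝ := ((univ.filter fun G : SimpleGraph (Fin n) => IsRegularGraph G d).card : ℝ)
  have hg0 : 0 ≤ g := Nat.cast_nonneg _
  have hpm' : (0 : ℝ) < pm (n * d) := by exact_mod_cast hpm
  have hg : 0 < g := by
    refine lt_of_le_of_ne hg0 fun h => ?_
    rw [← h] at h4
    simp only [mul_zero] at h4
    linarith
  refine ⟨?_, fun ε hε A hA => ?_⟩
  · rw [sum_mu]
    exact div_self hg.ne'
  · rw [sum_mu, le_div_iff₀ hg] at hA
    rw [card_pairingGraph_mem, div_mul_eq_mul_div, div_le_iff₀ hP0]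
    calc ε * (pm (n * d) : ℝ) ≤ ε * (P * ((d.factorial : ℝ) ^ n * g)) :=
          mul_le_mul_of_nonneg_left h4 hε.le
      _ = (d.factorial : ℝ) ^ n * (ε * g) * P := by ring
      _ ≤ _ := by gcongr

lemma exists_lower_bound (d : ℕ) (hd : 1 ≤ d) (ε : ℝ) (hε : 0 < ε) :
    ∃ l : ℕ, 2000 ≤ l ∧ ∃ c : ℝ, 0 < c ∧ ∃ N₀ : ℕ, ∀ m, N₀ ≤ 2 * m →
      ∑ G, mu (2 * m) d G = 1 ∧
      ∀ A : Finset (SimpleGraph (Fin (2 * m))), ε ≤ ∑ G ∈ A, mu (2 * m) d G →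
        c * bethe (d / (l * d : ℕ)) (l * d) d (2 * m) (Fintype.card (Fin d ↪ Fin (l * d))) *
          (pm (2 * m) : ℝ) ^ (l * d) ≤
        ∑ h : Fin (l * d) → PM (Fin (2 * m)), ind (Disj h) * ∑ G ∈ A, numGraph d h G := by
  obtain ⟨P, hP⟩ : ∃ P : ℕ, P = (2 * (1 + 2 * (d + d * d)) ^ (2 * (2 * (d + d * d)))) ^ 2 := ⟨_, rfl⟩
  have hP0 : (0 : ℝ) < P := by
    rw [hP]
    positivity
  obtain ⟨δ, hδ⟩ : ∃ δ : ℝ, δ = ε / P := ⟨_, rfl⟩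
  have hδ0 : 0 < δ := hδ ▸ div_pos hε hP0
  obtain ⟨θ, hθ⟩ : ∃ θ : ℝ, θ = min (1 / 2) (δ / 8) / 2 ^ d := ⟨_, rfl⟩
  have hθ0 : 0 < θ := by
    rw [hθ]
    positivity
  have hθ1 : 2 ^ d * θ = min (1 / 2) (δ / 8) := by
    rw [hθ]
    field_simp
  obtain ⟨l₀, hl₀⟩ := exists_nat_ge (2 * d / θ ^ 2)
  obtain ⟨l, hl⟩ : ∃ l : ℕ, l = max l₀ (max 2000 (max (2 * d) ((2 ^ (d + 3)) ^ 2))) := ⟨_, rfl⟩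
  have e1 : l₀ ≤ l := hl ▸ le_max_left _ _
  have e2 : 2000 ≤ l := hl ▸ (le_max_left _ _).trans (le_max_right _ _)
  have e3 : 2 * d ≤ l :=
    hl ▸ (le_max_left _ _).trans ((le_max_right _ _).trans (le_max_right _ _))
  have e4 : (2 ^ (d + 3)) ^ 2 ≤ l :=
    hl ▸ (le_max_right _ _).trans ((le_max_right _ _).trans (le_max_right _ _))
  obtain ⟨L, hL⟩ : ∃ L, L = l * d := ⟨_, rfl⟩
  have hlL : l ≤ L := hL ▸ Nat.le_mul_of_pos_right _ hd
  have hdL : d < L := by omega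
  obtain ⟨C, hC⟩ : ∃ C : ℕ,
    C = (2 * (1 + 4 * L * (L + L * L)) ^ (2 * (4 * L * (L + L * L)))) ^ 2 := ⟨_, rfl⟩
  have hC0 : (0 : ℝ) < C := by
    rw [hC]
    positivity
  have hlim : Tendsto (fun m : ℕ => (L : ℝ) / 2 ^ m) atTop (𝓝 0) := by
    have := (tendsto_pow_atTop_nhds_zero_of_lt_one (r := (1 / 2 : ℝ)) (by norm_num)
      (by norm_num)).const_mul (L : ℝ)
    rw [mul_zero] at this
    refine this.congr fun m => ?_
    rw [one_div, inv_pow, div_eq_mul_inv]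
  obtain ⟨m₀, hm₀⟩ := eventually_atTop.1 (hlim.eventually_le_const (show 0 < δ / 4 by positivity))
  have hK : (Fintype.card (Fin d ↪ Fin (l * d)) : ℝ) = ((l * d).descFactorial d : ℕ) := by
    rw [Fintype.card_embedding_eq, Fintype.card_fin, Fintype.card_fin]
  have hl0 : (0 : ℝ) < l := by exact_mod_cast (show 0 < l by omega)
  refine ⟨l, e2, δ / 2 / (2 ^ L * C), by positivity,
    2 * m₀ + 4 * (3 + 3 * L + 4 * (L * L)) + 2 * (3 + 3 * d + 4 * (d * d)), fun m hm => ?_⟩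
  obtain ⟨h1, h2⟩ := le_card_pairingGraph_mem (n := 2 * m) hd rfl (by omega) (even_two_mul m)
  refine ⟨h1, fun A hA => ?_⟩
  have h3 := h2 ε hε A hA
  rw [← hP, ← hδ, mul_assoc] at h3
  have h4 := le_sum_numGraph (I := Fin (l * d)) (L := L) (d := d) (m := m)
    (a := m - (2 + 3 * L + 4 * (L * L))) (K := Fintype.card (Fin d ↪ Fin (l * d))) (θ := θ)
    (δ := δ) (C := C) (by rw [Fintype.card_fin, hL]) hd hdL (by omega) (by omega) rfl
    (by rw [hK]; exact_mod_cast Nat.descFactorial_pos.2 (by omega)) hθ0.le ?_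
    (by rw [hθ1]; exact min_le_left _ _) ?_ (e4.trans hlL) (hm₀ m (by omega)) h3 hC
  · rw [hL] at h4 ⊢
    convert h4
  · rw [hK, hL]
    refine (pow_div_descFactorial_le hd e3).trans ?_
    rw [div_le_iff₀ hl0]
    rw [div_le_iff₀ (by positivity)] at hl₀
    have e1' : (l₀ : ℝ) ≤ l := by exact_mod_cast e1
    nlinarith [mul_le_mul_of_nonneg_right e1' (sq_nonneg θ)]
  · have := min_le_right (1 / 2) (δ / 8)
    rw [hθ1]
    linarith

end RegularCoupling

/-- For every `ε > 0` and `d ≥ 1` there is `k ≥ 1` such that for all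
sufficiently large even `n = 2m` there is a coupling of `G ~ μ_{d,n}` and
`G_⊕ ~ ν_{kd,n}` with `P(G ⊆ G_⊕) ≥ 1 - ε`. -/
theorem statement_18 (ε : ℝ) (hε : 0 < ε) (d : ℕ) (hd : 1 ≤ d) :
    ∃ k : ℕ, 1 ≤ k ∧ ∃ n₀ : ℕ, ∀ m : ℕ, n₀ ≤ 2*m →
      ∃ π : SimpleGraph (Fin (2*m)) × SimpleGraph (Fin (2*m)) → ℝ,
        IsCoupling π (mu (2*m) d) (nu (2*m) (k*d)) ∧
        1 - ε ≤ probOf π {p | p.1 ≤ p.2} :=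
  RegularCoupling.exists_coupling_of_kernel d
    (RegularCoupling.exists_kernel_of_lower_bound d hd (RegularCoupling.exists_lower_bound d hd)) ε hε
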